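/- arXiv:math/0508647 — 6 statements merged into one kernel-verified Lean document; each statement's English description precedes it below -/
import Mathlib

section
/- Let s ≥ 3 be an integer and let G be a finite group generated by an involution a and an element b of order s such that ab has order 3. If |G| ≡ 0 (mod 4), then the Cayley graph Cay(G,{a,b,b⁻¹}) has a Hamilton path. -/
/-- The Cayley graph `Cay(G, {a, b, b⁻¹})`: vertices are the elements of `G`,
with `g` adjacent to `h` iff `g⁻¹ * h ∈ {a, b, b⁻¹}`. -/
def cayleyGraph {G : Type*} [Group G] (a b : G) : SimpleGraph G :=
  SimpleGraph.fromRel (fun g h => g⁻¹ * h ∈ ({a, b, b⁻¹} : Set G))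

/-- The rank axioms of an integral 2-polymatroid, phrased through the insertion of one element. -/
structure IsTwoPolymatroid {V : Type*} [DecidableEq V] (r : Finset V → ℕ) : Prop where
  empty : r ∅ = 0
  le_insert : ∀ v S, r S ≤ r (insert v S)
  insert_le : ∀ v S, r (insert v S) ≤ r S + 2
  submod : ∀ v S T, S ⊆ T → r (insert v T) + r S ≤ r (insert v S) + r T

/-- Some set of `n` elements and rank `2 * n` gains full rank when `x` and `y` are both added. -/
def JointlyFree {V : Type*} [DecidableEq V] (r : Finset V → ℕ) (n : ℕ) (x y : V) : Prop :=
  ∃ M : Finset V, M.card = n ∧ r M = 2 * n ∧ r (insert x (insert y M)) = 2 * n + 2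

/-- `U` has `n + 1` elements and rank deficiency one, and becomes independent on removing
either of its distinct elements `p` and `q`. -/
structure SharesCircuit {V : Type*} [DecidableEq V] (r : Finset V → ℕ) (n : ℕ)
    (U : Finset V) (p q : V) : Prop where
  card_eq : U.card = n + 1
  left_mem : p ∈ U
  right_mem : q ∈ U
  ne : p ≠ q
  rank_eq : r U = 2 * n + 1
  rank_erase_left : r (U.erase p) = 2 * n
  rank_erase_right : r (U.erase q) = 2 * n

namespace IsTwoPolymatroid

variable {V : Type*} [DecidableEq V] {r : Finset V → ℕ}

theorem mono (h : IsTwoPolymatroid r) {S T : Finset V} (hST : S ⊆ T) : r S ≤ r T := by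
  have key : ∀ D : Finset V, r S ≤ r (D ∪ S) := by
    intro D
    induction D using Finset.induction_on with
    | empty => simp
    | insert v D _ ih =>
      rw [Finset.insert_union]
      exact ih.trans (h.le_insert _ _)
  simpa [Finset.sdiff_union_of_subset hST] using key (T \ S)

theorem union_le (h : IsTwoPolymatroid r) (D S : Finset V) : r (D ∪ S) ≤ r S + 2 * D.card := by
  induction D using Finset.induction_on with
  | empty => simp
  | insert v D hv ih =>
    rw [Finset.insert_union, Finset.card_insert_of_notMem hv]
    have := h.insert_le v (D ∪ S)
    omega

theorem le_two_mul_card (h : IsTwoPolymatroid r) (S : Finset V) : r S ≤ 2 * S.card := by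
  simpa [h.empty] using h.union_le S ∅

theorem eq_two_mul_card_of_subset (h : IsTwoPolymatroid r) {S M : Finset V}
    (hM : r M = 2 * M.card) (hS : S ⊆ M) : r S = 2 * S.card := by
  have h1 := h.union_le (M \ S) S
  rw [Finset.sdiff_union_of_subset hS, Finset.card_sdiff_of_subset hS] at h1
  have h2 := Finset.card_le_card hS
  have h3 := h.le_two_mul_card S
  omega

theorem exists_lt_insert (h : IsTwoPolymatroid r) {U W : Finset V} (hUW : r U < r W) :
    ∃ z ∈ W, r U < r (insert z U) := by
  by_contra! hcon
  have key : ∀ D ⊆ W, r (D ∪ U) ≤ r U := by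
    intro D
    induction D using Finset.induction_on with
    | empty => simp
    | insert v D _ ih =>
      intro hD
      rw [Finset.insert_union]
      have h1 := ih (by grind)
      have h2 := h.submod v U (D ∪ U) Finset.subset_union_right
      have h3 := hcon v (by grind)
      omega
  have := h.mono (S := W) (T := W ∪ U) Finset.subset_union_left
  have := key W subset_rfl
  omega

theorem submod_erase (h : IsTwoPolymatroid r) {u : V} {S T : Finset V} (hu : u ∈ S) (hST : S ⊆ T) :
    r T + r (S.erase u) ≤ r S + r (T.erase u) := by
  have := h.submod u (S.erase u) (T.erase u) (Finset.erase_subset_erase u hST)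
  rwa [Finset.insert_erase hu, Finset.insert_erase (hST hu)] at this

/-- The circuit of a set of rank deficiency one is not contained in an independent set. -/
theorem exists_erase (h : IsTwoPolymatroid r) {n : ℕ} {Y M : Finset V} (hY : Y.card = n + 1)
    (hrY : r Y = 2 * n + 1) (hM : r M = 2 * M.card) :
    ∃ u ∈ Y, u ∉ M ∧ r (Y.erase u) = 2 * n := by
  by_contra! hcon
  have key : ∀ D ⊆ Y \ M, r (Y \ D) + 2 * D.card ≤ 2 * n + 1 := by
    intro D
    induction D using Finset.induction_on with
    | empty => simp [hrY]
    | insert u D hu ih =>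
      intro hD
      have huY : u ∈ Y := by grind
      have h1 := ih (by grind)
      have h2 := h.submod_erase (u := u) (S := Y \ D) (T := Y) (by grind) Finset.sdiff_subset
      have h3 := hcon u huY (by grind)
      have h4 := h.le_two_mul_card (Y.erase u)
      rw [Finset.card_erase_of_mem huY] at h4
      rw [Finset.sdiff_insert, Finset.card_insert_of_notMem hu]
      omega
  have h1 := key (Y \ M) subset_rfl
  have h2 : r (Y ∩ M) = _ := h.eq_two_mul_card_of_subset hM Finset.inter_subset_right
  have h3 := Finset.card_sdiff_add_card_inter Y M
  rw [Finset.sdiff_sdiff_self_left] at h1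
  omega

theorem jointlyFree_comm {n : ℕ} {x y : V} (hxy : JointlyFree r n x y) : JointlyFree r n y x := by
  obtain ⟨M, h1, h2, h3⟩ := hxy
  exact ⟨M, h1, h2, by rwa [Finset.insert_comm]⟩

theorem not_jointlyFree_self {n : ℕ} (hmax : ∀ S : Finset V, S.card ≤ n + 1 → r S ≤ 2 * n + 1)
    (x : V) : ¬ JointlyFree r n x x := by
  rintro ⟨M, h1, -, h3⟩
  have h4 := hmax (insert x M) (by have := Finset.card_insert_le x M; omega)
  rw [Finset.insert_idem] at h3
  omega

/-- A Gallai-type lemma: failing to be jointly free is a transitive relation. -/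
theorem jointlyFree_or [Finite V] (h : IsTwoPolymatroid r) {n : ℕ}
    (hmax : ∀ S : Finset V, S.card ≤ n + 1 → r S ≤ 2 * n + 1) {x y t : V}
    (hxy : JointlyFree r n x y)
    (ht : ∃ N : Finset V, N.card = n ∧ r N = 2 * n ∧ r (insert t N) = 2 * n + 1) :
    JointlyFree r n x t ∨ JointlyFree r n t y := by
  obtain ⟨M, hMc, hMr, hW⟩ := hxy
  obtain ⟨N, ⟨hNc, hNr, hNt⟩, hbest⟩ := Set.exists_max_image
    {N : Finset V | N.card = n ∧ r N = 2 * n ∧ r (insert t N) = 2 * n + 1}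
    (fun N => (N ∩ M).card) (Set.toFinite _) ht
  obtain ⟨z, hzW, hz⟩ := h.exists_lt_insert (U := insert t N)
    (W := insert x (insert y M)) (by omega)
  have h1 := hmax (insert z N) (by have := Finset.card_insert_le z N; omega)
  have h2 := h.submod z N (insert t N) (Finset.subset_insert _ _)
  have hzr : r (insert z N) = 2 * n + 1 := by omega
  have hzt : r (insert z (insert t N)) = 2 * n + 2 := by omega
  by_cases hzx : z = x
  · subst hzx; exact Or.inl ⟨N, hNc, hNr, hzt⟩
  by_cases hzy : z = y
  · subst hzy; exact Or.inr ⟨N, hNc, hNr, by rwa [Finset.insert_comm]⟩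
  exfalso
  have hzM : z ∈ M := by grind
  have hzN : z ∉ insert t N := fun hmem => by rw [Finset.insert_eq_of_mem hmem] at hz; omega
  obtain ⟨u, huY, huM, hu⟩ := h.exists_erase (Y := insert z N) (M := M) (n := n) (by grind) hzr
    (by omega)
  have huN : u ∈ N := by grind
  have htN : t ∉ N := fun hmem => by rw [Finset.insert_eq_of_mem hmem] at hNt; omega
  have hc : ((insert z N).erase u).card = n := by grind
  have h3 := hmax (insert t ((insert z N).erase u))
    (by have := Finset.card_insert_le t ((insert z N).erase u); omega)
  have h4 := h.submod u ((insert z N).erase u) (insert t ((insert z N).erase u))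
    (Finset.subset_insert _ _)
  rw [Finset.insert_comm, Finset.insert_erase huY, Finset.insert_comm t z N] at h4
  have h5 := hbest ((insert z N).erase u) ⟨hc, hu, by omega⟩
  have h6 : insert z (N ∩ M) ⊆ (insert z N).erase u ∩ M := by grind
  have h7 := Finset.card_le_card h6
  rw [Finset.card_insert_of_notMem (by grind)] at h7
  grind

/-- Elements of a common circuit are not jointly free, provided no third element can be removed
together with either of them, while they cannot be removed together. -/
theorem not_jointlyFree_of_sharesCircuit [Finite V] (h : IsTwoPolymatroid r) {n : ℕ}
    (hmax : ∀ S : Finset V, S.card ≤ n + 1 → r S ≤ 2 * n + 1) {p q : V}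
    (hpq : ∃ U, SharesCircuit r n U p q)
    (hsep : ∀ U z, SharesCircuit r n U p q → z ∉ U → r (insert z U) = 2 * n + 2 →
      r (((insert z U).erase p).erase q) ≠ 2 * n) :
    ¬ JointlyFree r n p q := by
  rintro ⟨M, hMc, hMr, hW⟩
  obtain ⟨U, hU, hbest⟩ := Set.exists_max_image
    {U : Finset V | SharesCircuit r n U p q} (fun U => (U ∩ M).card) (Set.toFinite _) hpq
  obtain ⟨hUc, hp, hq, hne, hUr, hUp, hUq⟩ := id hU
  obtain ⟨z, hzW, hz⟩ := h.exists_lt_insert (U := U) (W := insert p (insert q M)) (by omega)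
  have hzU : z ∉ U := fun hmem => by rw [Finset.insert_eq_of_mem hmem] at hz; omega
  have hzM : z ∈ M := by grind
  have hpz : p ≠ z := fun e => hzU (e ▸ hp)
  have hqz : q ≠ z := fun e => hzU (e ▸ hq)
  set B := insert z U with hB
  have hBc : B.card = n + 2 := by grind
  have hrem : ∀ x ∈ U, r (U.erase x) = 2 * n → r (B.erase x) = 2 * n + 1 ∧ r B = 2 * n + 2 := by
    intro x hx hxr
    have h1 := hmax (B.erase x) (by grind)
    have h2 := h.submod z (U.erase x) U (Finset.erase_subset _ _)
    have h3 : insert z (U.erase x) = B.erase x := by grind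
    rw [h3] at h2
    have h4 := h.submod x (U.erase x) (B.erase x) (by grind)
    rw [Finset.insert_erase hx, Finset.insert_erase (by grind)] at h4
    omega
  obtain ⟨hBp, hBr⟩ := hrem p hp hUp
  obtain ⟨hBq, -⟩ := hrem q hq hUq
  have hBpq : r ((B.erase p).erase q) ≠ 2 * n := hsep U z hU hzU hBr
  obtain ⟨u, huB, huM, hu⟩ := h.exists_erase (Y := B.erase p) (M := M) (n := n) (by grind) hBp
    (by omega)
  have hup : u ≠ p := by grind
  have huB' : u ∈ B := by grind
  have huq : u ≠ q := by rintro rfl; exact hBpq hu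
  have huz : u ≠ z := by rintro rfl; exact huM hzM
  have huU : u ∈ U := by grind
  have h1 := hmax (B.erase u) (by grind)
  have h2 := h.submod_erase (u := u) (S := B.erase p) (T := B) (by grind) (Finset.erase_subset _ _)
  have h3 := h.le_two_mul_card ((B.erase u).erase q)
  have h4 : ((B.erase u).erase q).card = n := by grind
  have h5 := h.submod_erase (u := p) (S := (B.erase q).erase u) (T := B.erase q) (by grind)
    (Finset.erase_subset _ _)
  have h8 := h.le_two_mul_card ((B.erase p).erase q)
  have h9 : ((B.erase p).erase q).card = n := by grind
  have hindep : r (((B.erase q).erase u).erase p) = 2 * n - 2 := by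
    rw [h.eq_two_mul_card_of_subset (M := (B.erase p).erase u) (by grind) (by grind)]
    grind
  rw [Finset.erase_right_comm (s := B) (a := q) (b := p)] at h5
  have hn : 1 ≤ n := by grind [Finset.card_pos]
  have h10 : r ((B.erase q).erase u) = 2 * n := by
    rw [Finset.erase_right_comm] at h3 h4
    omega
  have h11 := hbest (B.erase u) ⟨by grind, by grind, by grind, hne, by omega,
    by rwa [Finset.erase_right_comm], by rwa [Finset.erase_right_comm]⟩
  have h12 : insert z (U ∩ M) ⊆ B.erase u ∩ M := by grind
  have h13 := Finset.card_le_card h12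
  rw [Finset.card_insert_of_notMem (by grind)] at h13
  grind

end IsTwoPolymatroid

section Link

variable {D V : Type*}

/-- The equivalence relation on darts generated by joining each dart with its reverse under `α`, and
joining the darts with a common base point in `S`. -/
def link (α : Equiv.Perm D) (π : D → V) (S : Finset V) : Setoid D :=
  Relation.EqvGen.setoid fun x y => y = α x ∨ (π x ∈ S ∧ π x = π y)

/-- The classes of `link α π S` containing a dart based at `v`. -/
def classesAt (α : Equiv.Perm D) (π : D → V) (S : Finset V) (v : V) :
    Set (Quotient (link α π S)) :=
  (fun d => (⟦d⟧ : Quotient (link α π S))) '' (π ⁻¹' {v})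

/-- The number of classes lost when the darts based at each element of `S` are joined. -/
noncomputable def linkRank (α : Equiv.Perm D) (π : D → V) (S : Finset V) : ℕ :=
  Nat.card (Quotient (link α π ∅)) - Nat.card (Quotient (link α π S))

variable {α : Equiv.Perm D} {π : D → V} {S T : Finset V}

theorem link_apply (x : D) : link α π S x (α x) := Relation.EqvGen.rel _ _ (Or.inl rfl)

theorem link_of_mem {x y : D} (hx : π x ∈ S) (hxy : π x = π y) : link α π S x y :=
  Relation.EqvGen.rel _ _ (Or.inr ⟨hx, hxy⟩)

theorem link_le_iff {s : Setoid D} :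
    link α π S ≤ s ↔ (∀ x, s x (α x)) ∧ ∀ x y, π x ∈ S → π x = π y → s x y := by
  refine ⟨fun h => ⟨fun x => h (link_apply x), fun x y hx hxy => h (link_of_mem hx hxy)⟩, ?_⟩
  rintro ⟨h1, h2⟩
  refine Setoid.eqvGen_le ?_
  rintro x y (rfl | ⟨hx, hxy⟩)
  exacts [h1 x, h2 x y hx hxy]

theorem link_mono (hST : S ⊆ T) : link α π S ≤ link α π T :=
  link_le_iff.2 ⟨link_apply, fun _ _ hx hxy => link_of_mem (hST hx) hxy⟩

theorem link_insert_iff [DecidableEq V] {v : V} {x y : D} :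
    link α π (insert v S) x y ↔ link α π S x y ∨
      ∃ x' y', π x' = v ∧ π y' = v ∧ link α π S x x' ∧ link α π S y y' := by
  constructor
  · let s : Setoid D :=
      { r := fun x y => link α π S x y ∨
          ∃ x' y', π x' = v ∧ π y' = v ∧ link α π S x x' ∧ link α π S y y'
        iseqv :=
          { refl := fun x => Or.inl (Setoid.refl' _ x)
            symm := by
              rintro x y (h | ⟨x', y', h1, h2, h3, h4⟩)
              exacts [Or.inl (Setoid.symm' _ h), Or.inr ⟨y', x', h2, h1, h4, h3⟩]
            trans := by
              rintro x y z (h | ⟨x', y', h1, h2, h3, h4⟩) (k | ⟨y'', z', k1, k2, k3, k4⟩)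
              · exact Or.inl (Setoid.trans' _ h k)
              · exact Or.inr ⟨y'', z', k1, k2, Setoid.trans' _ h k3, k4⟩
              · exact Or.inr ⟨x', y', h1, h2, h3, Setoid.trans' _ (Setoid.symm' _ k) h4⟩
              · exact Or.inr ⟨x', z', h1, k2, h3, k4⟩ } }
    have hs : link α π (insert v S) ≤ s := by
      refine link_le_iff.2 ⟨fun x => Or.inl (link_apply x), fun x y hx hxy => ?_⟩
      rcases Finset.mem_insert.1 hx with hx | hx
      · exact Or.inr ⟨x, y, hx, hxy ▸ hx, Setoid.refl' _ x, Setoid.refl' _ y⟩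
      · exact Or.inl (link_of_mem hx hxy)
    exact fun h => hs h
  · have hle : link α π S ≤ link α π (insert v S) := link_mono (Finset.subset_insert v S)
    rintro (h | ⟨x', y', h1, h2, h3, h4⟩)
    · exact hle h
    · exact Setoid.trans' _ (hle h3) (Setoid.trans' _
        (link_of_mem (by simp [h1]) (h1.trans h2.symm)) (Setoid.symm' _ (hle h4)))

/-- A pair of mutually reverse darts with both base points outside `S` is a class of its own. -/
theorem eq_or_eq_of_link (hα : Function.Involutive α) {d x : D} (h1 : π d ∉ S) (h2 : π (α d) ∉ S)
    (h : link α π S d x) : x = d ∨ x = α d := by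
  have hs : link α π S ≤ Setoid.comap (fun x => x = d ∨ x = α d) ⊥ := by
    refine link_le_iff.2 ⟨fun x => propext ?_, fun x y hx hxy => propext ?_⟩
    · have h3 : α x = α d ↔ x = d := α.injective.eq_iff
      have h4 : α x = d ↔ x = α d := by rw [← α.injective.eq_iff, hα]
      change x = d ∨ x = α d ↔ α x = d ∨ α x = α d
      rw [h3, h4, or_comm]
    · have key : ∀ z, π z ∈ S → ¬ (z = d ∨ z = α d) := by rintro z hz (rfl | rfl) <;> contradiction
      exact iff_of_false (key x hx) (key y (hxy ▸ hx))
  have hdx : (d = d ∨ d = α d) = (x = d ∨ x = α d) := hs h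
  exact hdx ▸ Or.inl rfl

theorem classesAt_ncard_anti [Finite D] (hST : S ⊆ T) (v : V) :
    (classesAt α π T v).ncard ≤ (classesAt α π S v).ncard := by
  have : classesAt α π T v = Quotient.map' id (link_mono hST) '' classesAt α π S v := by
    simp [classesAt, Set.image_image]
  rw [this]
  exact Set.ncard_image_le (Set.toFinite _)

theorem card_quotient_insert [Finite D] [DecidableEq V] {v : V} (hv : ∃ d, π d = v) :
    Nat.card (Quotient (link α π (insert v S))) + (classesAt α π S v).ncard =
      Nat.card (Quotient (link α π S)) + 1 := by
  obtain ⟨d, hd⟩ := hv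
  set q : Quotient (link α π S) → Quotient (link α π (insert v S)) :=
    Quotient.map' id (link_mono (Finset.subset_insert v S))
  have himage : q '' (classesAt α π S v)ᶜ = {⟦d⟧}ᶜ := by
    ext z
    induction z using Quotient.inductionOn with | _ x
    simp only [Set.mem_image, Set.mem_compl_iff, Set.mem_singleton_iff]
    constructor
    · rintro ⟨w, hw, hwx⟩ hx
      induction w using Quotient.inductionOn with | _ w
      have hwd : link α π (insert v S) w d := Quotient.exact (hwx.trans hx)
      rcases link_insert_iff.1 hwd with h | ⟨w', -, hw', -, h, -⟩
      · exact hw ⟨d, hd, Quotient.sound (Setoid.symm' _ h)⟩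
      · exact hw ⟨w', hw', Quotient.sound (Setoid.symm' _ h)⟩
    · intro hx
      refine ⟨⟦x⟧, ?_, rfl⟩
      rintro ⟨y, hy, hyx⟩
      refine hx (Quotient.sound (link_insert_iff.2 (Or.inr ⟨y, d, hy, hd, ?_, Setoid.refl' _ d⟩)))
      exact Setoid.symm' _ (Quotient.exact hyx)
  have hinj : Set.InjOn q (classesAt α π S v)ᶜ := by
    intro z hz w hw hzw
    induction z using Quotient.inductionOn with | _ z
    induction w using Quotient.inductionOn with | _ w
    rcases link_insert_iff.1 (Quotient.exact hzw : link α π (insert v S) z w) with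
      h | ⟨z', -, hz', -, h, -⟩
    · exact Quotient.sound h
    · exact absurd ⟨z', hz', Quotient.sound (Setoid.symm' _ h)⟩ hz
  have h1 := hinj.ncard_image
  have h2 := Set.ncard_add_ncard_compl (classesAt α π S v)
  have h3 := Set.ncard_add_ncard_compl {(⟦d⟧ : Quotient (link α π (insert v S)))}
  rw [himage] at h1
  rw [Set.ncard_singleton] at h3
  omega

theorem classesAt_ncard_pos [Finite D] {v : V} (hv : ∃ d, π d = v) :
    0 < (classesAt α π S v).ncard := by
  obtain ⟨d, hd⟩ := hv
  exact (Set.ncard_pos (Set.toFinite _)).2 ⟨_, d, hd, rfl⟩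

theorem classesAt_ncard_le_one [Finite D] {v : V}
    (h : ∀ x y, π x = v → π y = v → link α π S x y) : (classesAt α π S v).ncard ≤ 1 := by
  refine (Set.ncard_le_one (Set.toFinite _)).2 ?_
  rintro _ ⟨x, hx, rfl⟩ _ ⟨y, hy, rfl⟩
  exact Quotient.sound (h x y hx hy)

theorem classesAt_ncard_le [Finite D] {v : V} :
    (classesAt α π S v).ncard ≤ (π ⁻¹' {v}).ncard :=
  Set.ncard_image_le (Set.toFinite _)

theorem classesAt_ncard_eq_iff [Finite D] {v : V} :
    (classesAt α π S v).ncard = (π ⁻¹' {v}).ncard ↔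
      ∀ x y, π x = v → π y = v → link α π S x y → x = y := by
  rw [classesAt, Set.ncard_image_iff (Set.toFinite _)]
  exact ⟨fun h x y hx hy hxy => h hx hy (Quotient.sound hxy),
    fun h x hx y hy hxy => h x y hx hy (Quotient.exact hxy)⟩

theorem card_quotient_le [Finite D] [DecidableEq V] (hπ : Function.Surjective π) :
    Nat.card (Quotient (link α π S)) ≤ Nat.card (Quotient (link α π ∅)) := by
  induction S using Finset.induction_on with
  | empty => rfl
  | insert v S _ ih =>
    have h1 := card_quotient_insert (α := α) (S := S) (hπ v)
    have h2 := classesAt_ncard_pos (α := α) (S := S) (hπ v)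
    omega

theorem linkRank_insert [Finite D] [DecidableEq V] (hπ : Function.Surjective π) (v : V)
    (S : Finset V) :
    linkRank α π (insert v S) + 1 = linkRank α π S + (classesAt α π S v).ncard := by
  have h1 := card_quotient_insert (α := α) (S := S) (hπ v)
  have h2 := card_quotient_le (α := α) (S := S) hπ
  have h3 := card_quotient_le (α := α) (S := insert v S) hπ
  simp only [linkRank]
  omega

theorem isTwoPolymatroid_linkRank [Finite D] [DecidableEq V] (hπ : Function.Surjective π)
    (h3 : ∀ v, (π ⁻¹' {v}).ncard = 3) : IsTwoPolymatroid (linkRank α π) where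
  empty := by simp [linkRank]
  le_insert v S := by
    have h1 := linkRank_insert (α := α) hπ v S
    have h2 := classesAt_ncard_pos (α := α) (S := S) (hπ v)
    omega
  insert_le v S := by
    have h1 := linkRank_insert (α := α) hπ v S
    have h2 := classesAt_ncard_le (α := α) (π := π) (S := S) (v := v)
    have := h3 v
    omega
  submod v S T hST := by
    have h1 := linkRank_insert (α := α) hπ v S
    have h2 := linkRank_insert (α := α) hπ v T
    have h3 := classesAt_ncard_anti (α := α) (π := π) hST v
    omega

theorem surjective_of_ncard_fiber (h3 : ∀ v, (π ⁻¹' {v}).ncard = 3) : Function.Surjective π := by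
  intro v
  obtain ⟨d, hd⟩ := Set.nonempty_of_ncard_ne_zero (s := π ⁻¹' {v}) (by rw [h3]; norm_num)
  exact ⟨d, hd⟩

theorem eq_or_eq_or_eq_of_ncard_fiber [Finite D] (h3 : ∀ v, (π ⁻¹' {v}).ncard = 3) {v : V} {x y w u : D}
    (hx : π x = v) (hy : π y = v) (hw : π w = v) (hu : π u = v) (hxy : x ≠ y) (hxw : x ≠ w)
    (hyw : y ≠ w) : u = x ∨ u = y ∨ u = w := by
  have hsub : ({x, y, w} : Set D) ⊆ π ⁻¹' {v} := by
    rintro z (rfl | rfl | rfl) <;> assumption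
  have hcard : ({x, y, w} : Set D).ncard = 3 := Set.ncard_eq_three.2 ⟨x, y, w, hxy, hxw, hyw, rfl⟩
  have heq := Set.eq_of_subset_of_ncard_le hsub (by rw [h3, hcard]) (Set.toFinite _)
  have : u ∈ ({x, y, w} : Set D) := heq ▸ hu
  simpa using this

theorem link_map {e : Equiv.Perm D} {g : Equiv.Perm V} (hα : ∀ x, α (e x) = e (α x))
    (hπ : ∀ x, π (e x) = g (π x)) {S : Finset V} {x y : D} (h : link α π S x y) :
    link α π (S.map g.toEmbedding) (e x) (e y) := by
  have hle : link α π S ≤ (link α π (S.map g.toEmbedding)).comap e := by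
    refine link_le_iff.2 ⟨fun x => ?_, fun x y hx hxy => ?_⟩
    · rw [Setoid.comap_rel, ← hα]
      exact link_apply _
    · exact link_of_mem (by simpa [hπ] using hx) (by rw [hπ, hπ, hxy])
  exact hle h

theorem linkRank_map {e : Equiv.Perm D} {g : Equiv.Perm V} (hα : ∀ x, α (e x) = e (α x))
    (hπ : ∀ x, π (e x) = g (π x)) (S : Finset V) :
    linkRank α π (S.map g.toEmbedding) = linkRank α π S := by
  have : Nat.card (Quotient (link α π (S.map g.toEmbedding))) =
      Nat.card (Quotient (link α π S)) := by
    refine (Nat.card_congr (Quotient.congr e fun x y => ⟨link_map hα hπ, fun h => ?_⟩)).symm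
    have h' := link_map (e := e.symm) (g := g.symm) (fun x => by rw [e.eq_symm_apply, ← hα]; simp)
      (fun x => by rw [g.eq_symm_apply, ← hπ]; simp) h
    have hS : (S.map g.toEmbedding).map g.symm.toEmbedding = S := by ext; simp
    rwa [e.symm_apply_apply, e.symm_apply_apply, hS] at h'
  rw [linkRank, linkRank, this]

theorem SharesCircuit.map [DecidableEq V] {e : Equiv.Perm D} {g : Equiv.Perm V} (hα : ∀ x, α (e x) = e (α x))
    (hπ : ∀ x, π (e x) = g (π x)) {n : ℕ} {U : Finset V} {p q : V}
    (h : SharesCircuit (linkRank α π) n U p q) :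
    SharesCircuit (linkRank α π) n (U.map g.toEmbedding) (g p) (g q) := by
  obtain ⟨h1, h2, h3, h4, h5, h6, h7⟩ := h
  have he : ∀ x, (U.map g.toEmbedding).erase (g x) = (U.erase x).map g.toEmbedding := by
    intro x
    rw [Finset.map_erase]; rfl
  refine ⟨by rwa [Finset.card_map], by simpa, by simpa, by simpa, ?_, ?_, ?_⟩
  · rwa [linkRank_map hα hπ]
  · rwa [he, linkRank_map hα hπ]
  · rwa [he, linkRank_map hα hπ]

end Link

section CubicLink

variable {D V : Type*} [Finite D] [DecidableEq V] {α : Equiv.Perm D} {π : D → V}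

theorem exists_link_of_linkRank_insert_le (h3 : ∀ v, (π ⁻¹' {v}).ncard = 3) {v : V} {S : Finset V}
    (h : linkRank α π (insert v S) ≤ linkRank α π S + 1) :
    ∃ x y, π x = v ∧ π y = v ∧ x ≠ y ∧ link α π S x y := by
  have h1 := linkRank_insert (α := α) (surjective_of_ncard_fiber h3) v S
  by_contra! hcon
  have h2 : (classesAt α π S v).ncard = (π ⁻¹' {v}).ncard :=
    classesAt_ncard_eq_iff.2 fun x y hx hy hxy => by_contra fun hne => hcon x y hx hy hne hxy
  rw [h3] at h2
  omega

theorem eq_of_link_of_linkRank_insert (h3 : ∀ v, (π ⁻¹' {v}).ncard = 3) {v : V} {S : Finset V}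
    (h : linkRank α π S + 2 ≤ linkRank α π (insert v S)) {x y : D} (hx : π x = v) (hy : π y = v)
    (hxy : link α π S x y) : x = y := by
  have h1 := linkRank_insert (α := α) (surjective_of_ncard_fiber h3) v S
  have h2 := classesAt_ncard_le (α := α) (π := π) (S := S) (v := v)
  have h4 := h3 v
  exact classesAt_ncard_eq_iff.1 (by omega) x y hx hy hxy

theorem linkRank_insert_le_of_link (h3 : ∀ v, (π ⁻¹' {v}).ncard = 3) {v : V} {S : Finset V}
    {x y w d : D} (hx : π x = v) (hy : π y = v) (hw : π w = v) (hxy : x ≠ y) (hxw : x ≠ w)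
    (hyw : y ≠ w) (hdx : link α π S d x) (hdy : link α π S d y) (hdw : link α π S d w) :
    linkRank α π (insert v S) ≤ linkRank α π S := by
  have h1 := linkRank_insert (α := α) (surjective_of_ncard_fiber h3) v S
  have key : ∀ u, π u = v → link α π S d u := by
    intro u hu
    rcases eq_or_eq_or_eq_of_ncard_fiber h3 hx hy hw hu hxy hxw hyw with rfl | rfl | rfl <;>
      assumption
  have h2 := classesAt_ncard_le_one (α := α) (S := S) (v := v)
    fun a b ha hb => Setoid.trans' _ (Setoid.symm' _ (key a ha)) (key b hb)
  omega

/-- Adjacent base points on a common circuit cannot be removed together from a larger set of rank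
deficiency two so as to leave an independent set. -/
theorem linkRank_erase_erase_ne (hα : Function.Involutive α) (h3 : ∀ v, (π ⁻¹' {v}).ncard = 3)
    {n : ℕ} (hmax : ∀ S : Finset V, S.card ≤ n + 1 → linkRank α π S ≤ 2 * n + 1) {d : D}
    {U : Finset V} {z : V} (hU : SharesCircuit (linkRank α π) n U (π d) (π (α d))) (hz : z ∉ U)
    (hB : linkRank α π (insert z U) = 2 * n + 2) :
    linkRank α π (((insert z U).erase (π d)).erase (π (α d))) ≠ 2 * n := by
  intro hR
  have hr := isTwoPolymatroid_linkRank (α := α) (surjective_of_ncard_fiber h3) h3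
  obtain ⟨hUc, hp, hq, hne, hUr, hUp, hUq⟩ := hU
  set p := π d with hpd
  set q := π (α d) with hqd
  set R := (U.erase p).erase q with hRdef
  have hzp : z ≠ p := fun e => hz (e ▸ hp)
  have hzq : z ≠ q := fun e => hz (e ▸ hq)
  have hpR : p ∉ R := by grind
  have hqR : q ∉ R := by grind
  have e1 : ((insert z U).erase p).erase q = insert z R := by grind
  have e2 : insert q R = U.erase p := by grind
  have e3 : insert p R = U.erase q := by grind
  have e4 : insert q (insert p R) = U := by grind
  have hRc : R.card + 1 = n := by grind
  have hRr : linkRank α π R + 2 = 2 * n := by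
    have := hr.eq_two_mul_card_of_subset (M := U.erase p) (S := R) (by grind)
      (Finset.erase_subset _ _)
    omega
  rw [e1] at hR
  have hzc := Finset.card_insert_le z R
  have isolated : ∀ x y, π x = π y → x ≠ y → link α π (insert z R) x y → x ≠ d ∧ x ≠ α d := by
    intro x y hxy hxne hl
    have hd1 : π d ∉ insert z R := by grind
    have hd2 : π (α d) ∉ insert z R := by grind
    constructor
    · rintro rfl
      rcases eq_or_eq_of_link hα hd1 hd2 hl with rfl | rfl
      exacts [hxne rfl, hne hxy]
    · rintro rfl
      rcases eq_or_eq_of_link hα hd2 (by rwa [hα]) hl with rfl | rfl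
      · exact hxne rfl
      · rw [hα] at hxy; exact hne hxy.symm
  have ends : ∀ v, linkRank α π R + 2 ≤ linkRank α π (insert v R) →
      ∃ x y, π x = v ∧ π y = v ∧ x ≠ y ∧ x ≠ d ∧ x ≠ α d ∧ y ≠ d ∧ y ≠ α d ∧
        ∃ x' y', π x' = z ∧ π y' = z ∧ x' ≠ y' ∧ link α π R x x' ∧ link α π R y y' := by
    intro v hv
    obtain ⟨x, y, hx, hy, hxy, hl⟩ := exists_link_of_linkRank_insert_le (α := α) h3
      (v := v) (S := insert z R) (by
        rw [hR]
        refine hmax _ ?_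
        have := Finset.card_insert_le v (insert z R)
        omega)
    obtain ⟨h1, h2⟩ := isolated x y (hx.trans hy.symm) hxy hl
    obtain ⟨h4, h5⟩ := isolated y x (hy.trans hx.symm) hxy.symm (Setoid.symm' _ hl)
    have hnot : ¬ link α π R x y := fun h => hxy (eq_of_link_of_linkRank_insert h3 hv hx hy h)
    rcases link_insert_iff.1 hl with h | ⟨x', y', hx', hy', hxx', hyy'⟩
    · exact absurd h hnot
    · refine ⟨x, y, hx, hy, hxy, h1, h2, h4, h5, x', y', hx', hy', ?_, hxx', hyy'⟩
      rintro rfl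
      exact hnot (Setoid.trans' _ hxx' (Setoid.symm' _ hyy'))
  obtain ⟨x, y, hx, hy, hxy, hxd, -, hyd, -, zx, zy, hzx, hzy, hzxy, hxz, hyz⟩ :=
    ends p (by rw [e3]; omega)
  obtain ⟨x', y', hx', hy', hxy', -, hxd', -, hyd', zx', zy', hzx', hzy', hzxy', hxz', hyz'⟩ :=
    ends q (by rw [e2]; omega)
  have hRp : link α π R ≤ link α π (insert p R) := link_mono (Finset.subset_insert _ _)
  have hpq : link α π (insert p R) ≤ link α π (insert q (insert p R)) :=
    link_mono (Finset.subset_insert _ _)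
  have toX : link α π (insert p R) d zx :=
    Setoid.trans' _ (link_of_mem (by simp [p]) hx.symm) (hRp hxz)
  have toY : link α π (insert p R) d zy :=
    Setoid.trans' _ (link_of_mem (by simp [p]) hy.symm) (hRp hyz)
  by_cases hcase : (zx' = zx ∨ zx' = zy) ∧ (zy' = zx ∨ zy' = zy)
  · have toX' : link α π (insert p R) d x' := by
      refine Setoid.trans' _ ?_ (Setoid.symm' _ (hRp hxz'))
      rcases hcase.1 with h | h <;> rw [h] <;> assumption
    have toY' : link α π (insert p R) d y' := by
      refine Setoid.trans' _ ?_ (Setoid.symm' _ (hRp hyz'))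
      rcases hcase.2 with h | h <;> rw [h] <;> assumption
    have := linkRank_insert_le_of_link h3 hx' hy' hqd.symm hxy' hxd' hyd' toX' toY' (link_apply d)
    rw [e4, e3] at this
    omega
  · have hda : link α π (insert q (insert p R)) d (α d) := link_apply d
    have toX' : link α π (insert q (insert p R)) d zx' :=
      Setoid.trans' _ (Setoid.trans' _ hda (link_of_mem (by simp [q]) hx'.symm)) (hpq (hRp hxz'))
    have toY' : link α π (insert q (insert p R)) d zy' :=
      Setoid.trans' _ (Setoid.trans' _ hda (link_of_mem (by simp [q]) hy'.symm)) (hpq (hRp hyz'))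
    have hthird : ∃ w, π w = z ∧ zx ≠ w ∧ zy ≠ w ∧ link α π (insert q (insert p R)) d w := by
      by_cases h : zx' = zx ∨ zx' = zy
      · exact ⟨zy', hzy', by grind, by grind, toY'⟩
      · exact ⟨zx', hzx', by grind, by grind, toX'⟩
    obtain ⟨w, hw, hw1, hw2, hdw⟩ := hthird
    have := linkRank_insert_le_of_link h3 hzx hzy hw hzxy hw1 hw2 (hpq toX) (hpq toY) hdw
    rw [e4] at this
    omega

theorem exists_sharesCircuit (hα : Function.Involutive α) (h3 : ∀ v, (π ⁻¹' {v}).ncard = 3)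
    (hloop : ∀ d, π (α d) ≠ π d) {n : ℕ} {N : Finset V} {p : V} (hNc : N.card = n)
    (hNr : linkRank α π N = 2 * n) (hp : linkRank α π (insert p N) = 2 * n + 1) :
    ∃ d U, SharesCircuit (linkRank α π) n U (π d) (π (α d)) := by
  have hr := isTwoPolymatroid_linkRank (α := α) (surjective_of_ncard_fiber h3) h3
  have hpN : p ∉ N := fun h => by rw [Finset.insert_eq_of_mem h] at hp; omega
  obtain ⟨x, y, rfl, hy, hxy, hl⟩ := exists_link_of_linkRank_insert_le (α := α) h3
    (v := p) (S := N) (by omega)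
  have hq : π (α x) ∈ N := by
    by_contra hq
    rcases eq_or_eq_of_link hα hpN hq hl with rfl | rfl
    exacts [hxy rfl, hloop x hy]
  set q := π (α x) with hqdef
  have hqp : q ≠ π x := hloop x
  have hn : 1 ≤ n := hNc ▸ Finset.card_pos.2 ⟨_, hq⟩
  have hNq : linkRank α π (N.erase q) + 2 = 2 * n := by
    rw [hr.eq_two_mul_card_of_subset (M := N) (by omega) (Finset.erase_subset _ _)]
    grind
  have e1 : (insert (π x) N).erase (π x) = N := Finset.erase_insert hpN
  have e2 : (insert (π x) N).erase q = insert (π x) (N.erase q) := by grind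
  refine ⟨x, insert (π x) N, by grind, by grind, by grind, hqp.symm, hp, by rw [e1, hNr], ?_⟩
  rw [← hqdef, e2]
  have hle := hr.insert_le (π x) (N.erase q)
  by_contra hne
  obtain ⟨w, w', hw, hw', hww', hlw⟩ := exists_link_of_linkRank_insert_le (α := α) h3
    (v := π x) (S := N.erase q) (by omega)
  have isolated : ∀ u, π u = π x → u ≠ x → ¬ link α π (N.erase q) x u := by
    intro u hu hux h
    rcases eq_or_eq_of_link hα (by grind) (by grind) h with rfl | rfl
    exacts [hux rfl, hqp hu]
  have hwx : w ≠ x := by rintro rfl; exact isolated w' hw' hww'.symm hlw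
  have hwx' : w' ≠ x := by rintro rfl; exact isolated w hw hww' (Setoid.symm' _ hlw)
  have hlN : link α π N w w' := link_mono (Finset.erase_subset _ _) hlw
  have hxw : link α π N x w := by
    rcases eq_or_eq_or_eq_of_ncard_fiber h3 rfl hw hw' hy hwx.symm hwx'.symm hww' with h | h | h
    · exact absurd h.symm hxy
    · rwa [h] at hl
    · rw [h] at hl; exact Setoid.trans' _ hl (Setoid.symm' _ hlN)
  have := linkRank_insert_le_of_link h3 rfl hw hw' hwx.symm hwx'.symm hww' (Setoid.refl' _ x) hxw
    (Setoid.trans' _ hxw hlN)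
  omega

/-- In a connected arc-transitive cubic graph, some independent set of base points joins the
darts into at most two classes. -/
theorem exists_independent_card_quotient_le_two [Fintype V] (hα : Function.Involutive α)
    (h3 : ∀ v, (π ⁻¹' {v}).ncard = 3) (hloop : ∀ d, π (α d) ≠ π d)
    (htrans : ∀ d d' : D, ∃ (e : Equiv.Perm D) (g : Equiv.Perm V),
      (∀ x, α (e x) = e (α x)) ∧ (∀ x, π (e x) = g (π x)) ∧ e d = d')
    (hconn : ∀ x y, link α π Finset.univ x y) :
    ∃ S : Finset V, linkRank α π S = 2 * S.card ∧ Nat.card (Quotient (link α π S)) ≤ 2 := by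
  have hsurj := surjective_of_ncard_fiber h3
  have hr := isTwoPolymatroid_linkRank (α := α) hsurj h3
  obtain ⟨N, hN, hbest⟩ := Set.exists_max_image {N : Finset V | linkRank α π N = 2 * N.card}
    Finset.card (Set.toFinite _) ⟨∅, by simp [hr.empty]⟩
  refine ⟨N, hN, ?_⟩
  obtain ⟨n, hn⟩ : ∃ n, N.card = n := ⟨_, rfl⟩
  have hNr : linkRank α π N = 2 * n := hn ▸ hN
  have hmax : ∀ S : Finset V, S.card ≤ n + 1 → linkRank α π S ≤ 2 * n + 1 := by
    intro S hS
    have h1 := hr.le_two_mul_card S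
    by_contra! hlt
    have := hbest S (by rw [Set.mem_ofPred_eq]; omega)
    omega
  suffices hle : linkRank α π Finset.univ ≤ 2 * n + 1 by
    have : Subsingleton (Quotient (link α π (Finset.univ : Finset V))) :=
      ⟨fun a b => Quotient.inductionOn₂ a b fun x y => Quotient.sound (hconn x y)⟩
    have h1 := Finite.card_le_one_iff_subsingleton.2 this
    have h2 := card_quotient_le (α := α) (S := N) hsurj
    rw [linkRank] at hle hNr
    omega
  by_contra! hlt
  obtain ⟨p, -, hp⟩ := hr.exists_lt_insert (U := N) (W := Finset.univ) (by omega)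
  have hpr : linkRank α π (insert p N) = 2 * n + 1 := by
    have := hmax (insert p N) (by have := Finset.card_insert_le p N; omega)
    omega
  obtain ⟨q, -, hq⟩ := hr.exists_lt_insert (U := insert p N) (W := Finset.univ) (by omega)
  have hqp : JointlyFree (linkRank α π) n q p := by
    refine ⟨N, hn, hNr, ?_⟩
    have h1 := hmax (insert q N) (by have := Finset.card_insert_le q N; omega)
    have h2 := hr.submod q N (insert p N) (Finset.subset_insert _ _)
    omega
  obtain ⟨d₀, U₀, hU₀⟩ := exists_sharesCircuit hα h3 hloop hn hNr hpr
  have hcirc : ∀ d, ∃ U, SharesCircuit (linkRank α π) n U (π d) (π (α d)) := by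
    intro d
    obtain ⟨e, g, he, hg, rfl⟩ := htrans d₀ d
    rw [he, hg, hg]
    exact ⟨_, hU₀.map he hg⟩
  have hadj : ∀ d, ¬ JointlyFree (linkRank α π) n (π d) (π (α d)) := fun d =>
    hr.not_jointlyFree_of_sharesCircuit hmax (hcirc d)
      fun U z hU hz hB => linkRank_erase_erase_ne hα h3 hmax hU hz hB
  let s : Setoid D :=
    { r := fun x y => ¬ JointlyFree (linkRank α π) n (π x) (π y)
      iseqv :=
        { refl := fun x => IsTwoPolymatroid.not_jointlyFree_self hmax _
          symm := fun h h' => h (IsTwoPolymatroid.jointlyFree_comm h')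
          trans := by
            intro x y z hxy hyz hxz
            obtain ⟨U, hU⟩ := hcirc y
            have hfree : ∃ N : Finset V, N.card = n ∧ linkRank α π N = 2 * n ∧
                linkRank α π (insert (π y) N) = 2 * n + 1 := by
              refine ⟨U.erase (π y), ?_, hU.rank_erase_left, ?_⟩
              · rw [Finset.card_erase_of_mem hU.left_mem, hU.card_eq, Nat.add_sub_cancel]
              · rw [Finset.insert_erase hU.left_mem, hU.rank_eq]
            exact (hr.jointlyFree_or hmax hxz hfree).elim hxy hyz } }
  have hs : link α π Finset.univ ≤ s := by
    refine link_le_iff.2 ⟨hadj, fun x y _ hxy => ?_⟩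
    change ¬ JointlyFree _ _ (π x) (π y)
    rw [hxy]
    exact IsTwoPolymatroid.not_jointlyFree_self hmax _
  obtain ⟨x, rfl⟩ := hsurj q
  obtain ⟨y, rfl⟩ := hsurj p
  exact hs (hconn x y) hqp

end CubicLink

section Perm

open Equiv.Perm

theorem Equiv.Perm.sameCycle_mul_apply {D : Type*} [Finite D] {σ f : Equiv.Perm D}
    (h : ∀ x y, σ x ≠ x → σ y ≠ y → f.SameCycle x y → x = y) (x : D) :
    (σ * f).SameCycle x (σ x) := by
  classical
  by_cases hx : σ x = x
  · rw [hx]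
  have hex : ∃ n, 0 < n ∧ (f ^ n) x = x :=
    ⟨orderOf f, orderOf_pos f, by rw [pow_orderOf_eq_one, one_apply]⟩
  have key : ∀ i, i < Nat.find hex → ((σ * f) ^ i) x = (f ^ i) x := by
    intro i
    induction i with
    | zero => simp
    | succ i ih =>
      intro hi
      rw [pow_succ', mul_apply, ih (by omega), mul_apply, ← mul_apply f, ← pow_succ']
      by_contra hne
      exact Nat.find_min hex hi ⟨by omega, (h _ _ hx hne (SameCycle.refl f x).pow_right).symm⟩
  obtain ⟨hpos, hfix⟩ := Nat.find_spec hex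
  obtain ⟨m, hm⟩ := Nat.exists_eq_succ_of_ne_zero hpos.ne'
  refine ⟨(m + 1 : ℕ), ?_⟩
  rw [zpow_natCast, pow_succ', mul_apply, key m (by omega), mul_apply, ← mul_apply f, ← pow_succ',
    ← Nat.succ_eq_add_one, ← hm, hfix]

/-- If distinct points moved by `σ` lie in distinct cycles of `f`, then the cycles of `σ * f` are
unions of cycles of `f`. -/
theorem Equiv.Perm.SameCycle.mul_left {D : Type*} [Finite D] {σ f : Equiv.Perm D}
    (h : ∀ x y, σ x ≠ x → σ y ≠ y → f.SameCycle x y → x = y) {x y : D} (hxy : f.SameCycle x y) :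
    (σ * f).SameCycle x y := by
  have step : ∀ z, (σ * f).SameCycle z (f z) := fun z =>
    SameCycle.trans ⟨1, by simp⟩ (sameCycle_mul_apply h (f z)).symm
  obtain ⟨n, rfl⟩ := hxy.exists_nat_pow_eq
  clear hxy
  induction n with
  | zero => rfl
  | succ n ih =>
    rw [pow_succ', mul_apply]
    exact ih.trans (step _)

theorem SimpleGraph.Connected.exists_isHamiltonian_of_perm {V : Type*} [Fintype V] [DecidableEq V]
    {Γ : SimpleGraph V} (hΓ : Γ.Connected) (f : Equiv.Perm V) (hf : ∀ x, Γ.Adj x (f x))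
    (h2 : Nat.card (Quotient (SameCycle.setoid f)) ≤ 2) :
    ∃ (u v : V) (p : Γ.Walk u v), p.IsHamiltonian := by
  have hsupp : ∀ x, x ∈ f.support := fun x => Equiv.Perm.mem_support.2 (hf x).ne'
  have hchain : ∀ x, (f.toList x).IsChain Γ.Adj := by
    intro x
    rw [List.isChain_iff_getElem]
    intro i hi
    simp only [getElem_toList, pow_succ', mul_apply]
    exact hf _
  have hmem : ∀ {x y}, y ∈ f.toList x ↔ f.SameCycle x y := by simp [mem_toList_iff, hsupp]
  have of_list : ∀ l : List V, l.IsChain Γ.Adj → l.Nodup → (∀ x, x ∈ l) →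
      ∃ (u v : V) (p : Γ.Walk u v), p.IsHamiltonian := by
    intro l hl hnd hall
    obtain ⟨x⟩ := hΓ.nonempty
    have hne := List.ne_nil_of_mem (hall x)
    refine ⟨_, _, SimpleGraph.Walk.ofSupport l hne hl, ?_⟩
    refine SimpleGraph.Walk.IsPath.isHamiltonian_of_mem ?_ ?_
    · rw [SimpleGraph.Walk.isPath_def, SimpleGraph.Walk.support_ofSupport]
      exact hnd
    · simpa using hall
  by_cases hex : ∃ x y, Γ.Adj x y ∧ ¬ f.SameCycle x y
  · obtain ⟨x, y, hxy, hnot⟩ := hex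
    refine of_list ((f.toList x).reverse ++ f.toList y) ?_ ?_ fun z => ?_
    · rw [List.isChain_append]
      refine ⟨?_, hchain y, ?_⟩
      · rw [List.isChain_reverse]
        exact (hchain x).imp fun _ _ h => h.symm
      · have hhead : ∀ w, (f.toList w).head? = some w := by
          intro w
          rw [List.head?_eq_getElem?, List.getElem?_eq_getElem
            (length_toList_pos_of_mem_support _ _ (hsupp w)), toList_getElem_zero _ _ (hsupp w)]
        simpa [List.getLast?_reverse, hhead] using hxy
    · rw [List.nodup_append']
      refine ⟨List.nodup_reverse.2 (nodup_toList _ _), nodup_toList _ _, fun z hz hz' => ?_⟩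
      rw [List.mem_reverse, hmem] at hz
      exact hnot (hz.trans (hmem.1 hz').symm)
    · rw [List.mem_append, List.mem_reverse, hmem, hmem]
      by_contra! hz
      let g : Fin 3 → Quotient (SameCycle.setoid f) := ![⟦x⟧, ⟦y⟧, ⟦z⟧]
      have hg : Function.Injective g := by
        have e1 : (⟦x⟧ : Quotient (SameCycle.setoid f)) ≠ ⟦y⟧ := fun e => hnot (Quotient.exact e)
        have e2 : (⟦x⟧ : Quotient (SameCycle.setoid f)) ≠ ⟦z⟧ := fun e => hz.1 (Quotient.exact e)
        have e3 : (⟦y⟧ : Quotient (SameCycle.setoid f)) ≠ ⟦z⟧ := fun e => hz.2 (Quotient.exact e)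
        intro i j hij
        fin_cases i <;> fin_cases j <;> simp_all [g, eq_comm]
      have := Nat.card_le_card_of_injective g hg
      rw [Nat.card_fin] at this
      omega
  · push Not at hex
    have hall : ∀ {x y} (_ : Γ.Walk x y), f.SameCycle x y := by
      intro x y p
      induction p with
      | nil => rfl
      | cons h _ ih => exact (hex _ _ h).trans ih
    obtain ⟨x⟩ := hΓ.nonempty
    exact of_list (f.toList x) (hchain x) (nodup_toList _ _) fun y =>
      hmem.2 (hall (hΓ.preconnected x y).some)

end Perm

section Rotate

variable {D V : Type*} [DecidableEq V] {ρ : Equiv.Perm D} {π : D → V}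

/-- The permutation acting as `ρ` on the darts based in `S` and fixing the other darts. -/
def rotate (ρ : Equiv.Perm D) (π : D → V) (hρ : ∀ x, π (ρ x) = π x) (S : Finset V) :
    Equiv.Perm D where
  toFun x := if π x ∈ S then ρ x else x
  invFun x := if π x ∈ S then ρ.symm x else x
  left_inv x := by
    by_cases hx : π x ∈ S <;> simp [hx, hρ]
  right_inv x := by
    have hx' : π (ρ.symm x) = π x := by rw [← hρ (ρ.symm x), Equiv.apply_symm_apply]
    by_cases hx : π x ∈ S <;> simp [hx, hx']

theorem rotate_apply (hρ : ∀ x, π (ρ x) = π x) (S : Finset V) (x : D) :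
    rotate ρ π hρ S x = if π x ∈ S then ρ x else x := rfl

theorem rotate_insert (hρ : ∀ x, π (ρ x) = π x) {v : V} {S : Finset V} (hv : v ∉ S) :
    rotate ρ π hρ (insert v S) = rotate ρ π hρ {v} * rotate ρ π hρ S := by
  ext x
  simp only [Equiv.Perm.mul_apply, rotate_apply, Finset.mem_insert, Finset.mem_singleton]
  grind

theorem link_of_sameCycle [Finite D] {α : Equiv.Perm D} (hρ : ∀ x, π (ρ x) = π x) {S : Finset V}
    {x y : D} (h : (rotate ρ π hρ S * α).SameCycle x y) : link α π S x y := by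
  have step : ∀ z, link α π S z ((rotate ρ π hρ S * α) z) := by
    intro z
    refine Setoid.trans' _ (link_apply z) ?_
    rw [Equiv.Perm.mul_apply, rotate_apply]
    split_ifs with hz
    exacts [link_of_mem hz (hρ _).symm, Setoid.refl' _ _]
  obtain ⟨n, rfl⟩ := h.exists_nat_pow_eq
  clear h
  induction n with
  | zero => exact Setoid.refl' _ _
  | succ n ih =>
    rw [pow_succ', Equiv.Perm.mul_apply]
    exact Setoid.trans' _ ih (step _)

theorem link_le_sameCycle [Finite D] {α : Equiv.Perm D} (hρ : ∀ x, π (ρ x) = π x)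
    (h3 : ∀ v, (π ⁻¹' {v}).ncard = 3) (hfib : ∀ x y, π x = π y → ∃ n : ℕ, (ρ ^ n) x = y)
    {S : Finset V} (hS : linkRank α π S = 2 * S.card) :
    link α π S ≤ Equiv.Perm.SameCycle.setoid (rotate ρ π hρ S * α) := by
  have hr := isTwoPolymatroid_linkRank (α := α) (surjective_of_ncard_fiber h3) h3
  induction S using Finset.induction_on with
  | empty =>
    refine link_le_iff.2 ⟨fun x => ⟨1, ?_⟩, fun x y hx => absurd hx (Finset.notMem_empty _)⟩
    simp [rotate_apply]
  | insert v S hv ih =>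
    have hS' := hr.eq_two_mul_card_of_subset hS (Finset.subset_insert v S)
    have ih := link_le_iff.1 (ih hS')
    rw [Finset.card_insert_of_notMem hv] at hS
    have moved : ∀ x, rotate ρ π hρ {v} x ≠ x → π x = v := by
      intro x hx
      by_contra hne
      exact hx (by simp [rotate_apply, hne])
    have sep : ∀ x y, rotate ρ π hρ {v} x ≠ x → rotate ρ π hρ {v} y ≠ y →
        (rotate ρ π hρ S * α).SameCycle x y → x = y := fun x y hx hy hxy =>
      eq_of_link_of_linkRank_insert h3 (by omega) (moved x hx) (moved y hy) (link_of_sameCycle hρ hxy)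
    rw [rotate_insert hρ hv, mul_assoc]
    refine link_le_iff.2 ⟨fun x => (ih.1 x).mul_left sep, fun x y hx hxy => ?_⟩
    rcases Finset.mem_insert.1 hx with hx | hx
    · obtain ⟨n, rfl⟩ := hfib x y hxy
      clear hxy
      have hn : ∀ n, π ((ρ ^ n) x) = v := by
        intro n
        induction n with
        | zero => exact hx
        | succ n ih => rw [pow_succ', Equiv.Perm.mul_apply, hρ, ih]
      induction n with
      | zero => exact Setoid.refl' _ _
      | succ n ih' =>
        refine Setoid.trans' _ ih' ?_
        have := Equiv.Perm.sameCycle_mul_apply sep ((ρ ^ n) x)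
        rw [rotate_apply, if_pos (Finset.mem_singleton.2 (hn n)), ← Equiv.Perm.mul_apply,
          ← pow_succ'] at this
        exact this
    · exact (ih.2 x y hx hxy).mul_left sep

end Rotate

section Cayley

variable {G : Type*} [Group G] {a b : G}

theorem cayleyGraph_adj_of_mul_eq {x y z : G} (hz : z ∈ ({a, b} : Set G)) (h1 : z ≠ 1)
    (h : x * z = y) : (cayleyGraph a b).Adj x y := by
  subst h
  rw [cayleyGraph, SimpleGraph.fromRel_adj]
  refine ⟨by simpa using h1, Or.inl ?_⟩
  rcases hz with rfl | rfl <;> simp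

theorem Setoid.rel_of_closure_eq_top (hgen : Subgroup.closure ({a, b} : Set G) = ⊤) {s : Setoid G}
    (hsa : ∀ x, s x (x * a)) (hsb : ∀ x, s x (x * b)) (x y : G) : s x y := by
  have hs : ∀ z ∈ ({a, b} : Set G), ∀ x, s x (x * z) := by
    rintro z (rfl | rfl)
    exacts [hsa, hsb]
  have key : ∀ g, ∀ x, s x (x * g) := by
    intro g
    have hg : g ∈ Subgroup.closure ({a, b} : Set G) := hgen ▸ Subgroup.mem_top g
    induction hg using Subgroup.closure_induction with
    | mem z hz => exact hs z hz
    | one => intro x; rw [mul_one]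
    | mul g h _ _ ihg ihh => intro x; rw [← mul_assoc]; exact s.trans' (ihg x) (ihh _)
    | inv g _ ih => intro x; simpa using s.symm' (ih (x * g⁻¹))
  simpa using key (x⁻¹ * y) x

theorem exists_isHamiltonian_cayleyGraph [Fintype G] [DecidableEq G] (ha : orderOf a = 2)
    (hb : b ≠ 1) (hab : orderOf (a * b) = 3) (hgen : Subgroup.closure ({a, b} : Set G) = ⊤) :
    ∃ (u v : G) (p : (cayleyGraph a b).Walk u v), p.IsHamiltonian := by
  classical
  set H := Subgroup.zpowers (a * b)
  let _ : Fintype (G ⧸ H) := Fintype.ofFinite _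
  set α : Equiv.Perm G := Equiv.mulRight a
  set ρ : Equiv.Perm G := Equiv.mulRight (a * b)
  set π : G → G ⧸ H := QuotientGroup.mk
  have haa : a * a = 1 := by rw [← pow_two, ← ha, pow_orderOf_eq_one]
  have ha1 : a ≠ 1 := by rintro rfl; simp at ha
  have hα : Function.Involutive α := fun x => by simp [α, mul_assoc, haa]
  have h3 : ∀ v, (π ⁻¹' {v}).ncard = 3 := fun v => by
    rw [← Nat.card_coe_set_eq, QuotientGroup.card_preimage_mk, Nat.card_zpowers, hab]
    simp
  have hρ : ∀ x, π (ρ x) = π x := fun x =>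
    QuotientGroup.mk_mul_of_mem x (Subgroup.mem_zpowers _)
  have hfib : ∀ x y, π x = π y → ∃ n : ℕ, (ρ ^ n) x = y := by
    intro x y hxy
    obtain ⟨n, hn⟩ := mem_zpowers_iff_mem_range_orderOf.1 (QuotientGroup.eq.1 hxy) |>
      Finset.mem_image.1 |>.imp fun _ h => h.2
    exact ⟨n, by simp only [ρ, Equiv.pow_mulRight, Equiv.coe_mulRight, hn, mul_inv_cancel_left]⟩
  have hab' : ∀ x, x * a * (a * b) = x * b := fun x => by
    rw [mul_assoc, ← mul_assoc a, haa, one_mul]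
  have hloop : ∀ d, π (α d) ≠ π d := by
    intro d hd
    have h1 : a ∈ H := by simpa [α] using QuotientGroup.eq.1 hd.symm
    have h2 := orderOf_dvd_of_mem_zpowers h1
    rw [ha, hab] at h2
    omega
  have htrans : ∀ d d', ∃ (e : Equiv.Perm G) (g : Equiv.Perm (G ⧸ H)),
      (∀ x, α (e x) = e (α x)) ∧ (∀ x, π (e x) = g (π x)) ∧ e d = d' := fun d d' =>
    ⟨Equiv.mulLeft (d' * d⁻¹), MulAction.toPerm (d' * d⁻¹), fun x => by simp [α, mul_assoc],
      fun x => rfl, by simp⟩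
  have hconn : ∀ x y, link α π Finset.univ x y := by
    refine Setoid.rel_of_closure_eq_top hgen link_apply fun x => ?_
    refine Setoid.trans' _ (link_apply x) (link_of_mem (Finset.mem_univ _) ?_)
    rw [← hab']
    exact (hρ _).symm
  obtain ⟨S, hS, hcard⟩ := exists_independent_card_quotient_le_two hα h3 hloop htrans hconn
  have hle := link_le_sameCycle hρ h3 hfib hS
  have hΓ : (cayleyGraph a b).Connected := by
    have : Nonempty G := ⟨1⟩
    refine ⟨fun x y => ?_⟩
    refine Setoid.rel_of_closure_eq_top (s := (cayleyGraph a b).reachableSetoid) hgen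
      (fun x => ?_) (fun x => ?_) x y
    · exact (cayleyGraph_adj_of_mul_eq (by simp) ha1 rfl).reachable
    · exact (cayleyGraph_adj_of_mul_eq (by simp) hb rfl).reachable
  refine hΓ.exists_isHamiltonian_of_perm (rotate ρ π hρ S * α) (fun x => ?_) ?_
  · rw [Equiv.Perm.mul_apply, rotate_apply]
    split_ifs
    · exact cayleyGraph_adj_of_mul_eq (z := b) (by simp) hb ((hab' x).symm)
    · exact cayleyGraph_adj_of_mul_eq (z := a) (by simp) ha1 rfl
  · refine le_trans (Nat.card_le_card_of_surjective (Quotient.map' id fun x y h => hle h) ?_) hcard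
    rintro ⟨x⟩
    exact ⟨⟦x⟧, rfl⟩

end Cayley

/-- If `G` is a finite group generated by an involution `a` and an element `b` of order
`s ≥ 3` with `ab` of order `3`, and `|G| ≡ 0 (mod 4)`, then `Cay(G, {a, b, b⁻¹})`
has a Hamilton path, i.e. a walk visiting every vertex exactly once. -/
theorem stmt2 {G : Type*} [Group G] [Fintype G] [DecidableEq G] (a b : G) (s : ℕ)
    (hs : 3 ≤ s) (ha : orderOf a = 2) (hb : orderOf b = s) (hab : orderOf (a * b) = 3)
    (hgen : Subgroup.closure ({a, b} : Set G) = ⊤)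
    (hcard : Fintype.card G % 4 = 0) :
    ∃ (u v : G) (p : (cayleyGraph a b).Walk u v), p.IsHamiltonian := by
  exact exists_isHamiltonian_cayleyGraph ha (by rintro rfl; rw [orderOf_one] at hb; omega) hab hgen
end

section
/- Let s ≥ 3 be an integer and let G be a finite group generated by an involution a and an element b of order s such that ab has order 3. If |G| ≡ 2 (mod 4), then s ≡ 2 (mod 4). -/
/-- In a group of order congruent to `2` modulo `4`, left multiplication by an involution is an
odd permutation. -/
theorem sign_toPerm_of_orderOf_eq_two {G : Type*} [Group G] [Fintype G] [DecidableEq G] {a : G}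
    (ha : orderOf a = 2) (hcard : Fintype.card G % 4 = 2) :
    Equiv.Perm.sign (MulAction.toPermHom G G a) = -1 := by
  have hsq : MulAction.toPermHom G G a ^ 2 = 1 := by
    rw [← map_pow, ← ha, pow_orderOf_eq_one, map_one]
  have hne : a ≠ 1 := fun h => by simp [h] at ha
  have : IsEmpty (Function.fixedPoints (MulAction.toPermHom G G a)) :=
    ⟨fun x => hne (mul_eq_right.1 x.2)⟩
  rw [Equiv.Perm.sign_of_pow_two_eq_one hsq,
    Fintype.card_eq_zero (α := Function.fixedPoints (MulAction.toPermHom G G a)), Nat.sub_zero]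
  exact Odd.neg_one_pow (by rw [Nat.odd_iff]; omega)

/-- If `G` is a finite group generated by an involution `a` and an element `b` of order
`s ≥ 3` with `ab` of order `3`, and `|G| ≡ 2 (mod 4)`, then `s ≡ 2 (mod 4)`. -/
theorem stmt3 {G : Type*} [Group G] [Fintype G] (a b : G) (s : ℕ)
    (hs : 3 ≤ s) (ha : orderOf a = 2) (hb : orderOf b = s) (hab : orderOf (a * b) = 3)
    (hgen : Subgroup.closure ({a, b} : Set G) = ⊤)
    (hcard : Fintype.card G % 4 = 2) :
    s % 4 = 2 := by
  classical
  let f : G →* ℤˣ := Equiv.Perm.sign.comp (MulAction.toPermHom G G)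
  have hfa : f a = -1 := sign_toPerm_of_orderOf_eq_two ha hcard
  have hfab : f (a * b) = 1 := by
    have h : f (a * b) ^ 3 = 1 := by rw [← map_pow, ← hab, pow_orderOf_eq_one, map_one]
    rwa [pow_succ, Int.units_sq, one_mul] at h
  have hfb : f b = -1 := by
    rw [map_mul, hfa, neg_one_mul] at hfab
    exact neg_eq_iff_eq_neg.1 hfab
  have heven : Even s := by
    have h : f b ^ s = 1 := by rw [← map_pow, ← hb, pow_orderOf_eq_one, map_one]
    rw [hfb] at h
    by_contra hodd
    rw [(Nat.not_even_iff_odd.1 hodd).neg_one_pow] at h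
    exact absurd h (by decide)
  have hdvd : s ∣ Fintype.card G := hb ▸ orderOf_dvd_card
  have hfour : ¬ 4 ∣ s := fun h => by
    have := h.trans hdvd
    omega
  rw [Nat.even_iff] at heven
  omega
end

section
/- Let X be a cubic simple graph of order n ≥ 1 and let S be a cyclically stable subset of V(X). Then 4|S| ≤ 3n − 2. -/
/-- A finite nonempty acyclic graph has fewer edges than vertices. -/
theorem SimpleGraph.IsAcyclic.card_edgeFinset_add_one_le {V : Type*} [Fintype V] [Nonempty V]
    {G : SimpleGraph V} [Fintype G.edgeSet] (hG : G.IsAcyclic) :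
    G.edgeFinset.card + 1 ≤ Fintype.card V := by
  classical
  obtain ⟨T, hGT, -, hT⟩ :=
    (SimpleGraph.connected_top (V := V)).exists_isTree_le_of_le_of_isAcyclic le_top hG
  rw [← hT.card_edgeFinset]
  exact Nat.add_le_add_right (Finset.card_le_card (SimpleGraph.edgeFinset_mono hGT)) 1

/-- The number of ordered adjacent pairs inside a finite set is twice the number of edges of the
induced subgraph. -/
theorem SimpleGraph.sum_card_filter_adj_eq_twice_card_edges_induce {V : Type*}
    (X : SimpleGraph V) [DecidableRel X.Adj] (S : Finset V)
    [Fintype (X.induce (S : Set V)).edgeSet] :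
    ∑ v ∈ S, (S.filter (X.Adj v)).card = 2 * (X.induce (S : Set V)).edgeFinset.card := by
  classical
  rw [← Finset.sum_coe_sort]
  convert (X.induce (S : Set V)).sum_degrees_eq_twice_card_edges using 1
  · refine Finset.sum_congr rfl fun v _ => ?_
    rw [← SimpleGraph.card_neighborFinset_eq_degree,
      ← Finset.card_map (Function.Embedding.subtype (· ∈ (S : Set V)))]
    congr 1
    ext w
    simp [and_comm]
  · congr!

/-- If `X` is a cubic simple graph on `n ≥ 1` vertices and `S` is a cyclically stable
set of vertices (i.e. the subgraph induced by `S` is acyclic), then `4|S| ≤ 3n - 2`. -/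
theorem stmt5 {V : Type*} [Fintype V] (X : SimpleGraph V) [DecidableRel X.Adj]
    (hcubic : ∀ v : V, X.degree v = 3) (hn : 1 ≤ Fintype.card V)
    (S : Finset V) (hS : (X.induce (↑S : Set V)).IsAcyclic) :
    4 * S.card ≤ 3 * Fintype.card V - 2 := by
  classical
  obtain rfl | hne := S.eq_empty_or_nonempty
  · simp
  have : Nonempty (S : Set V) := hne.to_subtype
  have hforest := hS.card_edgeFinset_add_one_le
  have hcard : Fintype.card (S : Set V) = S.card := by simp
  have hinner := X.sum_card_filter_adj_eq_twice_card_edges_induce S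
  have hdeg : ∀ v, (S.filter (X.Adj v)).card + (Sᶜ.filter (X.Adj v)).card = 3 := fun v => by
    rw [← hcubic v, ← SimpleGraph.card_neighborFinset_eq_degree,
      SimpleGraph.neighborFinset_eq_filter, ← Finset.card_union_of_disjoint
        (Finset.disjoint_filter_filter disjoint_compl_right), ← Finset.filter_union,
      Finset.union_compl]
  have hsum : ∑ v ∈ S, (S.filter (X.Adj v)).card + ∑ v ∈ S, (Sᶜ.filter (X.Adj v)).card
      = S.card * 3 := by
    rw [← Finset.sum_add_distrib, Finset.sum_congr rfl fun v _ => hdeg v, Finset.sum_const,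
      smul_eq_mul]
  have hcross : ∑ v ∈ S, (Sᶜ.filter (X.Adj v)).card ≤ Sᶜ.card * 3 := by
    have hswap : ∑ v ∈ S, (Sᶜ.filter (X.Adj v)).card = ∑ w ∈ Sᶜ, (S.filter (X.Adj w)).card := by
      simpa [Finset.bipartiteAbove, Finset.bipartiteBelow, X.adj_comm] using
        Finset.sum_card_bipartiteAbove_eq_sum_card_bipartiteBelow (s := S) (t := Sᶜ) X.Adj
    rw [hswap, ← smul_eq_mul]
    exact Finset.sum_le_card_nsmul _ _ _ fun w _ => by have := hdeg w; omega
  have hcompl := S.card_add_card_compl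
  omega
end

section
/- Let X be a cubic simple graph and let S be a cyclically stable subset of V(X) of maximum size. Then every vertex of V(X)∖S has at most one neighbor in V(X)∖S; equivalently, every edge of the subgraph induced by V(X)∖S is an isolated edge of that subgraph. -/
namespace SimpleGraph

variable {V : Type*} {G : SimpleGraph V}

theorem isAcyclic_induce_iff {s : Set V} :
    (G.induce s).IsAcyclic ↔ ∀ (u : V) (c : G.Walk u u), c.IsCycle → ∃ x ∈ c.support, x ∉ s := by
  constructor
  · intro h u c hc
    by_contra! hs
    refine h (c.induce s hs) (Walk.IsCycle.of_map (f := (Embedding.induce s).toHom) ?_)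
    rwa [Walk.map_induce]
  · intro h u c hc
    obtain ⟨x, hx, hxs⟩ := h _ _ (hc.map (f := (Embedding.induce s).toHom) Subtype.val_injective)
    rw [Walk.support_map, List.mem_map] at hx
    obtain ⟨y, -, rfl⟩ := hx
    exact hxs y.2

/-- Adding to a set inducing a forest a vertex with at most one neighbor in the set
gives again a set inducing a forest. -/
theorem IsAcyclic.induce_insert {s : Set V} {v : V} (hs : (G.induce s).IsAcyclic)
    (hv : {w | w ∈ s ∧ G.Adj v w}.Subsingleton) : (G.induce (insert v s)).IsAcyclic := by
  classical
  rw [isAcyclic_induce_iff] at hs ⊢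
  intro u c hc
  by_contra! hsub
  obtain ⟨x, hx, hxs⟩ := hs u c hc
  obtain rfl : x = v := (hsub x hx).resolve_right hxs
  have hd := hc.rotate hx
  have mem : ∀ w ∈ (c.rotate x hx).support, G.Adj x w → w ∈ s ∧ G.Adj x w := fun w hw hadj ↦
    ⟨(hsub w ((c.mem_support_rotate_iff x hx).1 hw)).resolve_left hadj.ne', hadj⟩
  refine hd.snd_ne_penultimate (hv ?_ ?_)
  · exact mem _ (Walk.getVert_mem_support _ _) (Walk.adj_snd hd.not_nil)
  · exact mem _ (Walk.getVert_mem_support _ _) (Walk.adj_penultimate hd.not_nil).symm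

end SimpleGraph

/-- If `X` is a cubic simple graph and `S` is a maximum-size cyclically stable set
(i.e. the subgraph induced by `S` is acyclic), then every vertex outside `S` has at
most one neighbor outside `S`. -/
theorem stmt6 {V : Type*} [Fintype V] (X : SimpleGraph V) [DecidableRel X.Adj]
    (hcubic : ∀ v : V, X.degree v = 3)
    (S : Finset V) (hS : (X.induce (↑S : Set V)).IsAcyclic)
    (hmax : ∀ T : Finset V, (X.induce (↑T : Set V)).IsAcyclic → T.card ≤ S.card) :
    ∀ v : V, v ∉ S → {w : V | w ∉ S ∧ X.Adj v w}.Subsingleton := by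
  classical
  rintro v hv a ⟨ha, hva⟩ b ⟨hb, hvb⟩
  by_contra hab
  have hsub : {w : V | w ∈ (S : Set V) ∧ X.Adj v w}.Subsingleton := by
    rintro x ⟨hx, hvx⟩ y ⟨hy, hvy⟩
    by_contra hxy
    have hle : ({a, b, x, y} : Finset V) ⊆ X.neighborFinset v := by
      simp [Finset.insert_subset_iff, hva, hvb, hvx, hvy]
    have hcard : ({a, b, x, y} : Finset V).card = 4 := by
      rw [Finset.mem_coe] at hx hy
      rw [Finset.card_insert_of_notMem, Finset.card_insert_of_notMem, Finset.card_pair hxy] <;>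
        grind
    have := Finset.card_le_card hle
    rw [X.card_neighborFinset_eq_degree, hcubic, hcard] at this
    omega
  have := hmax (insert v S) (by rw [Finset.coe_insert]; exact hS.induce_insert hsub)
  rw [Finset.card_insert_of_notMem hv] at this
  omega
end

section
/- Let X be a connected cyclically 4-connected cubic simple graph of order n with n ≡ 2 (mod 4), and let S be a cyclically stable subset of V(X) of maximum size. Then |S| = (3n−2)/4, the subgraph induced by S is a tree, and V(X)∖S is an independent set of vertices. -/
/-- An edge set `F` of a graph `X` is cycle-separating if deleting `F` disconnects `X`
and at least two of the resulting connected components contain cycles. -/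
def CycleSeparating {V : Type*} (X : SimpleGraph V) (F : Set (Sym2 V)) : Prop :=
  ¬ (X.deleteEdges F).Connected ∧
    ∃ (u v : V) (p : (X.deleteEdges F).Walk u u) (q : (X.deleteEdges F).Walk v v),
      p.IsCycle ∧ q.IsCycle ∧ ¬ (X.deleteEdges F).Reachable u v

/-- A connected graph `X` is cyclically `k`-connected if no set of fewer than `k` edges
is cycle-separating in `X`. -/
def CyclicallyConnected {V : Type*} (X : SimpleGraph V) (k : ℕ) : Prop :=
  ∀ F : Finset (Sym2 V), ↑F ⊆ X.edgeSet → CycleSeparating X ↑F → k ≤ F.card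


section EdgeSets

open Finset

variable {V : Type*}

/-- Reachability in the graph whose edge set is `H`. -/
def EdgeReach (H : Finset (Sym2 V)) : V → V → Prop :=
  Relation.ReflTransGen fun a b => s(a, b) ∈ H

lemma EdgeReach.refl (H : Finset (Sym2 V)) (a : V) : EdgeReach H a a :=
  Relation.ReflTransGen.refl

lemma EdgeReach.of_mem {H : Finset (Sym2 V)} {a b : V} (h : s(a, b) ∈ H) : EdgeReach H a b :=
  Relation.ReflTransGen.single h

lemma EdgeReach.trans {H : Finset (Sym2 V)} {a b c : V} (h : EdgeReach H a b)
    (h' : EdgeReach H b c) : EdgeReach H a c :=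
  Relation.ReflTransGen.trans h h'

lemma EdgeReach.symm {H : Finset (Sym2 V)} {a b : V} (h : EdgeReach H a b) :
    EdgeReach H b a := by
  induction h with
  | refl => exact .refl _ _
  | tail _ h ih => exact (EdgeReach.of_mem (by rwa [Sym2.eq_swap])).trans ih

lemma EdgeReach.mono {H K : Finset (Sym2 V)} (hHK : H ⊆ K) {a b : V} (h : EdgeReach H a b) :
    EdgeReach K a b :=
  Relation.ReflTransGen.mono (fun _ _ h => hHK h) _ _ h

lemma edgeReach_insert_iff [DecidableEq V] {H : Finset (Sym2 V)} {u v a b : V} :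
    EdgeReach (insert s(u, v) H) a b ↔
      EdgeReach H a b ∨ (EdgeReach H a u ∧ EdgeReach H v b) ∨
        (EdgeReach H a v ∧ EdgeReach H u b) := by
  constructor
  · intro h
    induction h with
    | refl => exact Or.inl (.refl _ _)
    | tail _ h ih =>
      rename_i c d _
      rcases Finset.mem_insert.1 h with h | h
      · rcases Sym2.eq_iff.1 h with ⟨rfl, rfl⟩ | ⟨rfl, rfl⟩
        · rcases ih with ih | ⟨h1, h2⟩ | ⟨h1, h2⟩
          · exact Or.inr (Or.inl ⟨ih, .refl _ _⟩)
          · exact Or.inr (Or.inl ⟨h1, .refl _ _⟩)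
          · exact Or.inl h1
        · rcases ih with ih | ⟨h1, h2⟩ | ⟨h1, h2⟩
          · exact Or.inr (Or.inr ⟨ih, .refl _ _⟩)
          · exact Or.inl h1
          · exact Or.inr (Or.inr ⟨h1, .refl _ _⟩)
      · have h := EdgeReach.of_mem h
        rcases ih with ih | ⟨h1, h2⟩ | ⟨h1, h2⟩
        · exact Or.inl (ih.trans h)
        · exact Or.inr (Or.inl ⟨h1, h2.trans h⟩)
        · exact Or.inr (Or.inr ⟨h1, h2.trans h⟩)
  · have hs : H ⊆ insert s(u, v) H := Finset.subset_insert _ _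
    have huv : EdgeReach (insert s(u, v) H) u v := .of_mem (Finset.mem_insert_self _ _)
    rintro (h | ⟨h1, h2⟩ | ⟨h1, h2⟩)
    · exact h.mono hs
    · exact ((h1.mono hs).trans huv).trans (h2.mono hs)
    · exact ((h1.mono hs).trans huv.symm).trans (h2.mono hs)

variable [Fintype V]

open Classical in
/-- The vertex set of the component of `v` in the graph with edge set `H`. -/
noncomputable def edgeClass (H : Finset (Sym2 V)) (v : V) : Finset V :=
  univ.filter (EdgeReach H v)

open Classical in
/-- The vertex sets of the components of the graph with edge set `H`. -/
noncomputable def edgeComps (H : Finset (Sym2 V)) : Finset (Finset V) :=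
  univ.image (edgeClass H)

open Classical in
/-- The edges of `H` with all endpoints in `U`. -/
noncomputable def edgesWithin (H : Finset (Sym2 V)) (U : Finset V) : Finset (Sym2 V) :=
  H.filter fun e => ∀ v ∈ e, v ∈ U

/-- A component with vertex set `U` is odd if its cycle rank `|E| - |U| + 1` is odd. -/
def OddRank (H : Finset (Sym2 V)) (U : Finset V) : Prop :=
  Even (#(edgesWithin H U) + #U)

open Classical in
/-- Each component counts once, and once more if its cycle rank is odd. -/
noncomputable def compWeight (H : Finset (Sym2 V)) (U : Finset V) : ℕ :=
  1 + if OddRank H U then 1 else 0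

open Classical in
/-- The total weight of the components of `H` contained in `U`. -/
noncomputable def weightWithin (H : Finset (Sym2 V)) (U : Finset V) : ℕ :=
  ∑ W ∈ edgeComps H with W ⊆ U, compWeight H W

/-- The number of components plus the number of components of odd cycle rank. -/
noncomputable def totalWeight (H : Finset (Sym2 V)) : ℕ :=
  ∑ W ∈ edgeComps H, compWeight H W

lemma mem_edgeClass {H : Finset (Sym2 V)} {a b : V} : b ∈ edgeClass H a ↔ EdgeReach H a b := by
  simp [edgeClass]

lemma self_mem_edgeClass (H : Finset (Sym2 V)) (a : V) : a ∈ edgeClass H a :=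
  mem_edgeClass.2 (.refl _ _)

lemma edgeClass_eq_iff {H : Finset (Sym2 V)} {a b : V} :
    edgeClass H a = edgeClass H b ↔ EdgeReach H a b := by
  constructor
  · intro h
    exact mem_edgeClass.1 (h ▸ self_mem_edgeClass H b)
  · intro h
    ext c
    simp only [mem_edgeClass]
    exact ⟨h.symm.trans, h.trans⟩

lemma edgeClass_mem_edgeComps (H : Finset (Sym2 V)) (v : V) : edgeClass H v ∈ edgeComps H := by
  simp [edgeComps]

lemma mem_edgeComps {H : Finset (Sym2 V)} {U : Finset V} :
    U ∈ edgeComps H ↔ ∃ v, edgeClass H v = U := by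
  simp [edgeComps]

lemma edgeClass_eq_of_mem {H : Finset (Sym2 V)} {U : Finset V} (hU : U ∈ edgeComps H) {v : V}
    (hv : v ∈ U) : edgeClass H v = U := by
  obtain ⟨w, rfl⟩ := mem_edgeComps.1 hU
  exact edgeClass_eq_iff.2 (mem_edgeClass.1 hv).symm

lemma eq_of_mem_edgeComps {H : Finset (Sym2 V)} {U W : Finset V} (hU : U ∈ edgeComps H)
    (hW : W ∈ edgeComps H) {v : V} (hvU : v ∈ U) (hvW : v ∈ W) : U = W := by
  rw [← edgeClass_eq_of_mem hU hvU, edgeClass_eq_of_mem hW hvW]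

lemma nonempty_of_mem_edgeComps {H : Finset (Sym2 V)} {U : Finset V} (hU : U ∈ edgeComps H) :
    U.Nonempty := by
  obtain ⟨w, rfl⟩ := mem_edgeComps.1 hU
  exact ⟨w, self_mem_edgeClass H w⟩

lemma edgeComps_congr {H K : Finset (Sym2 V)} (h : ∀ a b, EdgeReach H a b ↔ EdgeReach K a b) :
    edgeComps H = edgeComps K := by
  have : edgeClass H = edgeClass K := by
    ext a b
    simp [mem_edgeClass, h]
  simp [edgeComps, this]

lemma mem_edgesWithin {H : Finset (Sym2 V)} {U : Finset V} {e : Sym2 V} :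
    e ∈ edgesWithin H U ↔ e ∈ H ∧ ∀ v ∈ e, v ∈ U := by
  simp [edgesWithin]

lemma mem_of_mem_edge {H : Finset (Sym2 V)} {U : Finset V} (hU : U ∈ edgeComps H) {e : Sym2 V}
    (he : e ∈ H) {v w : V} (hv : v ∈ e) (hvU : v ∈ U) (hw : w ∈ e) : w ∈ U := by
  rw [← edgeClass_eq_of_mem hU hvU, mem_edgeClass]
  by_cases hvw : v = w
  · exact hvw ▸ .refl _ _
  · rw [(Sym2.mem_and_mem_iff hvw).1 ⟨hv, hw⟩] at he
    exact .of_mem he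

lemma card_edgeComps_insert_of_reach [DecidableEq V] {H : Finset (Sym2 V)} {u v : V}
    (h : EdgeReach H u v) : #(edgeComps (insert s(u, v) H)) = #(edgeComps H) := by
  rw [edgeComps_congr (K := H)]
  intro a b
  rw [edgeReach_insert_iff]
  constructor
  · rintro (h' | ⟨h1, h2⟩ | ⟨h1, h2⟩)
    · exact h'
    · exact (h1.trans h).trans h2
    · exact (h1.trans h.symm).trans h2
  · exact Or.inl

lemma card_edgeComps_insert_of_not_reach [DecidableEq V] {H : Finset (Sym2 V)} {u v : V}
    (h : ¬ EdgeReach H u v) : #(edgeComps (insert s(u, v) H)) + 1 = #(edgeComps H) := by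
  have hne : edgeClass H u ≠ edgeClass H v := fun h' => h (edgeClass_eq_iff.1 h')
  have hu := edgeClass_mem_edgeComps H u
  have hv : edgeClass H v ∈ (edgeComps H).erase (edgeClass H u) :=
    mem_erase.2 ⟨hne.symm, edgeClass_mem_edgeComps H v⟩
  have key : edgeComps (insert s(u, v) H) =
      insert (edgeClass H u ∪ edgeClass H v)
        (((edgeComps H).erase (edgeClass H u)).erase (edgeClass H v)) := by
    have h1 : ∀ a, EdgeReach H u a ∨ EdgeReach H v a →
        edgeClass (insert s(u, v) H) a = edgeClass H u ∪ edgeClass H v := by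
      intro a ha
      ext b
      simp only [mem_edgeClass, mem_union, edgeReach_insert_iff]
      constructor
      · rintro (hab | ⟨-, h'⟩ | ⟨-, h'⟩)
        · exact ha.imp (·.trans hab) (·.trans hab)
        · exact Or.inr h'
        · exact Or.inl h'
      · rintro (hb | hb) <;> rcases ha with ha | ha
        · exact Or.inl (ha.symm.trans hb)
        · exact Or.inr (Or.inr ⟨ha.symm, hb⟩)
        · exact Or.inr (Or.inl ⟨ha.symm, hb⟩)
        · exact Or.inl (ha.symm.trans hb)
    have h2 : ∀ a, ¬ EdgeReach H u a → ¬ EdgeReach H v a →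
        edgeClass (insert s(u, v) H) a = edgeClass H a := by
      intro a hua hva
      ext b
      simp only [mem_edgeClass, edgeReach_insert_iff]
      constructor
      · rintro (hab | ⟨h', -⟩ | ⟨h', -⟩)
        · exact hab
        · exact (hua h'.symm).elim
        · exact (hva h'.symm).elim
      · exact Or.inl
    ext U
    simp only [mem_edgeComps, mem_insert, mem_erase]
    constructor
    · rintro ⟨a, rfl⟩
      by_cases ha : EdgeReach H u a ∨ EdgeReach H v a
      · exact Or.inl (h1 a ha)
      · rw [not_or] at ha
        rw [h2 a ha.1 ha.2]
        exact Or.inr ⟨fun h' => ha.2 (edgeClass_eq_iff.1 h'.symm),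
          fun h' => ha.1 (edgeClass_eq_iff.1 h'.symm), a, rfl⟩
    · rintro (rfl | ⟨hUv, hUu, a, rfl⟩)
      · exact ⟨u, h1 u (Or.inl (.refl _ _))⟩
      · exact ⟨a, h2 a (fun h' => hUu (edgeClass_eq_iff.2 h'.symm))
          (fun h' => hUv (edgeClass_eq_iff.2 h'.symm))⟩
  rw [key, card_insert_of_notMem, card_erase_of_mem hv, card_erase_of_mem hu]
  · have h1 : 1 ≤ #((edgeComps H).erase (edgeClass H u)) := card_pos.2 ⟨_, hv⟩
    rw [card_erase_of_mem hu] at h1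
    omega
  · intro hmem
    rw [mem_erase, mem_erase] at hmem
    exact hmem.2.1 (eq_of_mem_edgeComps hmem.2.2 hu
      (mem_union_left _ (self_mem_edgeClass H u)) (self_mem_edgeClass H u))

lemma card_edgeComps_submodular [DecidableEq V] {P Q : Finset (Sym2 V)} (hPQ : P ⊆ Q)
    (D : Finset (Sym2 V)) :
    #(edgeComps Q) + #(edgeComps (P ∪ D)) ≤ #(edgeComps P) + #(edgeComps (Q ∪ D)) := by
  induction D using Finset.induction_on with
  | empty => simp [add_comm]
  | insert e D _ ih =>
    induction e using Sym2.ind with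
    | _ u v =>
    rw [union_insert, union_insert]
    by_cases h : EdgeReach (P ∪ D) u v
    · have h' := h.mono (union_subset_union_left (t := D) hPQ)
      rw [card_edgeComps_insert_of_reach h, card_edgeComps_insert_of_reach h']
      exact ih
    · have h1 := card_edgeComps_insert_of_not_reach h
      by_cases h' : EdgeReach (Q ∪ D) u v
      · have h2 := card_edgeComps_insert_of_reach h'
        omega
      · have h2 := card_edgeComps_insert_of_not_reach h'
        omega

lemma card_edgeComps_le_union [DecidableEq V] (P D : Finset (Sym2 V)) :
    #(edgeComps P) ≤ #(edgeComps (P ∪ D)) + #D := by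
  induction D using Finset.induction_on with
  | empty => simp
  | insert e D he ih =>
    induction e using Sym2.ind with
    | _ u v =>
    rw [union_insert, card_insert_of_notMem he]
    by_cases h : EdgeReach (P ∪ D) u v
    · have := card_edgeComps_insert_of_reach h
      omega
    · have := card_edgeComps_insert_of_not_reach h
      omega

lemma card_edgeComps_anti {P Q : Finset (Sym2 V)} (hPQ : P ⊆ Q) :
    #(edgeComps Q) ≤ #(edgeComps P) := by
  classical
  suffices h : ∀ D : Finset (Sym2 V), #(edgeComps (P ∪ D)) ≤ #(edgeComps P) by
    simpa [union_eq_right.2 hPQ] using h Q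
  intro D
  induction D using Finset.induction_on with
  | empty => simp
  | insert e D he ih =>
    induction e using Sym2.ind with
    | _ u v =>
    rw [union_insert]
    by_cases h : EdgeReach (P ∪ D) u v
    · have := card_edgeComps_insert_of_reach h
      omega
    · have := card_edgeComps_insert_of_not_reach h
      omega

lemma card_edgeComps_empty : #(edgeComps (∅ : Finset (Sym2 V))) = Fintype.card V := by
  classical
  rw [edgeComps, card_image_of_injective, card_univ]
  intro a b hab
  have h := edgeClass_eq_iff.1 hab
  induction h with
  | refl => rfl
  | tail _ h _ => simp at h

lemma sum_card_edgeComps (H : Finset (Sym2 V)) : ∑ U ∈ edgeComps H, #U = Fintype.card V := by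
  classical
  rw [← card_univ, ← card_biUnion]
  · congr 1
    ext v
    simp only [mem_biUnion, mem_univ, iff_true]
    exact ⟨_, edgeClass_mem_edgeComps H v, self_mem_edgeClass H v⟩
  · intro U hU W hW hne
    refine disjoint_left.2 fun v hv hv' => ?_
    exact hne (eq_of_mem_edgeComps hU hW hv hv')

lemma edgesWithin_disjoint {H K : Finset (Sym2 V)} {U W : Finset V} (hU : U ∈ edgeComps H)
    (hW : W ∈ edgeComps H) (hne : U ≠ W) : Disjoint (edgesWithin K U) (edgesWithin K W) := by
  rw [disjoint_left]
  intro e he he'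
  induction e using Sym2.ind with
  | _ u v =>
  exact hne (eq_of_mem_edgeComps hU hW ((mem_edgesWithin.1 he).2 u (by simp))
    ((mem_edgesWithin.1 he').2 u (by simp)))

lemma sum_card_edgesWithin_le {H D : Finset (Sym2 V)} :
    ∑ U ∈ edgeComps H, #(edgesWithin D U) ≤ #D := by
  classical
  rw [← card_biUnion fun U hU W hW hne => edgesWithin_disjoint hU hW hne]
  refine card_le_card fun e he => ?_
  obtain ⟨U, _, he⟩ := mem_biUnion.1 he
  exact (mem_edgesWithin.1 he).1

lemma sum_card_edgesWithin (H : Finset (Sym2 V)) :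
    ∑ U ∈ edgeComps H, #(edgesWithin H U) = #H := by
  classical
  refine sum_card_edgesWithin_le.antisymm ?_
  rw [← card_biUnion fun U hU W hW hne => edgesWithin_disjoint hU hW hne]
  refine card_le_card fun e he => ?_
  induction e using Sym2.ind with
  | _ u v =>
  have hu := edgeClass_mem_edgeComps H u
  exact mem_biUnion.2 ⟨_, hu, mem_edgesWithin.2 ⟨he, fun w hw =>
    mem_of_mem_edge hu he (Sym2.mem_mk_left u v) (self_mem_edgeClass H u) hw⟩⟩

lemma totalWeight_parity (H : Finset (Sym2 V)) :
    Even (totalWeight H + #H + Fintype.card V) := by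
  rw [← sum_card_edgeComps H, ← sum_card_edgesWithin H, totalWeight, ← sum_add_distrib,
    ← sum_add_distrib]
  refine even_sum _ fun U _ => ?_
  unfold compWeight OddRank
  split_ifs with h
  · rw [add_assoc]
    exact Even.add (by norm_num) h
  · rw [add_zero, add_assoc]
    exact (odd_one).add_odd (Nat.not_even_iff_odd.1 h)

lemma card_edgeComps_le_totalWeight (H : Finset (Sym2 V)) : #(edgeComps H) ≤ totalWeight H := by
  rw [totalWeight, card_eq_sum_ones]
  exact sum_le_sum fun U _ => by simp [compWeight]

open Classical in
lemma totalWeight_eq (H : Finset (Sym2 V)) :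
    totalWeight H = #(edgeComps H) + #{U ∈ edgeComps H | OddRank H U} := by
  simp only [totalWeight, compWeight, sum_add_distrib, card_filter, sum_const, smul_eq_mul,
    mul_one]

lemma totalWeight_eq_sum_weightWithin {L K : Finset (Sym2 V)} (hLK : L ⊆ K) :
    totalWeight L = ∑ C ∈ edgeComps K, weightWithin L C := by
  classical
  unfold weightWithin
  rw [← sum_biUnion, totalWeight]
  · congr 1
    ext W
    simp only [mem_biUnion, mem_filter]
    constructor
    · intro hW
      obtain ⟨v, rfl⟩ := mem_edgeComps.1 hW
      refine ⟨_, edgeClass_mem_edgeComps K v, hW, fun w hw => ?_⟩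
      exact mem_edgeClass.2 ((mem_edgeClass.1 hw).mono hLK)
    · rintro ⟨_, _, hW, _⟩
      exact hW
  · intro C hC D hD hne
    refine disjoint_left.2 fun W hW hW' => hne ?_
    obtain ⟨v, hv⟩ := nonempty_of_mem_edgeComps (mem_filter.1 hW).1
    exact eq_of_mem_edgeComps hC hD ((mem_filter.1 hW).2 hv) ((mem_filter.1 hW').2 hv)

lemma edgeReach_of_edgesWithin_subset {L L' K : Finset (Sym2 V)} (hLK : L ⊆ K) {C : Finset V}
    (hC : C ∈ edgeComps K) (h : edgesWithin L C ⊆ edgesWithin L' C) {a b : V} (ha : a ∈ C)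
    (hab : EdgeReach L a b) : EdgeReach L' a b := by
  have : EdgeReach L' a b ∧ b ∈ C := by
    induction hab with
    | refl => exact ⟨.refl _ _, ha⟩
    | tail _ hcd ih =>
      rename_i c d _
      have hin : ∀ w ∈ s(c, d), w ∈ C := fun w hw =>
        mem_of_mem_edge hC (hLK hcd) (Sym2.mem_mk_left c d) ih.2 hw
      exact ⟨ih.1.trans (.of_mem (mem_edgesWithin.1 (h (mem_edgesWithin.2 ⟨hcd, hin⟩))).1),
        hin d (Sym2.mem_mk_right c d)⟩
  exact this.1

lemma compWeight_congr {L L' : Finset (Sym2 V)} {U C : Finset V} (hUC : U ⊆ C)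
    (h : edgesWithin L C = edgesWithin L' C) : compWeight L U = compWeight L' U := by
  have : edgesWithin L U = edgesWithin L' U := by
    ext e
    have he := Finset.ext_iff.1 h e
    simp only [mem_edgesWithin] at he ⊢
    constructor
    · exact fun h' => ⟨(he.1 ⟨h'.1, fun v hv => hUC (h'.2 v hv)⟩).1, h'.2⟩
    · exact fun h' => ⟨(he.2 ⟨h'.1, fun v hv => hUC (h'.2 v hv)⟩).1, h'.2⟩
  have hodd : OddRank L U ↔ OddRank L' U := by rw [OddRank, OddRank, this]
  by_cases h' : OddRank L' U
  · simp [compWeight, h', hodd.2 h']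
  · simp [compWeight, h', mt hodd.1 h']

lemma weightWithin_congr {L L' K : Finset (Sym2 V)} (hL : L ⊆ K) (hL' : L' ⊆ K)
    {C : Finset V} (hC : C ∈ edgeComps K) (h : edgesWithin L C = edgesWithin L' C) :
    weightWithin L C = weightWithin L' C := by
  classical
  have hcls : ∀ a ∈ C, edgeClass L a = edgeClass L' a := by
    intro a ha
    ext b
    simp only [mem_edgeClass]
    exact ⟨edgeReach_of_edgesWithin_subset hL hC h.le ha,
      edgeReach_of_edgesWithin_subset hL' hC h.ge ha⟩
  refine sum_congr ?_ fun U hU => compWeight_congr (mem_filter.1 hU).2 h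
  ext U
  simp only [mem_filter, mem_edgeComps]
  constructor
  · rintro ⟨⟨a, rfl⟩, hsub⟩
    exact ⟨⟨a, (hcls a (hsub (self_mem_edgeClass L a))).symm⟩, hsub⟩
  · rintro ⟨⟨a, rfl⟩, hsub⟩
    exact ⟨⟨a, hcls a (hsub (self_mem_edgeClass L' a))⟩, hsub⟩

lemma weightWithin_self {K : Finset (Sym2 V)} {C : Finset V} (hC : C ∈ edgeComps K) :
    weightWithin K C = compWeight K C := by
  classical
  have : {W ∈ edgeComps K | W ⊆ C} = {C} := by
    ext W
    simp only [mem_filter, mem_singleton]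
    constructor
    · rintro ⟨hW, hWC⟩
      obtain ⟨v, hv⟩ := nonempty_of_mem_edgeComps hW
      exact eq_of_mem_edgeComps hW hC hv (hWC hv)
    · rintro rfl
      exact ⟨hC, Subset.rfl⟩
  rw [weightWithin, this, sum_singleton]

/-- Removing edges inside one component changes the total weight only within it. -/
lemma totalWeight_sdiff_within [DecidableEq V] {K B : Finset (Sym2 V)} {C : Finset V}
    (hC : C ∈ edgeComps K) (hB : ∀ e ∈ B, ∀ v ∈ e, v ∈ C) :
    totalWeight (K \ B) + compWeight K C = totalWeight K + weightWithin (K \ B) C := by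
  rw [totalWeight_eq_sum_weightWithin (sdiff_subset : K \ B ⊆ K),
    totalWeight_eq_sum_weightWithin (Subset.refl K), ← add_sum_erase _ _ hC,
    ← add_sum_erase (edgeComps K) (weightWithin K) hC, weightWithin_self hC]
  have : ∑ D ∈ (edgeComps K).erase C, weightWithin (K \ B) D =
      ∑ D ∈ (edgeComps K).erase C, weightWithin K D := by
    refine sum_congr rfl fun D hD => ?_
    obtain ⟨hne, hD⟩ := mem_erase.1 hD
    refine weightWithin_congr sdiff_subset (Subset.refl K) hD ?_
    ext e
    simp only [mem_edgesWithin, mem_sdiff]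
    constructor
    · exact fun h => ⟨h.1.1, h.2⟩
    · refine fun h => ⟨⟨h.1, fun heB => hne ?_⟩, h.2⟩
      induction e using Sym2.ind with
      | _ u v =>
      exact eq_of_mem_edgeComps hD hC (h.2 u (by simp)) (hB _ heB u (by simp))
  omega

lemma exists_mem_edge_of_oddRank {K : Finset (Sym2 V)} {C : Finset V} (hC : C ∈ edgeComps K)
    (hodd : OddRank K C) {v : V} (hv : v ∈ C) : ∃ e ∈ K, v ∈ e := by
  classical
  by_contra! h
  have hCv : C = {v} := by
    rw [← edgeClass_eq_of_mem hC hv]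
    ext w
    rw [mem_edgeClass, mem_singleton]
    constructor
    · intro hvw
      induction hvw with
      | refl => rfl
      | tail _ hcd ih =>
        rename_i c d _
        exact (h _ hcd (by simp [ih])).elim
    · rintro rfl
      exact .refl _ _
  have hE : edgesWithin K C = ∅ := by
    rw [eq_empty_iff_forall_notMem]
    intro e he
    obtain ⟨heK, heC⟩ := mem_edgesWithin.1 he
    induction e using Sym2.ind with
    | _ a b =>
    have : a = v := by simpa [hCv] using heC a (by simp)
    exact h _ heK (by simp [this])
  rw [OddRank, hE, hCv] at hodd
  simp at hodd

end EdgeSets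

section Transversal

open Finset

variable {ι α : Type*} [DecidableEq ι] [DecidableEq α]

/-- Rado's theorem on independent transversals, for a submodular rank function. -/
theorem exists_transversal_of_le_rank [Fintype ι] (r : Finset α → ℤ)
    (hmono : ∀ s t, s ⊆ t → r s ≤ r t) (hcard : ∀ s, r s ≤ #s)
    (hsub : ∀ s t, r (s ∪ t) + r (s ∩ t) ≤ r s + r t) (I : ι → Finset α)
    (hI : ∀ Y : Finset ι, (#Y : ℤ) ≤ r (Y.biUnion I)) :
    ∃ φ : ι → α, (∀ i, φ i ∈ I i) ∧ (Fintype.card ι : ℤ) ≤ r (univ.image φ) := by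
  induction hm : ∑ i, #(I i) using Nat.strong_induction_on generalizing I with
  | _ m ih =>
  have hpos : ∀ i, (I i).Nonempty := by
    intro i
    have h1 := hI {i}
    have h2 := hcard ((({i} : Finset ι)).biUnion I)
    rw [singleton_biUnion] at h1 h2
    rw [← card_pos]
    simp only [card_singleton] at h1
    push_cast at h1
    omega
  by_cases hsing : ∀ i, #(I i) ≤ 1
  · choose φ hφ using hpos
    refine ⟨φ, hφ, ?_⟩
    have heq : univ.image φ = (univ : Finset ι).biUnion I := by
      ext x
      simp only [mem_image, mem_biUnion, mem_univ, true_and]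
      constructor
      · rintro ⟨i, rfl⟩
        exact ⟨i, hφ i⟩
      · rintro ⟨i, hi⟩
        exact ⟨i, card_le_one.1 (hsing i) _ (hφ i) _ hi⟩
    rw [heq, ← card_univ]
    exact hI univ
  · push Not at hsing
    obtain ⟨i, hi⟩ := hsing
    obtain ⟨x, hx, y, hy, hxy⟩ := one_lt_card.1 hi
    have step : ∀ z ∈ I i, (∀ Y : Finset ι,
        (#Y : ℤ) ≤ r (Y.biUnion (Function.update I i ((I i).erase z)))) →
        ∃ φ : ι → α, (∀ i, φ i ∈ I i) ∧ (Fintype.card ι : ℤ) ≤ r (univ.image φ) := by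
      intro z hz hY
      have hle : ∀ j, Function.update I i ((I i).erase z) j ⊆ I j := by
        intro j
        by_cases hj : j = i
        · subst hj
          simpa using erase_subset _ _
        · simp [hj]
      obtain ⟨φ, hφ, hr⟩ := ih _ (by
        rw [← hm]
        refine sum_lt_sum (fun j _ => card_le_card (hle j)) ⟨i, mem_univ i, ?_⟩
        simpa using card_erase_lt_of_mem hz) _ hY rfl
      exact ⟨φ, fun j => hle j (hφ j), hr⟩
    have split : ∀ z, (¬ ∀ Y : Finset ι,
        (#Y : ℤ) ≤ r (Y.biUnion (Function.update I i ((I i).erase z)))) →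
        ∃ Y : Finset ι, i ∉ Y ∧ r (Y.biUnion I ∪ (I i).erase z) ≤ #Y := by
      intro z hz
      push Not at hz
      obtain ⟨Y, hY⟩ := hz
      have hcongr : ∀ Z : Finset ι, i ∉ Z →
          Z.biUnion (Function.update I i ((I i).erase z)) = Z.biUnion I := by
        intro Z hZ
        refine biUnion_congr rfl fun j hj => ?_
        rw [Function.update_of_ne (by rintro rfl; exact hZ hj)]
      by_cases hiY : i ∈ Y
      · refine ⟨Y.erase i, notMem_erase i Y, ?_⟩
        have h1 : #(Y.erase i) + 1 = #Y := card_erase_add_one hiY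
        have h2 : Y.biUnion (Function.update I i ((I i).erase z)) =
            (Y.erase i).biUnion I ∪ (I i).erase z := by
          conv_lhs => rw [← insert_erase hiY]
          rw [biUnion_insert, hcongr _ (notMem_erase i Y), Function.update_self, union_comm]
        rw [h2] at hY
        omega
      · rw [hcongr Y hiY] at hY
        exact absurd (hI Y) (not_le.2 hY)
    by_cases h1 : ∀ Y : Finset ι,
        (#Y : ℤ) ≤ r (Y.biUnion (Function.update I i ((I i).erase x)))
    · exact step x hx h1
    by_cases h2 : ∀ Y : Finset ι,
        (#Y : ℤ) ≤ r (Y.biUnion (Function.update I i ((I i).erase y)))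
    · exact step y hy h2
    exfalso
    obtain ⟨Y, hiY, hY⟩ := split x h1
    obtain ⟨Z, hiZ, hZ⟩ := split y h2
    have hs := hsub (Y.biUnion I ∪ (I i).erase x) (Z.biUnion I ∪ (I i).erase y)
    have hu : r ((insert i (Y ∪ Z)).biUnion I) ≤
        r ((Y.biUnion I ∪ (I i).erase x) ∪ (Z.biUnion I ∪ (I i).erase y)) := by
      refine hmono _ _ fun w hw => ?_
      simp only [mem_biUnion, mem_union, mem_insert, mem_erase] at hw ⊢
      obtain ⟨j, rfl | hj | hj, hwj⟩ := hw
      · by_cases hwx : w = x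
        · subst hwx
          exact Or.inr (Or.inr ⟨hxy, hwj⟩)
        · exact Or.inl (Or.inr ⟨hwx, hwj⟩)
      · exact Or.inl (Or.inl ⟨j, hj, hwj⟩)
      · exact Or.inr (Or.inl ⟨j, hj, hwj⟩)
    have hn : r ((Y ∩ Z).biUnion I) ≤
        r ((Y.biUnion I ∪ (I i).erase x) ∩ (Z.biUnion I ∪ (I i).erase y)) := by
      refine hmono _ _ fun w hw => ?_
      simp only [mem_biUnion, mem_union, mem_inter] at hw ⊢
      obtain ⟨j, ⟨hjY, hjZ⟩, hwj⟩ := hw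
      exact ⟨Or.inl ⟨j, hjY, hwj⟩, Or.inl ⟨j, hjZ, hwj⟩⟩
    have hI1 := hI (insert i (Y ∪ Z))
    have hI2 := hI (Y ∩ Z)
    have hc := card_union_add_card_inter Y Z
    rw [card_insert_of_notMem (by simp [hiY, hiZ])] at hI1
    push_cast at hI1
    omega

end Transversal

section ForestCover

open Finset

variable {V : Type*} [Fintype V] [DecidableEq V]

lemma card_edgeComps_inter_add_union (P Q : Finset (Sym2 V)) :
    #(edgeComps P) + #(edgeComps Q) ≤ #(edgeComps (P ∩ Q)) + #(edgeComps (P ∪ Q)) := by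
  have := card_edgeComps_submodular (inter_subset_left : P ∩ Q ⊆ P) Q
  rwa [union_eq_right.2 (inter_subset_right : P ∩ Q ⊆ Q)] at this

/-- An independent transversal, in the cographic matroid of `H`, of the sets `I i`. -/
lemma exists_nonseparating_transversal {ι : Type*} [Fintype ι] [DecidableEq ι]
    (H : Finset (Sym2 V)) (I : ι → Finset (Sym2 V))
    (hI : ∀ Y : Finset ι,
      #(edgeComps (H \ Y.biUnion I)) + #Y ≤ #(Y.biUnion I) + #(edgeComps H)) :
    ∃ φ : ι → Sym2 V, (∀ i, φ i ∈ I i) ∧ #(univ.image φ) = Fintype.card ι ∧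
      #(edgeComps (H \ univ.image φ)) = #(edgeComps H) := by
  obtain ⟨φ, hφ, hr⟩ := exists_transversal_of_le_rank
    (fun s => (#s : ℤ) + #(edgeComps H) - #(edgeComps (H \ s)))
    (fun s t hst => by
      have h4 := card_sdiff_add_card_eq_card hst
      have h5 : #(edgeComps (H \ t)) ≤ #(edgeComps (H \ s)) + #(t \ s) := by
        have h6 := card_edgeComps_le_union (H \ t) (H ∩ (t \ s))
        have h7 : H \ t ∪ H ∩ (t \ s) = H \ s := by
          ext e
          have := @hst e
          simp only [mem_union, mem_sdiff, mem_inter]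
          tauto
        have h8 : #(H ∩ (t \ s)) ≤ #(t \ s) := card_le_card inter_subset_right
        rw [h7] at h6
        omega
      omega)
    (fun s => by
      have := card_edgeComps_anti (sdiff_subset : H \ s ⊆ H)
      omega)
    (fun s t => by
      have h1 := card_edgeComps_inter_add_union (H \ s) (H \ t)
      have h2 := card_union_add_card_inter s t
      have h3 : (H \ s) ∩ (H \ t) = H \ (s ∪ t) := by
        ext e
        simp only [mem_union, mem_sdiff, mem_inter]
        tauto
      have h4 : H \ s ∪ H \ t = H \ (s ∩ t) := by
        ext e
        simp only [mem_union, mem_sdiff, mem_inter]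
        tauto
      rw [h3, h4] at h1
      omega)
    I
    (fun Y => by
      have := hI Y
      omega)
  have h1 := card_edgeComps_anti (sdiff_subset : H \ univ.image φ ⊆ H)
  have h2 : #(univ.image φ) ≤ Fintype.card ι := card_image_le
  refine ⟨φ, hφ, ?_, ?_⟩ <;> omega

set_option maxHeartbeats 1000000 in
/-- Edge sets all of whose deletions satisfy Nebeský's inequality contain a spanning forest
whose complement splits into adjacent pairs of edges. -/
theorem exists_forest_cover (H : Finset (Sym2 V))
    (hH : ∀ A ⊆ H, totalWeight (H \ A) ≤ #A + #(edgeComps H)) :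
    ∃ F ⊆ H, ∃ J : Finset V, #F + #(edgeComps F) = Fintype.card V ∧
      #(edgeComps F) = #(edgeComps H) ∧ 2 * #J + #F ≤ #H ∧
      ∀ e ∈ H, e ∉ F → ∃ v ∈ J, v ∈ e := by
  induction hm : #H using Nat.strong_induction_on generalizing H with
  | _ m ih =>
  subst hm
  rcases H.eq_empty_or_nonempty with rfl | ⟨e₀, he₀⟩
  · exact ⟨∅, Subset.rfl, ∅, by simp [card_edgeComps_empty]⟩
  have hH0 : totalWeight H = #(edgeComps H) := by
    have h1 := hH ∅ (empty_subset _)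
    have h2 := card_edgeComps_le_totalWeight H
    simp at h1
    omega
  have hparity : ∀ A ⊆ H, Even (totalWeight (H \ A) + #A + #(edgeComps H)) := by
    intro A hA
    have h1 := totalWeight_parity H
    have h2 := totalWeight_parity (H \ A)
    have h3 := card_sdiff_add_card_eq_card hA
    rw [Nat.even_iff] at *
    omega
  -- a maximum tight set of edges
  obtain ⟨A, hAmem, hAmax⟩ := exists_max_image
    (H.powerset.filter fun A => totalWeight (H \ A) = #A + #(edgeComps H)) card
    ⟨∅, by simp [hH0]⟩
  simp only [mem_filter, mem_powerset] at hAmem hAmax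
  obtain ⟨hAH, hAtight⟩ := hAmem
  have hApos : 0 < #A := by
    have h1 := hH {e₀} (singleton_subset_iff.2 he₀)
    have h2 := hparity {e₀} (singleton_subset_iff.2 he₀)
    have h3 := card_edgeComps_le_totalWeight (H \ {e₀})
    have h4 := card_edgeComps_anti (sdiff_subset : H \ {e₀} ⊆ H)
    have h5 := hAmax {e₀} ⟨singleton_subset_iff.2 he₀, by
      rw [card_singleton, Nat.even_iff] at *
      omega⟩
    simp at h5
    exact card_pos.2 h5
  set K := H \ A with hK
  have hKH : K ⊆ H := sdiff_subset
  have hKcard : #K + #A = #H := card_sdiff_add_card_eq_card hAH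
  have hKle : ∀ B ⊆ K, totalWeight (K \ B) ≤ totalWeight K + #B := by
    intro B hB
    have hAB : Disjoint A B := by
      rw [disjoint_left]
      exact fun e heA heB => (mem_sdiff.1 (hB heB)).2 heA
    have hAB' : H \ (A ∪ B) = K \ B := by
      ext e
      simp only [hK, mem_sdiff, mem_union]
      tauto
    have h1 := hH (A ∪ B) (union_subset hAH (hB.trans hKH))
    rw [card_union_of_disjoint hAB, hAB'] at h1
    omega
  have hKlt : ∀ B ⊆ K, B.Nonempty → totalWeight (K \ B) + 2 ≤ totalWeight K + #B := by
    intro B hB hBne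
    have hAB : Disjoint A B := by
      rw [disjoint_left]
      exact fun e heA heB => (mem_sdiff.1 (hB heB)).2 heA
    have hAB' : H \ (A ∪ B) = K \ B := by
      ext e
      simp only [hK, mem_sdiff, mem_union]
      tauto
    have hsub : A ∪ B ⊆ H := union_subset hAH (hB.trans hKH)
    have h1 := hH (A ∪ B) hsub
    have h2 := hparity (A ∪ B) hsub
    have h3 := hAmax (A ∪ B)
    have h4 := hBne.card_pos
    rw [card_union_of_disjoint hAB, hAB'] at h1 h2 h3
    have h5 : totalWeight (K \ B) ≠ #A + #B + #(edgeComps H) := by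
      intro h
      have := h3 ⟨hsub, h⟩
      omega
    rw [Nat.even_iff] at h2
    omega
  classical
  let ι := {C : Finset V // C ∈ edgeComps K ∧ OddRank K C}
  have hιcard : totalWeight K = #(edgeComps K) + Fintype.card ι := by
    rw [totalWeight_eq, Fintype.card_subtype, filter_and]
    congr 2
    ext C
    simp
  let I : ι → Finset (Sym2 V) := fun C => A.filter fun e => ∃ v ∈ e, v ∈ C.1
  obtain ⟨φ, hφI, hφcard, hφcomps⟩ := exists_nonseparating_transversal H I
    (by
      intro Y
      set B := Y.biUnion I with hB
      have hBA : B ⊆ A := biUnion_subset.2 fun C _ => filter_subset _ _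
      have h1 := hH B (hBA.trans hAH)
      have hsub : K ⊆ H \ B := sdiff_subset_sdiff Subset.rfl hBA
      have hwithin : ∀ C ∈ Y, edgesWithin (H \ B) C.1 = edgesWithin K C.1 := by
        intro C hC
        ext e
        simp only [mem_edgesWithin]
        refine ⟨fun ⟨he, heC⟩ => ⟨?_, heC⟩, fun ⟨he, heC⟩ => ⟨hsub he, heC⟩⟩
        refine mem_sdiff.2 ⟨(mem_sdiff.1 he).1, fun heA => (mem_sdiff.1 he).2 ?_⟩
        induction e using Sym2.ind with
        | _ u v =>
        exact mem_biUnion.2 ⟨C, hC, mem_filter.2 ⟨heA, u, by simp, heC u (by simp)⟩⟩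
      have hcomp : ∀ C ∈ Y, C.1 ∈ edgeComps (H \ B) := by
        intro C hC
        obtain ⟨v, hv⟩ := nonempty_of_mem_edgeComps C.2.1
        have : edgeClass (H \ B) v = C.1 := by
          apply Subset.antisymm
          · intro w hw
            rw [mem_edgeClass] at hw
            induction hw with
            | refl => exact hv
            | tail _ hcd ih =>
              rename_i c d _
              have hcdK : s(c, d) ∈ K := by
                refine mem_sdiff.2 ⟨(mem_sdiff.1 hcd).1, fun heA => (mem_sdiff.1 hcd).2 ?_⟩
                exact mem_biUnion.2 ⟨C, hC, mem_filter.2 ⟨heA, c, by simp, ih⟩⟩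
              exact mem_of_mem_edge C.2.1 hcdK (Sym2.mem_mk_left c d) ih (Sym2.mem_mk_right c d)
          · rw [← edgeClass_eq_of_mem C.2.1 hv]
            exact fun w hw => mem_edgeClass.2 ((mem_edgeClass.1 hw).mono hsub)
        exact this ▸ edgeClass_mem_edgeComps _ v
      have hodd : #Y ≤ #{U ∈ edgeComps (H \ B) | OddRank (H \ B) U} := by
        rw [← card_map (Function.Embedding.subtype _)]
        refine card_le_card fun U hU => ?_
        obtain ⟨C, hC, rfl⟩ := mem_map.1 hU
        refine mem_filter.2 ⟨hcomp C hC, ?_⟩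
        change Even _
        rw [show ((Function.Embedding.subtype _) C : Finset V) = C.1 from rfl, hwithin C hC]
        exact C.2.2
      rw [totalWeight_eq] at h1
      omega)
  have hφA : ∀ C, φ C ∈ A := fun C => (mem_filter.1 (hφI C)).1
  choose v hvφ hvC using fun C => (mem_filter.1 (hφI C)).2
  choose ε hεK hvε using fun C : ι => exists_mem_edge_of_oddRank C.2.1 C.2.2 (hvC C)
  have hεC : ∀ C, ∀ w ∈ ε C, w ∈ C.1 := fun C w hw =>
    mem_of_mem_edge C.2.1 (hεK C) (hvε C) (hvC C) hw
  have hεinj : Function.Injective ε := by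
    intro C D h
    exact Subtype.ext (eq_of_mem_edgeComps C.2.1 D.2.1 (hvC C) (hεC D _ (h ▸ hvε C)))
  set E := univ.image ε with hE
  have hEK : E ⊆ K := by
    intro e he
    obtain ⟨C, _, rfl⟩ := mem_image.1 he
    exact hεK C
  have hEcard : #E = Fintype.card ι := by
    rw [hE, card_image_of_injective _ hεinj, card_univ]
  set X := univ.image φ with hX
  have hXA : X ⊆ A := by
    intro e he
    obtain ⟨C, _, rfl⟩ := mem_image.1 he
    exact hφA C
  set H' := K \ E with hH'
  have hH'K : H' ⊆ K := sdiff_subset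
  have hH'card : #H' + #E = #K := card_sdiff_add_card_eq_card hEK
  -- the remaining edges satisfy the inequality again
  have hweight : ∀ D ⊆ H', totalWeight (H' \ D) ≤ #D + #(edgeComps K) := by
    intro D hD
    have hlocal : ∀ C ∈ edgeComps K, weightWithin (H' \ D) C ≤ #(edgesWithin D C) + 1 := by
      intro C hC
      have hDK : edgesWithin D C ⊆ K := fun e he => hH'K (hD (mem_edgesWithin.1 he).1)
      by_cases hodd : OddRank K C
      · let i : ι := ⟨C, hC, hodd⟩
        set B := insert (ε i) (edgesWithin D C) with hB
        have hBK : B ⊆ K := insert_subset (hεK i) hDK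
        have hBC : ∀ e ∈ B, ∀ v ∈ e, v ∈ C := by
          intro e he
          rcases mem_insert.1 he with rfl | he
          · exact hεC i
          · exact (mem_edgesWithin.1 he).2
        have h1 := totalWeight_sdiff_within hC hBC
        have h2 := hKlt B hBK (insert_nonempty _ _)
        have h3 : #B ≤ #(edgesWithin D C) + 1 := card_insert_le _ _
        have h4 : compWeight K C = 2 := by simp [compWeight, hodd]
        have h5 : weightWithin (H' \ D) C = weightWithin (K \ B) C := by
          refine weightWithin_congr (sdiff_subset.trans hH'K) sdiff_subset hC ?_
          ext e
          simp only [mem_edgesWithin, mem_sdiff, hH', hB, mem_insert, not_or]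
          constructor
          · rintro ⟨⟨⟨heK, heE⟩, heD⟩, heC⟩
            refine ⟨⟨heK, fun h => heE (h ▸ mem_image_of_mem ε (mem_univ i)),
              fun h => heD h.1⟩, heC⟩
          · rintro ⟨⟨heK, heε, heD⟩, heC⟩
            refine ⟨⟨⟨heK, fun h => ?_⟩, fun h => heD ⟨h, heC⟩⟩, heC⟩
            obtain ⟨j, _, rfl⟩ := mem_image.1 h
            apply heε
            congr 1
            exact Subtype.ext (eq_of_mem_edgeComps j.2.1 hC (hvC j) (heC _ (hvε j)))
        omega
      · set B := edgesWithin D C with hB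
        have hBC : ∀ e ∈ B, ∀ v ∈ e, v ∈ C := fun e he => (mem_edgesWithin.1 he).2
        have h1 := totalWeight_sdiff_within hC hBC
        have h2 := hKle B hDK
        have h4 : compWeight K C = 1 := by simp [compWeight, hodd]
        have h5 : weightWithin (H' \ D) C = weightWithin (K \ B) C := by
          refine weightWithin_congr (sdiff_subset.trans hH'K) sdiff_subset hC ?_
          ext e
          simp only [mem_edgesWithin, mem_sdiff, hH', hB]
          constructor
          · rintro ⟨⟨⟨heK, heE⟩, heD⟩, heC⟩
            exact ⟨⟨heK, fun h => heD h.1⟩, heC⟩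
          · rintro ⟨⟨heK, heD⟩, heC⟩
            refine ⟨⟨⟨heK, fun h => ?_⟩, fun h => heD ⟨h, heC⟩⟩, heC⟩
            obtain ⟨j, _, rfl⟩ := mem_image.1 h
            exact hodd (eq_of_mem_edgeComps j.2.1 hC (hvC j) (heC _ (hvε j)) ▸ j.2.2)
        omega
    rw [totalWeight_eq_sum_weightWithin (sdiff_subset.trans hH'K : H' \ D ⊆ K)]
    calc ∑ C ∈ edgeComps K, weightWithin (H' \ D) C
        ≤ ∑ C ∈ edgeComps K, (#(edgesWithin D C) + 1) := sum_le_sum hlocal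
      _ = ∑ C ∈ edgeComps K, #(edgesWithin D C) + #(edgeComps K) := by
          rw [sum_add_distrib, card_eq_sum_ones (edgeComps K)]
      _ ≤ #D + #(edgeComps K) := by
          have := sum_card_edgesWithin_le (H := K) (D := D)
          omega
  have hH'comps : #(edgeComps H') = #(edgeComps K) := by
    have h1 := hweight ∅ (empty_subset _)
    have h2 := card_edgeComps_le_totalWeight H'
    have h3 := card_edgeComps_anti hH'K
    simp at h1
    omega
  obtain ⟨F', hF'H, J', hF'card, hF'comps, hJ', hcover⟩ :=
    ih #H' (by omega) H' (by rwa [hH'comps]) rfl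
  have hF'K : F' ⊆ K := hF'H.trans hH'K
  have hdisj : Disjoint F' (A \ X) := by
    rw [disjoint_left]
    exact fun e he heA => (mem_sdiff.1 (hF'K he)).2 (mem_sdiff.1 heA).1
  have hcompsF : #(edgeComps (F' ∪ A \ X)) = #(edgeComps H) := by
    have h1 := card_edgeComps_submodular hF'K (A \ X)
    have h2 := card_edgeComps_anti (union_subset_union_left (t := A \ X) hF'K)
    have h3 : K ∪ A \ X = H \ X := by
      ext e
      have := @hXA e
      have := @hAH e
      simp only [hK, mem_union, mem_sdiff]
      tauto
    rw [h3] at h1 h2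
    omega
  have hAX : #(A \ X) + #X = #A := card_sdiff_add_card_eq_card hXA
  refine ⟨F' ∪ A \ X, union_subset (hF'K.trans hKH) (sdiff_subset.trans hAH),
    J' ∪ univ.image v, ?_, hcompsF, ?_, ?_⟩
  · rw [hcompsF, card_union_of_disjoint hdisj]
    omega
  · have h1 : #(J' ∪ univ.image v) ≤ #J' + Fintype.card ι :=
      (card_union_le _ _).trans (Nat.add_le_add_left card_image_le _)
    rw [card_union_of_disjoint hdisj]
    omega
  · intro e heH heF
    simp only [mem_union, mem_sdiff, not_or, not_and, not_not] at heF
    by_cases heA : e ∈ A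
    · obtain ⟨C, _, rfl⟩ := mem_image.1 (heF.2 heA)
      exact ⟨v C, mem_union_right _ (mem_image_of_mem v (mem_univ C)), hvφ C⟩
    · by_cases heE : e ∈ E
      · obtain ⟨C, _, rfl⟩ := mem_image.1 heE
        exact ⟨v C, mem_union_right _ (mem_image_of_mem v (mem_univ C)), hvε C⟩
      · obtain ⟨w, hw, hwe⟩ :=
          hcover e (mem_sdiff.2 ⟨mem_sdiff.2 ⟨heH, heA⟩, heE⟩) heF.1
        exact ⟨w, mem_union_left _ hw, hwe⟩

end ForestCover

section CubicGraphs

open Finset SimpleGraph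

variable {V : Type*} [Fintype V]

lemma card_edgeComps_eq_one {X : SimpleGraph V} [DecidableRel X.Adj] (hconn : X.Connected) :
    #(edgeComps X.edgeFinset) = 1 := by
  obtain ⟨v⟩ := hconn.nonempty
  rw [card_eq_one]
  refine ⟨edgeClass X.edgeFinset v, ?_⟩
  ext U
  rw [mem_edgeComps, mem_singleton]
  constructor
  · rintro ⟨w, rfl⟩
    have h := (reachable_iff_reflTransGen w v).1 (hconn.preconnected w v)
    refine edgeClass_eq_iff.2 (Relation.ReflTransGen.mono (fun a b hab => ?_) _ _ h)
    simpa using hab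
  · rintro rfl
    exact ⟨v, rfl⟩

variable [DecidableEq V]

/-- The edges of `H` with endpoints both inside and outside of `U`. -/
def edgeBoundary (H : Finset (Sym2 V)) (U : Finset V) : Finset (Sym2 V) :=
  H.filter fun e => (∃ v ∈ e, v ∈ U) ∧ ∃ v ∈ e, v ∉ U

lemma mk_mem_edgeBoundary {H : Finset (Sym2 V)} {U : Finset V} {u v : V} :
    s(u, v) ∈ edgeBoundary H U ↔ s(u, v) ∈ H ∧ (u ∈ U ∧ v ∉ U ∨ u ∉ U ∧ v ∈ U) := by
  simp only [edgeBoundary, mem_filter, Sym2.mem_iff, exists_eq_or_imp, exists_eq_left]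
  tauto

lemma edgeBoundary_compl (H : Finset (Sym2 V)) (U : Finset V) :
    edgeBoundary H Uᶜ = edgeBoundary H U := by
  ext e
  induction e using Sym2.ind with
  | _ u v =>
  simp only [mk_mem_edgeBoundary, mem_compl]
  tauto

variable (X : SimpleGraph V) [DecidableRel X.Adj]

lemma sum_degree_eq_within_add_boundary (U : Finset V) :
    ∑ v ∈ U, X.degree v =
      2 * #(edgesWithin X.edgeFinset U) + #(edgeBoundary X.edgeFinset U) := by
  classical
  have h1 : ∀ v ∈ U, X.degree v = #{e ∈ X.edgeFinset | v ∈ e} := by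
    intro v _
    rw [← card_incidenceFinset_eq_degree, incidenceFinset_eq_filter]
  rw [sum_congr rfl h1]
  have h2 := sum_card_bipartiteAbove_eq_sum_card_bipartiteBelow (s := U) (t := X.edgeFinset)
    (fun v e => v ∈ e)
  simp only [bipartiteAbove, bipartiteBelow] at h2
  rw [h2, edgesWithin, edgeBoundary, card_filter, card_filter, mul_sum, ← sum_add_distrib]
  refine sum_congr rfl fun e he => ?_
  induction e using Sym2.ind with
  | _ u v =>
  have hne : u ≠ v := by
    rintro rfl
    simp at he
  simp only [Sym2.mem_iff, forall_eq_or_imp, forall_eq, exists_eq_or_imp, exists_eq_left]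
  have h3 : {a ∈ U | a = u ∨ a = v} = ({u, v} : Finset V).filter (· ∈ U) := by
    ext a
    simp only [mem_filter, mem_insert, mem_singleton]
    tauto
  rw [h3]
  by_cases hu : u ∈ U <;> by_cases hv : v ∈ U <;>
    simp [filter_insert, filter_singleton, hu, hv, hne]

lemma card_edgesWithin_eq (U : Finset V) [Fintype (X.induce (U : Set V)).edgeSet] :
    #(edgesWithin X.edgeFinset U) = #(X.induce (U : Set V)).edgeFinset := by
  classical
  have h := congrArg card (map_edgeFinset_induce (G := X) (s := (U : Set V)))
  rw [card_map] at h
  have hE : edgesWithin X.edgeFinset U = X.edgeFinset ∩ (U : Set V).toFinset.sym2 := by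
    ext e
    simp [mem_edgesWithin, mem_sym2_iff]
  rw [hE]
  convert h.symm

variable {X}

lemma isTree_of_isAcyclic_of_card_le {W : Type*} [Fintype W] [Nonempty W] {G : SimpleGraph W}
    [Fintype G.edgeSet] (hG : G.IsAcyclic) :
    #G.edgeFinset + 1 ≤ Fintype.card W ∧
      (#G.edgeFinset + 1 = Fintype.card W → G.IsTree) := by
  classical
  obtain ⟨T, hGT, -, hT⟩ := (connected_top (V := W)).exists_isTree_le_of_le_of_isAcyclic
    (le_top : G ≤ ⊤) hG
  have hcard := hT.card_edgeFinset
  have hsub : G.edgeFinset ⊆ T.edgeFinset := edgeFinset_mono hGT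
  refine ⟨by have := card_le_card hsub; omega, fun h => ?_⟩
  have heq : G.edgeFinset = T.edgeFinset := eq_of_subset_of_card_le hsub (by omega)
  rw [edgeFinset_inj] at heq
  rwa [heq]

lemma card_edgesWithin_lt_of_isAcyclic {U : Finset V} (hU : U.Nonempty)
    (h : (X.induce (U : Set V)).IsAcyclic) :
    #(edgesWithin X.edgeFinset U) + 1 ≤ #U ∧
      (#(edgesWithin X.edgeFinset U) + 1 = #U → (X.induce (U : Set V)).IsTree) := by
  classical
  have : Nonempty (U : Set V) := hU.coe_sort
  have h1 := isTree_of_isAcyclic_of_card_le h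
  rw [← card_edgesWithin_eq] at h1
  simpa using h1

lemma four_le_card_edgeBoundary (hc : CyclicallyConnected X 4) {U : Finset V}
    (hU : ¬ (X.induce (U : Set V)).IsAcyclic)
    (hU' : ¬ (X.induce ((Uᶜ : Finset V) : Set V)).IsAcyclic) :
    4 ≤ #(edgeBoundary X.edgeFinset U) := by
  have hlift : ∀ W : Finset V, (W = U ∨ W = Uᶜ) → ¬ (X.induce (W : Set V)).IsAcyclic →
      ∃ u ∈ W, ∃ p : (X.deleteEdges (edgeBoundary X.edgeFinset U : Set (Sym2 V))).Walk u u,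
        p.IsCycle := by
    intro W hW h
    simp only [IsAcyclic, not_forall, not_not] at h
    obtain ⟨u, p, hp⟩ := h
    let f : X.induce (W : Set V) →g
        X.deleteEdges (edgeBoundary X.edgeFinset U : Set (Sym2 V)) :=
      ⟨Subtype.val, by
        rintro ⟨a, ha⟩ ⟨b, hb⟩ hab
        rw [deleteEdges_adj]
        refine ⟨hab, fun hmem => ?_⟩
        rw [mem_coe, mk_mem_edgeBoundary] at hmem
        rw [mem_coe] at ha hb
        rcases hW with rfl | rfl
        · tauto
        · rw [mem_compl] at ha hb
          tauto⟩
    exact ⟨u.1, u.2, p.map f, hp.map Subtype.val_injective⟩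
  obtain ⟨u, hu, p, hp⟩ := hlift U (Or.inl rfl) hU
  obtain ⟨v, hv, q, hq⟩ := hlift Uᶜ (Or.inr rfl) hU'
  have hnr : ¬ (X.deleteEdges (edgeBoundary X.edgeFinset U : Set (Sym2 V))).Reachable u v := by
    intro h
    rw [reachable_iff_reflTransGen] at h
    have hmem : ∀ w, Relation.ReflTransGen
        (X.deleteEdges (edgeBoundary X.edgeFinset U : Set (Sym2 V))).Adj u w → w ∈ U := by
      intro w hw
      induction hw with
      | refl => exact hu
      | tail _ hcd ih =>
        rw [deleteEdges_adj, mem_coe, mk_mem_edgeBoundary, mem_edgeFinset, mem_edgeSet] at hcd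
        tauto
    exact mem_compl.1 hv (hmem v h)
  refine hc _ (fun e he => ?_) ⟨fun h => hnr (h.preconnected u v), u, v, p, q, hp, hq, hnr⟩
  exact mem_edgeFinset.1 (mem_filter.1 he).1

lemma two_lt_card_edgeBoundary (hcubic : ∀ v : V, X.degree v = 3)
    (hc : CyclicallyConnected X 4) {U : Finset V} (hU : U.Nonempty) (hU' : Uᶜ.Nonempty) :
    2 < #(edgeBoundary X.edgeFinset U) := by
  by_contra! hle
  have key : ∀ W : Finset V, W.Nonempty → #(edgeBoundary X.edgeFinset W) ≤ 2 →
      ¬ (X.induce (W : Set V)).IsAcyclic := by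
    intro W hW hWle hac
    have h1 := (card_edgesWithin_lt_of_isAcyclic hW hac).1
    have h2 := sum_degree_eq_within_add_boundary X W
    rw [sum_congr rfl fun v _ => hcubic v, sum_const, smul_eq_mul] at h2
    omega
  have := four_le_card_edgeBoundary hc (key U hU hle)
    (key Uᶜ hU' (by rwa [edgeBoundary_compl]))
  omega

lemma not_isAcyclic_of_oddRank {L : Finset (Sym2 V)} (hL : L ⊆ X.edgeFinset) {C : Finset V}
    (hC : C ∈ edgeComps L) (hodd : OddRank L C) : ¬ (X.induce (C : Set V)).IsAcyclic := by
  classical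
  intro hac
  obtain ⟨G, hG⟩ : ∃ G : SimpleGraph V, G = fromEdgeSet (L : Set (Sym2 V)) := ⟨_, rfl⟩
  have hadj : ∀ a b, G.Adj a b ↔ s(a, b) ∈ L := by
    intro a b
    rw [hG, fromEdgeSet_adj, mem_coe]
    refine ⟨fun h => h.1, fun h => ⟨h, ?_⟩⟩
    have := hL h
    rw [mem_edgeFinset, mem_edgeSet] at this
    exact this.ne
  have hGX : G ≤ X := by
    intro a b hab
    simpa using hL ((hadj a b).1 hab)
  have hacG : (G.induce (C : Set V)).IsAcyclic :=
    hac.anti (comap_monotone _ hGX)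
  have hne : Nonempty (C : Set V) := (nonempty_of_mem_edgeComps hC).coe_sort
  have hconn : (G.induce (C : Set V)).Connected := by
    refine ⟨fun a b => ?_⟩
    have hab : EdgeReach L a.1 b.1 := by
      rw [← edgeClass_eq_iff, edgeClass_eq_of_mem hC a.2, edgeClass_eq_of_mem hC b.2]
    have : ∀ c, EdgeReach L a.1 c → ∃ hc : c ∈ (C : Set V),
        (G.induce (C : Set V)).Reachable a ⟨c, hc⟩ := by
      intro c hac
      induction hac with
      | refl => exact ⟨a.2, Reachable.refl _⟩
      | tail _ hcd ih =>
        rename_i c d _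
        obtain ⟨hc, hr⟩ := ih
        have hd : d ∈ C := mem_of_mem_edge hC hcd (Sym2.mem_mk_left c d) hc
          (Sym2.mem_mk_right c d)
        refine ⟨hd, hr.trans (Adj.reachable ?_)⟩
        exact (hadj c d).2 hcd
    exact (this b.1 hab).2
  have hcard := (IsTree.mk hconn hacG).card_edgeFinset
  rw [← card_edgesWithin_eq] at hcard
  have hE : #(edgesWithin L C) + 1 = Fintype.card (C : Set V) := by
    rw [← hcard]
    congr 2
    ext e
    induction e using Sym2.ind with
    | _ a b => rw [mem_edgesWithin, mem_edgesWithin, mem_edgeFinset, mem_edgeSet, hadj]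
  rw [OddRank, Nat.even_iff] at hodd
  have : Fintype.card (C : Set V) = #C := by simp
  omega

lemma totalWeight_sdiff_le (hcubic : ∀ v : V, X.degree v = 3)
    (hc : CyclicallyConnected X 4) (hn : Fintype.card V % 4 = 2) {A : Finset (Sym2 V)}
    (hA : A ⊆ X.edgeFinset) : totalWeight (X.edgeFinset \ A) ≤ #A + 1 := by
  classical
  set L := X.edgeFinset \ A with hL
  have hLX : L ⊆ X.edgeFinset := sdiff_subset
  have hpar := totalWeight_parity L
  have hsum := X.sum_degrees_eq_twice_card_edges
  rw [sum_congr rfl fun v _ => hcubic v, sum_const, smul_eq_mul, card_univ] at hsum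
  have hLA : #L + #A = #X.edgeFinset := card_sdiff_add_card_eq_card hA
  have hw := totalWeight_eq L
  have hoddle : #{U ∈ edgeComps L | OddRank L U} ≤ #(edgeComps L) := card_filter_le _ _
  rw [Nat.even_iff] at hpar
  rcases le_or_gt #(edgeComps L) 1 with h1 | h1
  · omega
  have hproper : ∀ C ∈ edgeComps L, Cᶜ.Nonempty := by
    intro C hC
    obtain ⟨D, hD, hne⟩ := exists_mem_ne h1 C
    obtain ⟨v, hv⟩ := nonempty_of_mem_edgeComps hD
    exact ⟨v, mem_compl.2 fun hvC => hne (eq_of_mem_edgeComps hD hC hv hvC)⟩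
  have hbA : ∀ C ∈ edgeComps L, edgeBoundary X.edgeFinset C = edgeBoundary A C := by
    intro C hC
    ext e
    simp only [edgeBoundary, mem_filter]
    refine ⟨fun ⟨he, ⟨v, hv, hvC⟩, w, hw, hwC⟩ => ⟨?_, ⟨v, hv, hvC⟩, w, hw, hwC⟩,
      fun ⟨he, h⟩ => ⟨hA he, h⟩⟩
    by_contra heA
    exact hwC (mem_of_mem_edge hC (mem_sdiff.2 ⟨he, heA⟩) hv hvC hw)
  have hbsum : ∑ C ∈ edgeComps L, #(edgeBoundary X.edgeFinset C) ≤ 2 * #A := by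
    rw [sum_congr rfl fun C hC => congrArg card (hbA C hC)]
    have h2 := sum_card_bipartiteAbove_eq_sum_card_bipartiteBelow (s := edgeComps L) (t := A)
      (fun C e => (∃ v ∈ e, v ∈ C) ∧ ∃ v ∈ e, v ∉ C)
    simp only [bipartiteAbove, bipartiteBelow] at h2
    unfold edgeBoundary
    rw [h2, mul_comm, ← smul_eq_mul]
    refine sum_le_card_nsmul _ _ _ fun e _ => ?_
    induction e using Sym2.ind with
    | _ u v =>
    refine (card_le_card (t := {edgeClass L u, edgeClass L v}) fun C hC => ?_).trans card_le_two
    obtain ⟨hC, ⟨w, hw, hwC⟩, -⟩ := mem_filter.1 hC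
    rw [mem_insert, mem_singleton, ← edgeClass_eq_of_mem hC hwC]
    rcases Sym2.mem_iff.1 hw with rfl | rfl
    · exact Or.inl rfl
    · exact Or.inr rfl
  rcases le_or_gt #{U ∈ edgeComps L | OddRank L U} 1 with h2 | h2
  · have h3 : #(edgeComps L) * 2 ≤ ∑ C ∈ edgeComps L, #(edgeBoundary X.edgeFinset C) := by
      rw [← smul_eq_mul]
      exact card_nsmul_le_sum _ _ _ fun C hC =>
        (two_lt_card_edgeBoundary hcubic hc (nonempty_of_mem_edgeComps hC) (hproper C hC)).le
    omega
  · have h3 : ∑ C ∈ edgeComps L, 2 * compWeight L C ≤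
        ∑ C ∈ edgeComps L, #(edgeBoundary X.edgeFinset C) := by
      refine sum_le_sum fun C hC => ?_
      by_cases hodd : OddRank L C
      · obtain ⟨D, hD, hne⟩ := exists_mem_ne h2 C
        obtain ⟨hD, hDodd⟩ := mem_filter.1 hD
        have hDC : (D : Set V) ⊆ ((Cᶜ : Finset V) : Set V) := fun v hv =>
          mem_coe.2 (mem_compl.2 fun hvC => hne (eq_of_mem_edgeComps hD hC hv hvC))
        have h4 := four_le_card_edgeBoundary hc (not_isAcyclic_of_oddRank hLX hC hodd)
          fun h => not_isAcyclic_of_oddRank hLX hD hDodd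
            (h.comap (induceHomOfLE X hDC).toHom (induceHomOfLE X hDC).injective)
        simpa [compWeight, hodd] using h4
      · have := two_lt_card_edgeBoundary hcubic hc (nonempty_of_mem_edgeComps hC) (hproper C hC)
        simp only [compWeight, hodd, if_false]
        omega
    rw [← mul_sum] at h3
    change 2 * totalWeight L ≤ _ at h3
    omega

lemma exists_large_isAcyclic (hconn : X.Connected) (hcubic : ∀ v : V, X.degree v = 3)
    (hc : CyclicallyConnected X 4) (hn : Fintype.card V % 4 = 2) :
    ∃ T : Finset V, (X.induce (T : Set V)).IsAcyclic ∧
      3 * Fintype.card V ≤ 4 * #T + 2 := by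
  classical
  have hone := card_edgeComps_eq_one hconn
  obtain ⟨F, hFX, J, hF, hFcomps, hJ, hcover⟩ := exists_forest_cover X.edgeFinset
    fun A hA => (totalWeight_sdiff_le hcubic hc hn hA).trans_eq (by rw [hone])
  rw [hone] at hFcomps
  have hsum := X.sum_degrees_eq_twice_card_edges
  rw [sum_congr rfl fun v _ => hcubic v, sum_const, smul_eq_mul, card_univ] at hsum
  refine ⟨Jᶜ, ?_, by rw [card_compl]; have := card_le_univ J; omega⟩
  set G : SimpleGraph V := fromEdgeSet (F : Set (Sym2 V)) with hG
  have hadj : ∀ a b, G.Adj a b ↔ s(a, b) ∈ F := by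
    intro a b
    rw [hG, fromEdgeSet_adj, mem_coe]
    refine ⟨fun h => h.1, fun h => ⟨h, ?_⟩⟩
    have := hFX h
    rw [mem_edgeFinset, mem_edgeSet] at this
    exact this.ne
  have hedge : G.edgeFinset = F := by
    ext e
    induction e using Sym2.ind with
    | _ a b => rw [mem_edgeFinset, mem_edgeSet, hadj]
  have hGconn : G.Connected := by
    have := hconn.nonempty
    refine ⟨fun a b => ?_⟩
    have hab : EdgeReach F a b := edgeClass_eq_iff.1
      (card_le_one.1 hFcomps.le _ (edgeClass_mem_edgeComps F a) _ (edgeClass_mem_edgeComps F b))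
    rw [reachable_iff_reflTransGen]
    exact Relation.ReflTransGen.mono (fun a b hab => (hadj a b).2 hab) _ _ hab
  have htree : G.IsTree := by
    rw [isTree_iff_connected_and_card]
    refine ⟨hGconn, ?_⟩
    rw [Nat.card_eq_fintype_card, Nat.card_eq_fintype_card, ← edgeFinset_card, hedge]
    omega
  let f : X.induce ((Jᶜ : Finset V) : Set V) →g G :=
    ⟨Subtype.val, by
      rintro ⟨a, ha⟩ ⟨b, hb⟩ hab
      rw [hadj]
      by_contra hmem
      obtain ⟨v, hvJ, hv⟩ := hcover s(a, b) (by simpa using hab) hmem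
      rcases Sym2.mem_iff.1 hv with rfl | rfl
      · exact mem_compl.1 (mem_coe.1 ha) hvJ
      · exact mem_compl.1 (mem_coe.1 hb) hvJ⟩
  exact htree.isAcyclic.comap f Subtype.val_injective

end CubicGraphs

/-- Payan–Sakarovitch: if `X` is a connected cyclically 4-connected cubic simple graph
on `n ≡ 2 (mod 4)` vertices and `S` is a maximum-size cyclically stable set, then
`|S| = (3n-2)/4`, the subgraph induced by `S` is a tree, and the complement of `S` is
an independent set of vertices. -/
theorem stmt7 {V : Type*} [Fintype V] (X : SimpleGraph V) [DecidableRel X.Adj]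
    (hconn : X.Connected) (hcubic : ∀ v : V, X.degree v = 3)
    (hc4c : CyclicallyConnected X 4) (hn : Fintype.card V % 4 = 2)
    (S : Finset V) (hS : (X.induce (↑S : Set V)).IsAcyclic)
    (hmax : ∀ T : Finset V, (X.induce (↑T : Set V)).IsAcyclic → T.card ≤ S.card) :
    4 * S.card = 3 * Fintype.card V - 2 ∧
      (X.induce (↑S : Set V)).IsTree ∧
      ((↑S : Set V)ᶜ).Pairwise (fun u v => ¬ X.Adj u v) := by
  classical
  obtain ⟨T, hT, hTcard⟩ := exists_large_isAcyclic hconn hcubic hc4c hn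
  have hTS := hmax T hT
  have hSne : S.Nonempty := Finset.card_pos.1 (by omega)
  have hac := card_edgesWithin_lt_of_isAcyclic hSne hS
  have h1 := sum_degree_eq_within_add_boundary X S
  have h2 := sum_degree_eq_within_add_boundary X Sᶜ
  rw [Finset.sum_congr rfl fun v _ => hcubic v, Finset.sum_const, smul_eq_mul] at h1 h2
  rw [edgeBoundary_compl] at h2
  have h3 := Finset.card_add_card_compl S
  refine ⟨by omega, hac.2 (by omega), fun u hu v hv _ hadj => ?_⟩
  have h4 : edgesWithin X.edgeFinset Sᶜ = ∅ := Finset.card_eq_zero.1 (by omega)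
  refine Finset.notMem_empty s(u, v) (h4 ▸ mem_edgesWithin.2 ⟨by simpa using hadj, fun w hw => ?_⟩)
  rcases Sym2.mem_iff.1 hw with rfl | rfl
  · simpa using hu
  · simpa using hv
end

section
/- Let X be a connected cyclically 4-connected cubic simple graph of order n with n ≡ 0 (mod 4), and let S be a cyclically stable subset of V(X) of maximum size. Then |S| = (3n−4)/4 and either the subgraph induced by S is a tree and the subgraph induced by V(X)∖S has exactly one edge, or the subgraph induced by S is a forest with exactly two components and V(X)∖S is an independent set of vertices. -/
namespace OrientationParity

open Finset

section Partition

variable {V : Type*} [DecidableEq V]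

theorem exists_finpartition_replace {C : Finset V} (P : Finpartition C) {Y : Finset (Finset V)}
    (hY : Y ⊆ P.parts) (Q : Finpartition (Y.biUnion id)) :
    ∃ P' : Finpartition C, ∀ g : Finset V → ℕ,
      ∑ D ∈ P'.parts, g D + ∑ D ∈ Y, g D = ∑ D ∈ P.parts, g D + ∑ D ∈ Q.parts, g D := by
  have hdisj : Disjoint (P.parts \ Y) Q.parts := by
    rw [Finset.disjoint_left]
    intro D hD hDQ
    obtain ⟨v, hv⟩ := Q.nonempty_of_mem_parts hDQ
    obtain ⟨B, hB, hvB⟩ := mem_biUnion.1 (Q.subset hDQ hv)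
    have := P.eq_of_mem_parts (mem_sdiff.1 hD).1 (hY hB) hv hvB
    exact (mem_sdiff.1 hD).2 (this ▸ hB)
  refine ⟨Finpartition.ofExistsUnique (P.parts \ Y ∪ Q.parts) ?_ ?_ ?_, ?_⟩
  · intro D hD
    rcases mem_union.1 hD with h | h
    · exact P.subset (mem_sdiff.1 h).1
    · refine (Q.subset h).trans (biUnion_subset.2 fun B hB => P.subset (hY hB))
  · intro v hv
    by_cases hvY : v ∈ Y.biUnion id
    · obtain ⟨D, ⟨hD, hvD⟩, huniq⟩ := Q.existsUnique_mem hvY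
      refine ⟨D, ⟨mem_union_right _ hD, hvD⟩, ?_⟩
      rintro B ⟨hB, hvB⟩
      rcases mem_union.1 hB with h | h
      · obtain ⟨A, hA, hvA⟩ := mem_biUnion.1 hvY
        have := P.eq_of_mem_parts (mem_sdiff.1 h).1 (hY hA) hvB hvA
        exact absurd (this ▸ hA) (mem_sdiff.1 h).2
      · exact huniq _ ⟨h, hvB⟩
    · obtain ⟨D, ⟨hD, hvD⟩, huniq⟩ := P.existsUnique_mem hv
      refine ⟨D, ⟨mem_union_left _ (mem_sdiff.2 ⟨hD, fun h => hvY ?_⟩), hvD⟩, ?_⟩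
      · exact mem_biUnion.2 ⟨D, h, hvD⟩
      · rintro B ⟨hB, hvB⟩
        rcases mem_union.1 hB with h | h
        · exact huniq _ ⟨(mem_sdiff.1 h).1, hvB⟩
        · exact absurd (Q.subset h hvB) hvY
  · intro h
    rcases mem_union.1 h with h | h
    · exact P.empty_notMem_parts (mem_sdiff.1 h).1
    · exact Q.empty_notMem_parts h
  · intro g
    have h1 : ∑ D ∈ P.parts \ Y ∪ Q.parts, g D = ∑ D ∈ P.parts \ Y, g D + ∑ D ∈ Q.parts, g D :=
      sum_union hdisj
    have h2 := sum_sdiff (f := g) hY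
    simp only [Finpartition.ofExistsUnique]
    omega

theorem sum_parts_sum {C : Finset V} (P : Finpartition C) (g : V → ℕ) :
    ∑ D ∈ P.parts, ∑ v ∈ D, g v = ∑ v ∈ C, g v := by
  conv_rhs => rw [← P.biUnion_parts]
  rw [sum_biUnion P.disjoint]
  rfl

theorem sum_parts_mem {C : Finset V} (P : Finpartition C) {r : V} (hr : r ∈ C) :
    ∑ D ∈ P.parts, (if r ∈ D then 1 else 0) = 1 := by
  rw [sum_eq_single_of_mem (P.part r) (P.part_mem.2 hr), if_pos (P.mem_part_self.2 hr)]
  intro B hB hne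
  rw [if_neg fun h => hne (P.part_eq_of_mem hB h).symm]

end Partition

section Orientation

variable {V ι : Type*} (a b : ι → V)

/-- The head of the edge `e` in the orientation `σ`. -/
def head (σ : ι → Bool) (e : ι) : V := bif σ e then b e else a e

/-- The tail of the edge `e` in the orientation `σ`. -/
def tail (σ : ι → Bool) (e : ι) : V := bif σ e then a e else b e

theorem head_comp {W : Type*} (f : V → W) (σ : ι → Bool) (e : ι) :
    head (fun e => f (a e)) (fun e => f (b e)) σ e = f (head a b σ e) := by
  cases h : σ e <;> simp [head, h]

theorem tail_comp {W : Type*} (f : V → W) (σ : ι → Bool) (e : ι) :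
    tail (fun e => f (a e)) (fun e => f (b e)) σ e = f (tail a b σ e) := by
  cases h : σ e <;> simp [tail, h]

theorem head_mem {K : Finset V} {e : ι} (h : a e ∈ K ∧ b e ∈ K) (σ : ι → Bool) :
    head a b σ e ∈ K := by
  cases h' : σ e
  · simpa [head, h'] using h.1
  · simpa [head, h'] using h.2

theorem tail_mem {K : Finset V} {e : ι} (h : a e ∈ K ∧ b e ∈ K) (σ : ι → Bool) :
    tail a b σ e ∈ K := by
  cases h' : σ e
  · simpa [tail, h'] using h.2
  · simpa [tail, h'] using h.1

end Orientation

section Multigraph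

variable {V ι : Type*} [DecidableEq V] (a b : ι → V)

/-- The edges of `E` with both ends in `D`. -/
def inside (E : Finset ι) (D : Finset V) : Finset ι := {e ∈ E | a e ∈ D ∧ b e ∈ D}

/-- An orientation with in-degrees `m` exists as soon as every vertex set spans few enough
edges (Hakimi). -/
theorem exists_orientation_indegree_eq (E : Finset ι) (K : Finset V) (m : V → ℕ)
    (hE : ∀ e ∈ E, a e ∈ K ∧ b e ∈ K) (hsum : ∑ v ∈ K, m v = #E)
    (hin : ∀ Y ⊆ K, #(inside a b E Y) ≤ ∑ v ∈ Y, m v) :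
    ∃ σ : ι → Bool, ∀ v ∈ K, #{e ∈ E | head a b σ e = v} = m v := by
  classical
  let slots : V → Finset (V × ℕ) := fun v => (range (m v)).map ⟨Prod.mk v, Prod.mk_right_injective v⟩
  have hslot : ∀ v p, p ∈ slots v ↔ p.1 = v ∧ p.2 < m v := by
    rintro v ⟨w, k⟩
    simp [slots]
    grind
  have hall : ∀ s : Finset E, #s ≤ #(s.biUnion fun e => slots (a e) ∪ slots (b e)) := by
    intro s
    set Y := s.image (fun e : E => a e) ∪ s.image (fun e : E => b e) with hYdef
    have h1 : s.biUnion (fun e => slots (a e) ∪ slots (b e)) = Y.biUnion slots := by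
      ext p
      simp only [mem_biUnion, mem_union, hYdef, mem_image]
      constructor
      · rintro ⟨e, he, h | h⟩
        · exact ⟨_, Or.inl ⟨e, he, rfl⟩, h⟩
        · exact ⟨_, Or.inr ⟨e, he, rfl⟩, h⟩
      · rintro ⟨_, ⟨e, he, rfl⟩ | ⟨e, he, rfl⟩, h⟩
        · exact ⟨e, he, Or.inl h⟩
        · exact ⟨e, he, Or.inr h⟩
    have h2 : #(Y.biUnion slots) = ∑ v ∈ Y, m v := by
      rw [card_biUnion]
      · simp [slots]
      · intro x _ y _ hxy
        refine Finset.disjoint_left.2 fun p hp hp' => ?_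
        exact hxy (((hslot _ _).1 hp).1.symm.trans ((hslot _ _).1 hp').1)
    have h3 : #s ≤ #(inside a b E Y) := by
      rw [← card_map (Function.Embedding.subtype _)]
      apply card_le_card
      intro e he
      obtain ⟨e', he', rfl⟩ := mem_map.1 he
      simp only [inside, mem_filter, hYdef, mem_union, mem_image]
      exact ⟨e'.2, Or.inl ⟨e', he', rfl⟩, Or.inr ⟨e', he', rfl⟩⟩
    rw [h1, h2]
    refine h3.trans (hin Y ?_)
    intro v hv
    simp only [hYdef, mem_union, mem_image] at hv
    rcases hv with ⟨e, _, rfl⟩ | ⟨e, _, rfl⟩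
    · exact (hE e e.2).1
    · exact (hE e e.2).2
  obtain ⟨f, hf, hfs⟩ := (Finset.all_card_le_biUnion_card_iff_exists_injective _).1 hall
  let σ : ι → Bool := fun e => if h : e ∈ E then decide (f ⟨e, h⟩ ∈ slots (b e)) else true
  have hσ : ∀ e (h : e ∈ E), f ⟨e, h⟩ ∈ slots (head a b σ e) := by
    intro e h
    have := mem_union.1 (hfs ⟨e, h⟩)
    by_cases hb : f ⟨e, h⟩ ∈ slots (b e)
    · simp [head, σ, h, hb]
    · simpa [head, σ, h, hb] using this
  refine ⟨σ, ?_⟩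
  have hle : ∀ v ∈ K, #{e ∈ E | head a b σ e = v} ≤ m v := by
    intro v _
    rw [← card_range (m v)]
    rw [← card_map (s := range (m v)) ⟨Prod.mk v, Prod.mk_right_injective v⟩]
    change _ ≤ #(slots v)
    refine card_le_card_of_injOn (fun e => if h : e ∈ E then f ⟨e, h⟩ else (v, 0)) ?_ ?_
    · intro e he
      obtain ⟨he, hv⟩ := mem_filter.1 he
      simpa [he] using hv ▸ hσ e he
    · intro e he e' he' h
      have h1 := (mem_filter.1 he).1
      have h2 := (mem_filter.1 he').1
      simp only [h1, h2, dif_pos] at h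
      simpa using hf h
  refine (sum_eq_sum_iff_of_le hle).1 ?_
  rw [hsum, ← card_eq_sum_card_fiberwise]
  intro e he
  cases h : σ e
  · simpa [head, h] using (hE e he).1
  · simpa [head, h] using (hE e he).2

/-- If every proper vertex set containing `r` is left by an edge, then there is a rank function
along which every vertex other than `r` has a parent. -/
theorem exists_rank (hd tl : ι → V) (E : Finset ι) (K : Finset V) (r : V)
    (hE : ∀ e ∈ E, hd e ∈ K) (hrK : r ∈ K)
    (hclosed : ∀ Z : Finset V, r ∈ Z → (∀ e ∈ E, tl e ∈ Z → hd e ∈ Z) → K ⊆ Z) :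
    ∃ rk : V → ℕ, ∀ v ∈ K, v ≠ r → ∃ e ∈ E, hd e = v ∧ rk (tl e) < rk v := by
  classical
  let good : Finset V → Prop := fun Z => r ∈ Z ∧ ∃ rk : V → ℕ, ∀ v ∈ Z, v ≠ r →
    ∃ e ∈ E, hd e = v ∧ tl e ∈ Z ∧ rk (tl e) < rk v
  have h0 : ({Z ∈ K.powerset | good Z}).Nonempty :=
    ⟨{r}, by simp [good, hrK]⟩
  obtain ⟨Z, hZ, hmax⟩ := exists_max_image _ card h0
  obtain ⟨hZK, hrZ, rk, hrk⟩ := mem_filter.1 hZ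
  have : K ⊆ Z := by
    refine hclosed Z hrZ fun e he htl => ?_
    by_contra hhd
    have hmem : insert (hd e) Z ∈ ({Z ∈ K.powerset | good Z}) := by
      refine mem_filter.2 ⟨mem_powerset.2 (insert_subset (hE e he) (mem_powerset.1 hZK)),
        mem_insert_of_mem hrZ, Function.update rk (hd e) (rk (tl e) + 1), ?_⟩
      intro v hv hvr
      have hne : ∀ x ∈ Z, x ≠ hd e := fun x hx h => hhd (h ▸ hx)
      rcases mem_insert.1 hv with rfl | hv
      · exact ⟨e, he, rfl, mem_insert_of_mem htl, by simp [Function.update_of_ne (hne _ htl)]⟩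
      · obtain ⟨e', he', h1, h2, h3⟩ := hrk v hv hvr
        refine ⟨e', he', h1, mem_insert_of_mem h2, ?_⟩
        rwa [Function.update_of_ne (hne _ h2), Function.update_of_ne (hne _ hv)]
    have := hmax _ hmem
    rw [card_insert_of_notMem hhd] at this
    omega
  refine ⟨rk, fun v hv hvr => ?_⟩
  obtain ⟨e, he, h1, -, h3⟩ := hrk v (this hv) hvr
  exact ⟨e, he, h1, h3⟩

/-- The parity by which `D` fails to admit one entering edge if `r ∉ D` (and none if `r ∈ D`),
when in-degrees are to be congruent to `t` modulo two. -/
def oddity (E : Finset ι) (r : V) (t : V → ℕ) (D : Finset V) : ℕ :=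
  (∑ v ∈ D, t v + #(inside a b E D) + 1 + if r ∈ D then 1 else 0) % 2

/-- The contribution of a part to the partition condition. -/
def partWeight (E : Finset ι) (r : V) (t : V → ℕ) (D : Finset V) : ℕ :=
  1 + #(inside a b E D) + oddity a b E r t D

/-- The edges of `E` joining different parts of `P`. -/
def cross {C : Finset V} (P : Finpartition C) (E : Finset ι) : Finset ι :=
  {e ∈ E | P.part (a e) ≠ P.part (b e)}

theorem sum_partWeight_mod_two {C : Finset V} (P : Finpartition C) (E : Finset ι) {r : V}
    (hr : r ∈ C) (t : V → ℕ) :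
    (∑ D ∈ P.parts, partWeight a b E r t D) % 2 = (∑ v ∈ C, t v + 1) % 2 := by
  rw [← sum_parts_sum P t, ← sum_parts_mem P hr, ← sum_add_distrib, sum_nat_mod,
    sum_nat_mod P.parts 2 fun D => ∑ v ∈ D, t v + if r ∈ D then 1 else 0]
  congr 1
  refine sum_congr rfl fun D _ => ?_
  unfold partWeight oddity
  omega

theorem mem_biUnion_iff_part_mem {C : Finset V} (P : Finpartition C) {Y : Finset (Finset V)}
    (hY : Y ⊆ P.parts) {v : V} (hv : v ∈ C) : v ∈ Y.biUnion id ↔ P.part v ∈ Y := by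
  rw [mem_biUnion]
  constructor
  · rintro ⟨D, hD, hvD⟩
    rwa [P.part_eq_of_mem (hY hD) hvD]
  · intro h
    exact ⟨_, h, P.mem_part_self.2 hv⟩

theorem card_inside_biUnion {C : Finset V} (P : Finpartition C) {E : Finset ι}
    (hE : ∀ e ∈ E, a e ∈ C ∧ b e ∈ C) {Y : Finset (Finset V)} (hY : Y ⊆ P.parts) :
    #(inside a b E (Y.biUnion id)) =
      #(inside (fun e => P.part (a e)) (fun e => P.part (b e)) (cross a b P E) Y) +
        ∑ D ∈ Y, #(inside a b E D) := by
  rw [← card_filter_add_card_filter_not (s := inside a b E (Y.biUnion id))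
    (fun e => P.part (a e) ≠ P.part (b e))]
  congr 1
  · congr 1
    ext e
    simp only [inside, cross, mem_filter]
    constructor
    · rintro ⟨⟨he, h1, h2⟩, h3⟩
      exact ⟨⟨he, h3⟩, (mem_biUnion_iff_part_mem P hY (hE e he).1).1 h1,
        (mem_biUnion_iff_part_mem P hY (hE e he).2).1 h2⟩
    · rintro ⟨⟨he, h3⟩, h1, h2⟩
      exact ⟨⟨he, (mem_biUnion_iff_part_mem P hY (hE e he).1).2 h1,
        (mem_biUnion_iff_part_mem P hY (hE e he).2).2 h2⟩, h3⟩
  · rw [card_eq_sum_card_fiberwise (f := fun e => P.part (a e)) (t := Y)]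
    · refine sum_congr rfl fun D hD => ?_
      congr 1
      ext e
      simp only [inside, mem_filter, not_not]
      constructor
      · rintro ⟨⟨⟨he, h1, h2⟩, h3⟩, h4⟩
        exact ⟨he, (P.part_eq_iff_mem (hY hD)).1 h4, (P.part_eq_iff_mem (hY hD)).1 (h3 ▸ h4)⟩
      · rintro ⟨he, h1, h2⟩
        have h3 := P.part_eq_of_mem (hY hD) h1
        have h4 := P.part_eq_of_mem (hY hD) h2
        exact ⟨⟨⟨he, mem_biUnion.2 ⟨D, hD, h1⟩, mem_biUnion.2 ⟨D, hD, h2⟩⟩, h3.trans h4.symm⟩, h3⟩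
    · intro e he
      have he' := (mem_filter.1 he).1
      simp only [inside, mem_filter] at he'
      exact (mem_biUnion_iff_part_mem P hY (hE e he'.1).1).1 he'.2.1

theorem inside_eq_self {C : Finset V} {E : Finset ι} (hE : ∀ e ∈ E, a e ∈ C ∧ b e ∈ C) :
    inside a b E C = E := filter_true_of_mem hE

/-- The edges between the parts of a tight partition can be oriented so that all parts are
reachable from the part of `r` and every part has the right number of entering edges. -/
theorem exists_orientation_cross {C : Finset V} {E : Finset ι} {r : V} {t : V → ℕ} (hr : r ∈ C)
    (hE : ∀ e ∈ E, a e ∈ C ∧ b e ∈ C)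
    (hcond : ∀ P : Finpartition C, ∑ D ∈ P.parts, partWeight a b E r t D ≤ #E + 1)
    (P : Finpartition C) (htight : ∑ D ∈ P.parts, partWeight a b E r t D = #E + 1) :
    ∃ (σ : ι → Bool) (rt : Finset V → V) (rk : Finset V → ℕ),
      (∀ D ∈ P.parts, #{e ∈ cross a b P E | head a b σ e ∈ D} + (if r ∈ D then 1 else 0) =
        oddity a b E r t D + 1) ∧
      (∀ D ∈ P.parts, r ∈ D → rt D = r) ∧
      (∀ D ∈ P.parts, r ∉ D → rt D ∈ D ∧ ∃ e ∈ cross a b P E, head a b σ e = rt D ∧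
        rk (P.part (tail a b σ e)) < rk D) := by
  classical
  set m : Finset V → ℕ := fun D => oddity a b E r t D + if r ∈ D then 0 else 1 with hm
  have hm1 : ∀ D, m D + (if r ∈ D then 1 else 0) = oddity a b E r t D + 1 := by
    intro D
    simp only [hm]
    split_ifs <;> rfl
  set A := fun e => P.part (a e) with hA
  set B := fun e => P.part (b e) with hB
  have hAB : ∀ e ∈ cross a b P E, A e ∈ P.parts ∧ B e ∈ P.parts := fun e he =>
    ⟨P.part_mem.2 (hE e (mem_filter.1 he).1).1, P.part_mem.2 (hE e (mem_filter.1 he).1).2⟩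
  have hsumY : ∀ Y : Finset (Finset V), ∑ D ∈ Y, partWeight a b E r t D =
      ∑ D ∈ Y, m D + ∑ D ∈ Y, (if r ∈ D then 1 else 0) + ∑ D ∈ Y, #(inside a b E D) := by
    intro Y
    rw [← sum_add_distrib, ← sum_add_distrib]
    refine sum_congr rfl fun D _ => ?_
    rw [hm1, partWeight]
    omega
  have hall : P.parts.biUnion id = C := P.biUnion_parts
  have hmC : ∑ D ∈ P.parts, m D = #(cross a b P E) := by
    have h1 := card_inside_biUnion a b P hE subset_rfl
    rw [hall, inside_eq_self a b hE, inside_eq_self A B hAB] at h1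
    have h2 := hsumY P.parts
    rw [sum_parts_mem P hr] at h2
    omega
  have hkey : ∀ Y ⊆ P.parts, Y.Nonempty →
      #(inside A B (cross a b P E) Y) + 1 ≤ ∑ D ∈ Y, m D + ∑ D ∈ Y, (if r ∈ D then 1 else 0) := by
    intro Y hY hne
    have hU : Y.biUnion id ≠ ⊥ := by
      obtain ⟨D, hD⟩ := hne
      obtain ⟨v, hv⟩ := P.nonempty_of_mem_parts (hY hD)
      exact ne_empty_of_mem (mem_biUnion.2 ⟨D, hD, hv⟩)
    obtain ⟨P', hP'⟩ := exists_finpartition_replace P hY (Finpartition.indiscrete hU)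
    have h1 := hP' (partWeight a b E r t)
    have h2 := hcond P'
    have h3 : #(inside a b E (Y.biUnion id)) = #(inside A B (cross a b P E) Y) +
        ∑ D ∈ Y, #(inside a b E D) := card_inside_biUnion a b P hE hY
    rw [Finpartition.indiscrete_parts, sum_singleton, hsumY Y, partWeight] at h1
    omega
  obtain ⟨σ, hσ⟩ := exists_orientation_indegree_eq A B (cross a b P E) P.parts m hAB hmC (by
    intro Y hY
    rcases Y.eq_empty_or_nonempty with rfl | hne
    · simp [inside]
    · have h1 := hkey Y hY hne
      have h2 : ∑ D ∈ Y, (if r ∈ D then 1 else 0) ≤ 1 :=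
        (sum_le_sum_of_subset hY).trans (sum_parts_mem P hr).le
      omega)
  have hrank := exists_rank (head A B σ) (tail A B σ) (cross a b P E) P.parts (P.part r)
    (fun e he => head_mem A B (hAB e he) σ) (P.part_mem.2 hr) (by
      intro Z hrZ hZ
      by_contra hnot
      set Y := P.parts \ Z with hYdef
      have hY : Y ⊆ P.parts := sdiff_subset
      have hne : Y.Nonempty := sdiff_nonempty.2 hnot
      have h1 := hkey Y hY hne
      have h2 : ∑ D ∈ Y, (if r ∈ D then 1 else 0) = 0 := by
        refine sum_eq_zero fun D hD => if_neg fun h => ?_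
        rw [hYdef, mem_sdiff] at hD
        exact hD.2 (P.part_eq_of_mem hD.1 h ▸ hrZ)
      have h3 : ∑ D ∈ Y, m D = #{e ∈ cross a b P E | head A B σ e ∈ Y} := by
        rw [card_eq_sum_card_fiberwise (s := {e ∈ cross a b P E | head A B σ e ∈ Y})
          (f := head A B σ) (t := Y) (fun e he => (mem_filter.1 he).2)]
        refine sum_congr rfl fun D hD => ?_
        rw [← hσ D (hY hD), filter_filter]
        congr 1
        ext e
        simp only [mem_filter]
        grind
      have h4 : {e ∈ cross a b P E | head A B σ e ∈ Y} ⊆ inside A B (cross a b P E) Y := by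
        intro e he
        obtain ⟨he, hh⟩ := mem_filter.1 he
        have ht : tail A B σ e ∈ Y := by
          rw [hYdef, mem_sdiff] at hh ⊢
          exact ⟨tail_mem A B (hAB e he) σ, fun h => hh.2 (hZ e he h)⟩
        refine mem_filter.2 ⟨he, ?_⟩
        cases hs : σ e
        · simp only [head, tail, hs, cond_false] at hh ht
          exact ⟨hh, ht⟩
        · simp only [head, tail, hs, cond_true] at hh ht
          exact ⟨ht, hh⟩
      have := card_le_card h4
      omega)
  obtain ⟨rk, hrk⟩ := hrank
  have hpar : ∀ D : Finset V, ∃ v, D ∈ P.parts → (r ∈ D → v = r) ∧ (r ∉ D → v ∈ D ∧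
      ∃ e ∈ cross a b P E, head a b σ e = v ∧ rk (P.part (tail a b σ e)) < rk D) := by
    intro D
    by_cases hD : D ∈ P.parts
    swap
    · exact ⟨r, fun h => absurd h hD⟩
    by_cases hrD : r ∈ D
    · exact ⟨r, fun _ => ⟨fun _ => rfl, fun h => absurd hrD h⟩⟩
    · obtain ⟨e, he, h1, h2⟩ := hrk D hD fun h => hrD (h ▸ P.mem_part_self.2 hr)
      rw [head_comp a b P.part] at h1
      rw [tail_comp a b P.part] at h2
      exact ⟨head a b σ e, fun _ => ⟨fun h => absurd h hrD, fun _ =>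
        ⟨(P.part_eq_iff_mem hD).1 h1, e, he, rfl, h2⟩⟩⟩
  choose rt hrt using hpar
  refine ⟨σ, rt, rk, fun D hD => ?_, fun D hD => (hrt D hD).1, fun D hD => (hrt D hD).2⟩
  rw [← hm1, ← hσ D hD]
  congr 2
  ext e
  simp only [mem_filter, and_congr_right_iff]
  intro he
  rw [head_comp a b P.part, P.part_eq_iff_mem hD]
theorem parts_eq_singleton_of_card_le_one {C : Finset V} (P : Finpartition C) (hC : C.Nonempty)
    (h : #P.parts ≤ 1) : P.parts = {C} := by
  have hne : P.parts.Nonempty := P.parts_nonempty hC.ne_empty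
  obtain ⟨B, hB⟩ := card_eq_one.1 (le_antisymm h hne.card_pos)
  have := P.biUnion_parts
  rw [hB, singleton_biUnion] at this
  rw [hB, ← this, id]

theorem oddity_le_one (E : Finset ι) (r : V) (t : V → ℕ) (D : Finset V) :
    oddity a b E r t D ≤ 1 := by
  unfold oddity
  omega

/-- The partition condition is inherited by the parts of a finest tight partition. -/
theorem partition_condition_part {C : Finset V} {E : Finset ι} {r : V} {t : V → ℕ} (hr : r ∈ C)
    (hcond : ∀ P : Finpartition C, ∑ D ∈ P.parts, partWeight a b E r t D ≤ #E + 1)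
    (hpar : (∑ v ∈ C, t v) % 2 = #E % 2)
    (P : Finpartition C) (htight : ∑ D ∈ P.parts, partWeight a b E r t D = #E + 1)
    (hfine : ∀ P' : Finpartition C, ∑ D ∈ P'.parts, partWeight a b E r t D = #E + 1 →
      #P'.parts ≤ #P.parts)
    {D : Finset V} (hD : D ∈ P.parts) {r' : V} (hr' : r' ∈ D) (s : V → ℕ)
    (hs : ∑ v ∈ D, s v + (if r ∈ D then 1 else 0) = oddity a b E r t D + 1)
    (hrs : r' = r ∨ s r' ≠ 0) (Q : Finpartition D) :
    ∑ B ∈ Q.parts, partWeight a b (inside a b E D) r' (fun v => t v + s v) B ≤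
      #(inside a b E D) + 1 := by
  have hin : ∀ B ⊆ D, inside a b (inside a b E D) B = inside a b E B := by
    intro B hB
    ext e
    simp only [inside, mem_filter]
    exact ⟨fun h => ⟨h.1.1, h.2⟩, fun h => ⟨⟨h.1, hB h.2.1, hB h.2.2⟩, h.2⟩⟩
  have hodd := oddity_le_one a b E r t D
  by_cases hQ : #Q.parts ≤ 1
  · rw [parts_eq_singleton_of_card_le_one Q ⟨r', hr'⟩ hQ, sum_singleton, partWeight, oddity,
      hin D subset_rfl, sum_add_distrib, if_pos hr']
    rw [oddity] at hs
    split_ifs at hs <;> omega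
  · have hpt : ∀ B ∈ Q.parts,
        partWeight a b (inside a b E D) r' (fun v => t v + s v) B + (if r' ∈ B then 1 else 0) ≤
        partWeight a b E r t B + (∑ v ∈ B, s v + if r ∈ B then 1 else 0) := by
      intro B hB
      rw [partWeight, partWeight, oddity, oddity, hin B (Q.subset hB), sum_add_distrib]
      have : r' ∈ B → r ∉ B → 1 ≤ ∑ v ∈ B, s v := by
        intro h1 h2
        rcases hrs with rfl | h
        · exact absurd h1 h2
        · exact (Nat.one_le_iff_ne_zero.2 h).trans
            (single_le_sum (f := s) (fun _ _ => Nat.zero_le _) h1)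
      by_cases h1 : r' ∈ B <;> by_cases h2 : r ∈ B <;> simp only [h1, h2, if_true, if_false]
      · omega
      · have := this h1 h2
        omega
      · omega
      · omega
    have h1 := sum_le_sum hpt
    rw [sum_add_distrib, sum_add_distrib, sum_add_distrib, sum_parts_mem Q hr',
      sum_parts_sum Q s] at h1
    have hrD : ∑ B ∈ Q.parts, (if r ∈ B then 1 else 0) = if r ∈ D then 1 else 0 := by
      split_ifs with h
      · exact sum_parts_mem Q h
      · exact sum_eq_zero fun B hB => if_neg fun h' => h (Q.subset hB h')
    have hbU : D = ({D} : Finset (Finset V)).biUnion id := by simp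
    obtain ⟨P', hP'⟩ := exists_finpartition_replace P (singleton_subset_iff.2 hD) (Q.copy hbU)
    have h2 := hP' (partWeight a b E r t)
    have h3 := hP' fun _ => 1
    simp only [sum_singleton, Finpartition.copy, sum_const, card_singleton, smul_eq_mul, mul_one] at h2 h3
    have h4 := hcond P'
    have h5 : ∑ D ∈ P'.parts, partWeight a b E r t D ≠ #E + 1 := fun h => by
      have := hfine P' h
      omega
    have h6 := sum_partWeight_mod_two a b P' E hr t
    have h7 : partWeight a b E r t D = 1 + #(inside a b E D) + oddity a b E r t D := rfl
    omega

/-- A rooted graph satisfying the partition condition has an orientation in which all vertices are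
reachable from the root and all in-degrees have prescribed parity (Nebeský;
Frank, Jordán, Szigeti). -/
theorem exists_orientation_of_partition_condition [DecidableEq ι] (n : ℕ) :
    ∀ (C : Finset V) (E : Finset ι) (r : V) (t : V → ℕ), #C + #E = n → r ∈ C →
      (∀ e ∈ E, a e ∈ C ∧ b e ∈ C) →
      (∀ P : Finpartition C, ∑ D ∈ P.parts, partWeight a b E r t D ≤ #E + 1) →
      ∃ σ : ι → Bool, (∀ v ∈ C, #{e ∈ E | head a b σ e = v} % 2 = t v % 2) ∧
        ∀ Z : Finset V, r ∈ Z → (∀ e ∈ E, tail a b σ e ∈ Z → head a b σ e ∈ Z) → C ⊆ Z := by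
  induction n using Nat.strong_induction_on with
  | _ n ih =>
  intro C E r t hn hr hE hcond
  have hCne : C ≠ ⊥ := ne_empty_of_mem hr
  have hind : partWeight a b E r t C ≤ #E + 1 := by
    simpa using hcond (Finpartition.indiscrete hCne)
  have hpar : (∑ v ∈ C, t v) % 2 = #E % 2 := by
    rw [partWeight, oddity, inside_eq_self a b hE, if_pos hr] at hind
    omega
  have hindeq : partWeight a b E r t C = #E + 1 := by
    rw [partWeight, inside_eq_self a b hE] at hind ⊢
    omega
  obtain ⟨P, htight, hmin⟩ := WellFounded.has_min
    (measure fun P : Finpartition C => #C - #P.parts).wf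
    {P | ∑ D ∈ P.parts, partWeight a b E r t D = #E + 1}
    ⟨Finpartition.indiscrete hCne, by simpa using hindeq⟩
  replace htight : ∑ D ∈ P.parts, partWeight a b E r t D = #E + 1 := htight
  have hfine : ∀ P' : Finpartition C, ∑ D ∈ P'.parts, partWeight a b E r t D = #E + 1 →
      #P'.parts ≤ #P.parts := by
    intro P' hP'
    have h1 : ¬ (#C - #P'.parts < #C - #P.parts) := hmin P' hP'
    have h2 := P'.card_parts_le_card
    have h3 := P.card_parts_le_card
    omega
  by_cases hP1 : #P.parts ≤ 1
  · rcases E.eq_empty_or_nonempty with rfl | ⟨e₀, he₀⟩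
    · have h1 : #C ≤ 1 := by
        have h := hcond ⊥
        have h' : #(⊥ : Finpartition C).parts • 1 ≤
            ∑ D ∈ (⊥ : Finpartition C).parts, partWeight a b ∅ r t D :=
          card_nsmul_le_sum _ _ _ fun D _ => by rw [partWeight]; omega
        rw [Finpartition.card_bot, smul_eq_mul, mul_one] at h'
        simpa using h'.trans h
      have hC : ∀ v ∈ C, v = r := fun v hv => card_le_one.1 h1 v hv r hr
      refine ⟨fun _ => true, fun v hv => ?_, fun Z hZ _ v hv => hC v hv ▸ hZ⟩
      have hCr : C = {r} := eq_singleton_iff_unique_mem.2 ⟨hr, hC⟩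
      rw [hCr, sum_singleton] at hpar
      rw [hC v hv, hpar]
      simp
    · have hcardE := card_erase_add_one he₀
      have hE' : ∀ e ∈ E.erase e₀, a e ∈ C ∧ b e ∈ C := fun e he => hE e (mem_of_mem_erase he)
      set t' : V → ℕ := fun v => t v + if v = b e₀ then 1 else 0 with ht'
      have hsum : ∀ D : Finset V, ∑ v ∈ D, t' v = ∑ v ∈ D, t v + if b e₀ ∈ D then 1 else 0 := by
        intro D
        rw [ht', sum_add_distrib, sum_ite_eq']
      have hcond' : ∀ Q : Finpartition C,
          ∑ D ∈ Q.parts, partWeight a b (E.erase e₀) r t' D ≤ #(E.erase e₀) + 1 := by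
        intro Q
        by_cases hQ : #Q.parts ≤ 1
        · rw [parts_eq_singleton_of_card_le_one Q ⟨r, hr⟩ hQ, sum_singleton, partWeight, oddity,
            inside_eq_self a b hE', hsum, if_pos hr, if_pos (hE e₀ he₀).2]
          omega
        · have hpt : ∀ D ∈ Q.parts, partWeight a b (E.erase e₀) r t' D ≤
              partWeight a b E r t D + if b e₀ ∈ D then 1 else 0 := by
            intro D _
            rw [partWeight, partWeight, oddity, oddity, hsum]
            have hi : inside a b (E.erase e₀) D = (inside a b E D).erase e₀ := by
              ext e
              simp only [inside, mem_filter, mem_erase]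
              tauto
            by_cases h : e₀ ∈ inside a b E D
            · have h1 := card_erase_add_one h
              rw [← hi] at h1
              have h2 : b e₀ ∈ D := (mem_filter.1 h).2.2
              rw [if_pos h2]
              split_ifs <;> omega
            · rw [hi, erase_eq_of_notMem h]
              split_ifs <;> omega
          have h1 := sum_le_sum hpt
          rw [sum_add_distrib, sum_parts_mem Q (hE e₀ he₀).2] at h1
          have h2 := hcond Q
          have h3 := sum_partWeight_mod_two a b Q E hr t
          have h4 : ∑ D ∈ Q.parts, partWeight a b E r t D ≠ #E + 1 := fun h => by
            have := hfine Q h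
            omega
          omega
      obtain ⟨σ, hσ, hreach⟩ := ih (#C + #(E.erase e₀)) (by omega) C (E.erase e₀) r t' rfl hr hE'
        hcond'
      set τ : ι → Bool := fun e => if e = e₀ then true else σ e with hτ
      have hhd : ∀ e ∈ E.erase e₀, head a b τ e = head a b σ e := by
        intro e he
        simp [head, hτ, ne_of_mem_erase he]
      have htl : ∀ e ∈ E.erase e₀, tail a b τ e = tail a b σ e := by
        intro e he
        simp [tail, hτ, ne_of_mem_erase he]
      refine ⟨τ, fun v hv => ?_, fun Z hrZ hZ => hreach Z hrZ fun e he h => ?_⟩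
      · have h1 := hσ v hv
        rw [← insert_erase he₀, filter_insert]
        have h2 : {e ∈ E.erase e₀ | head a b τ e = v} = {e ∈ E.erase e₀ | head a b σ e = v} :=
          filter_congr fun e he => by rw [hhd e he]
        have h3 : head a b τ e₀ = b e₀ := by simp [head, hτ]
        rw [h2, h3]
        simp only [ht'] at h1
        by_cases hv : b e₀ = v
        · rw [if_pos hv, card_insert_of_notMem (by simp)]
          rw [if_pos hv.symm] at h1
          omega
        · rw [if_neg hv]
          rw [if_neg (Ne.symm hv)] at h1
          omega
      · rw [← hhd e he]
        rw [← htl e he] at h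
        exact hZ e (mem_of_mem_erase he) h
  · obtain ⟨σ, rt, rk, hdeg, hrt, hrk⟩ := exists_orientation_cross a b hr hE hcond P htight
    set s : V → ℕ := fun v => #{e ∈ cross a b P E | head a b σ e = v} with hs
    have hssum : ∀ D : Finset V, ∑ v ∈ D, s v = #{e ∈ cross a b P E | head a b σ e ∈ D} := by
      intro D
      rw [card_eq_sum_card_fiberwise (s := {e ∈ cross a b P E | head a b σ e ∈ D})
        (f := head a b σ) (t := D) (fun e he => (mem_filter.1 he).2)]
      refine sum_congr rfl fun v hv => ?_
      rw [filter_filter]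
      simp only [hs]
      congr 1
      ext e
      simp only [mem_filter]
      grind
    have hrtD : ∀ D ∈ P.parts, rt D ∈ D := by
      intro D hD
      by_cases h : r ∈ D
      · rwa [hrt D hD h]
      · exact (hrk D hD h).1
    have hinner : ∀ D : Finset V, ∃ τ : ι → Bool, D ∈ P.parts →
        (∀ v ∈ D, #{e ∈ inside a b E D | head a b τ e = v} % 2 = (t v + s v) % 2) ∧
        ∀ Z : Finset V, rt D ∈ Z →
          (∀ e ∈ inside a b E D, tail a b τ e ∈ Z → head a b τ e ∈ Z) → D ⊆ Z := by
      intro D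
      by_cases hD : D ∈ P.parts
      swap
      · exact ⟨fun _ => true, fun h => absurd h hD⟩
      have hlt : #D < #C := by
        refine card_lt_card ((P.subset hD).ssubset_of_ne ?_)
        rintro rfl
        refine hP1 (card_le_one.2 fun A hA B hB => ?_)
        have haux : ∀ A ∈ P.parts, A = D := by
          intro A hA
          obtain ⟨v, hv⟩ := P.nonempty_of_mem_parts hA
          exact P.eq_of_mem_parts hA hD hv (P.subset hA hv)
        rw [haux A hA, haux B hB]
      have hle : #(inside a b E D) ≤ #E := card_filter_le _ _
      obtain ⟨τ, hτ⟩ := ih (#D + #(inside a b E D)) (by omega) D (inside a b E D) (rt D)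
        (fun v => t v + s v) rfl (hrtD D hD) (fun e he => (mem_filter.1 he).2)
        (partition_condition_part a b hr hcond hpar P htight hfine hD (hrtD D hD) s
          (by rw [hssum]; exact hdeg D hD) (by
            by_cases h : r ∈ D
            · exact Or.inl (hrt D hD h)
            · obtain ⟨-, e, he, h1, -⟩ := hrk D hD h
              exact Or.inr (card_ne_zero_of_mem (mem_filter.2 ⟨he, h1⟩))))
      exact ⟨τ, fun _ => hτ⟩
    choose τ hτ using hinner
    set ρ : ι → Bool := fun e => if e ∈ cross a b P E then σ e else τ (P.part (a e)) e with hρ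
    have hpart : ∀ v ∈ C, P.part v ∈ P.parts := fun v hv => P.part_mem.2 hv
    have hρc : ∀ e ∈ cross a b P E, ρ e = σ e := fun e he => if_pos he
    have hnc : ∀ D ∈ P.parts, ∀ e ∈ inside a b E D, e ∉ cross a b P E ∧ P.part (a e) = D := by
      intro D hD e he
      obtain ⟨-, h1, h2⟩ := mem_filter.1 he
      have h1 := P.part_eq_of_mem hD h1
      have h2 := P.part_eq_of_mem hD h2
      exact ⟨fun h => (mem_filter.1 h).2 (h1.trans h2.symm), h1⟩
    have hρi : ∀ D ∈ P.parts, ∀ e ∈ inside a b E D, ρ e = τ D e := by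
      intro D hD e he
      obtain ⟨h1, h2⟩ := hnc D hD e he
      simp only [hρ, if_neg h1, h2]
    have hhd : ∀ (σ₁ σ₂ : ι → Bool) (e : ι), σ₁ e = σ₂ e → head a b σ₁ e = head a b σ₂ e := by
      intro σ₁ σ₂ e h
      simp only [head, h]
    have htl : ∀ (σ₁ σ₂ : ι → Bool) (e : ι), σ₁ e = σ₂ e → tail a b σ₁ e = tail a b σ₂ e := by
      intro σ₁ σ₂ e h
      simp only [tail, h]
    refine ⟨ρ, fun v hv => ?_, fun Z hrZ hZ => ?_⟩
    · set D := P.part v with hDdef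
      have hD : D ∈ P.parts := hpart v hv
      have hvD : v ∈ D := P.mem_part_self.2 hv
      have h1 := (hτ D hD).1 v hvD
      have h2 : {e ∈ E | head a b ρ e = v} = {e ∈ cross a b P E | head a b σ e = v} ∪
          {e ∈ inside a b E D | head a b (τ D) e = v} := by
        ext e
        simp only [mem_union, mem_filter]
        constructor
        · rintro ⟨he, h⟩
          by_cases hc : e ∈ cross a b P E
          · exact Or.inl ⟨hc, by rw [← hhd ρ σ e (hρc e hc), h]⟩
          · have hab : P.part (a e) = P.part (b e) := by
              by_contra hne
              exact hc (mem_filter.2 ⟨he, hne⟩)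
            have hi : e ∈ inside a b E D := by
              have h3 : P.part (a e) = D := by
                rw [hDdef, ← h]
                cases hs : ρ e
                · simp [head, hs]
                · simp [head, hs, hab]
              exact mem_filter.2 ⟨he, (P.part_eq_iff_mem hD).1 h3,
                (P.part_eq_iff_mem hD).1 (hab ▸ h3)⟩
            exact Or.inr ⟨hi, by rw [← hhd ρ (τ D) e (hρi D hD e hi), h]⟩
        · rintro (⟨he, h⟩ | ⟨he, h⟩)
          · exact ⟨(mem_filter.1 he).1, by rw [hhd ρ σ e (hρc e he), h]⟩
          · exact ⟨(mem_filter.1 he).1, by rw [hhd ρ (τ D) e (hρi D hD e he), h]⟩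
      rw [h2, card_union_of_disjoint]
      · change (s v + _) % 2 = _
        omega
      · refine Finset.disjoint_left.2 fun e he he' => ?_
        exact (hnc D hD e (mem_filter.1 he').1).1 (mem_filter.1 he).1
    · have hsub : ∀ k, ∀ D ∈ P.parts, rk D = k → D ⊆ Z := by
        intro k
        induction k using Nat.strong_induction_on with
        | _ k ihk =>
        intro D hD hk
        refine (hτ D hD).2 Z ?_ fun e he h => ?_
        · by_cases hrD : r ∈ D
          · rwa [hrt D hD hrD]
          · obtain ⟨-, e, he, h1, h2⟩ := hrk D hD hrD
            have heE := (mem_filter.1 he).1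
            have htC := tail_mem a b (hE e heE) σ
            have h3 := ihk _ (hk ▸ h2) _ (hpart _ htC) rfl (P.mem_part_self.2 htC)
            rw [← htl ρ σ e (hρc e he)] at h3
            have h4 := hZ e heE h3
            rwa [hhd ρ σ e (hρc e he), h1] at h4
        · rw [← htl ρ (τ D) e (hρi D hD e he)] at h
          rw [← hhd ρ (τ D) e (hρi D hD e he)]
          exact hZ e (mem_filter.1 he).1 h
      intro v hv
      exact hsub _ _ (hpart v hv) rfl (P.mem_part_self.2 hv)

end Multigraph

section Graph

theorem card_edgeSet_add_card_connectedComponent {V : Type*} [Finite V] {G : SimpleGraph V}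
    (hG : G.IsAcyclic) :
    Nat.card G.edgeSet + Nat.card G.ConnectedComponent = Nat.card V := by
  classical
  have := Fintype.ofFinite V
  have hfib : ∀ c : G.ConnectedComponent,
      #{e ∈ G.edgeFinset | G.connectedComponentMk (Quot.out e).1 = c} + 1 =
        #{v | G.connectedComponentMk v = c} := by
    intro c
    have h1 := SimpleGraph.IsTree.card_edgeFinset (G := G.induce c.supp)
      (hG.isTree_connectedComponent c)
    have h2 : #(G.induce c.supp).edgeFinset = #(G.edgeFinset ∩ c.supp.toFinset.sym2) := by
      rw [← G.map_edgeFinset_induce, card_map]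
    have h3 : {e ∈ G.edgeFinset | G.connectedComponentMk (Quot.out e).1 = c} =
        G.edgeFinset ∩ c.supp.toFinset.sym2 := by
      rw [← filter_mem_eq_inter]
      refine filter_congr fun e he => ?_
      rw [SimpleGraph.mem_edgeFinset] at he
      generalize hx : Quot.out e = x
      obtain ⟨u, v⟩ := x
      have hx' : s(u, v) = e := by rw [← Quot.out_eq e, hx]
      subst hx'
      have : G.connectedComponentMk u = G.connectedComponentMk v :=
        SimpleGraph.ConnectedComponent.sound (SimpleGraph.Adj.reachable he)
      simp [← this]
    have h4 : #{v | G.connectedComponentMk v = c} = Fintype.card c.supp := by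
      rw [← Set.toFinset_card]
      congr 1
      ext v
      simp
    rw [h3, ← h2, h4]
    convert h1
  have h1 : #G.edgeFinset = _ := card_eq_sum_card_fiberwise
    (f := fun e => G.connectedComponentMk (Quot.out e).1) (t := univ) (fun _ _ => by simp)
  have h2 : #(univ : Finset V) = _ := card_eq_sum_card_fiberwise
    (f := G.connectedComponentMk) (t := univ) (fun _ _ => by simp)
  rw [Nat.card_eq_fintype_card, ← SimpleGraph.edgeFinset_card, Nat.card_eq_fintype_card,
    Nat.card_eq_fintype_card, ← card_univ, ← card_univ (α := V), h1, h2, card_eq_sum_ones,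
    ← sum_add_distrib]
  exact sum_congr rfl fun c _ => hfib c

theorem adj_of_mem_edgeFinset {V : Type*} [Fintype V] {X : SimpleGraph V} [DecidableRel X.Adj]
    (a b : Sym2 V → V) (hab : ∀ e, s(a e, b e) = e) {e : Sym2 V} (he : e ∈ X.edgeFinset) :
    X.Adj (a e) (b e) := by
  rw [← SimpleGraph.mem_edgeSet, hab]
  exact SimpleGraph.mem_edgeFinset.1 he

variable {V : Type*} [DecidableEq V] (a b : Sym2 V → V)

/-- The edges of `E` with exactly one end in `D`. -/
def boundary {ι : Type*} (a b : ι → V) (E : Finset ι) (D : Finset V) : Finset ι :=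
  {e ∈ E | ¬(a e ∈ D ↔ b e ∈ D)}

theorem card_inside_add_boundary {ι : Type*} (a b : ι → V) (E : Finset ι) (D : Finset V) :
    #{e ∈ E | a e ∈ D} + #{e ∈ E | b e ∈ D} =
      2 * #(inside a b E D) + #(boundary a b E D) := by
  simp only [inside, boundary, card_filter, mul_sum, ← sum_add_distrib]
  refine sum_congr rfl fun e _ => ?_
  by_cases h1 : a e ∈ D <;> by_cases h2 : b e ∈ D <;> simp [h1, h2]

theorem card_inside_add_inside_compl [Fintype V] {ι : Type*} (a b : ι → V) (E : Finset ι)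
    (D : Finset V) :
    #(inside a b E D) + #(inside a b E Dᶜ) + #(boundary a b E D) = #E := by
  simp only [inside, boundary, card_filter, ← sum_add_distrib, card_eq_sum_ones E]
  refine sum_congr rfl fun e _ => ?_
  by_cases h1 : a e ∈ D <;> by_cases h2 : b e ∈ D <;> simp [h1, h2]

variable [Fintype V] {X : SimpleGraph V} [DecidableRel X.Adj]

theorem card_inside_edgeFinset (hab : ∀ e, s(a e, b e) = e) (D : Finset V) :
    #(inside a b X.edgeFinset D) = Nat.card (X.induce (D : Set V)).edgeSet := by
  have h : #(X.induce (D : Set V)).edgeFinset = #(X.edgeFinset ∩ (D : Set V).toFinset.sym2) := by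
    convert (card_map _).symm.trans (congrArg card (X.map_edgeFinset_induce (s := (D : Set V))))
  rw [Nat.card_eq_fintype_card, ← SimpleGraph.edgeFinset_card, h, ← filter_mem_eq_inter, inside]
  congr 1
  refine filter_congr fun e _ => ?_
  conv_rhs => rw [← hab e]
  simp

theorem degree_eq_card_add_card (hab : ∀ e, s(a e, b e) = e) (v : V) :
    X.degree v = #{e ∈ X.edgeFinset | a e = v} + #{e ∈ X.edgeFinset | b e = v} := by
  rw [← SimpleGraph.card_incidenceFinset_eq_degree, SimpleGraph.incidenceFinset_eq_filter,
    card_filter, card_filter, card_filter, ← sum_add_distrib]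
  refine sum_congr rfl fun e he => ?_
  have h1 := (adj_of_mem_edgeFinset a b hab he).ne
  have h2 : v ∈ e ↔ v = a e ∨ v = b e := by
    conv_lhs => rw [← hab e]
    simp
  grind

theorem sum_degree (hab : ∀ e, s(a e, b e) = e) (D : Finset V) :
    ∑ v ∈ D, X.degree v =
      2 * #(inside a b X.edgeFinset D) + #(boundary a b X.edgeFinset D) := by
  rw [← card_inside_add_boundary, card_eq_sum_card_fiberwise (f := a) (t := D)
    (s := {e ∈ X.edgeFinset | a e ∈ D}) (fun e he => (mem_filter.1 he).2),
    card_eq_sum_card_fiberwise (f := b) (t := D)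
    (s := {e ∈ X.edgeFinset | b e ∈ D}) (fun e he => (mem_filter.1 he).2), ← sum_add_distrib]
  refine sum_congr rfl fun v hv => ?_
  rw [degree_eq_card_add_card a b hab, filter_filter, filter_filter]
  congr 2 <;> refine filter_congr fun e _ => ?_ <;> grind

theorem card_inside_add_card_connectedComponent (hab : ∀ e, s(a e, b e) = e) {D : Finset V}
    (hD : (X.induce (D : Set V)).IsAcyclic) :
    #(inside a b X.edgeFinset D) + Nat.card (X.induce (D : Set V)).ConnectedComponent = #D := by
  rw [card_inside_edgeFinset a b hab, card_edgeSet_add_card_connectedComponent hD]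
  simp

theorem card_add_two_le_card_boundary (hab : ∀ e, s(a e, b e) = e)
    (hcubic : ∀ v, X.degree v = 3) {D : Finset V} (hne : D.Nonempty)
    (hD : (X.induce (D : Set V)).IsAcyclic) :
    #D + 2 ≤ #(boundary a b X.edgeFinset D) := by
  have h1 := sum_degree (X := X) a b hab D
  have h2 := card_inside_add_card_connectedComponent a b hab hD
  have : Nonempty (X.induce (D : Set V)).ConnectedComponent :=
    ⟨(X.induce (D : Set V)).connectedComponentMk ⟨hne.choose, hne.choose_spec⟩⟩
  have h3 : 0 < Nat.card (X.induce (D : Set V)).ConnectedComponent := Nat.card_pos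
  simp only [hcubic, sum_const, smul_eq_mul] at h1
  omega

theorem boundary_compl (E : Finset (Sym2 V)) (D : Finset V) :
    boundary a b E Dᶜ = boundary a b E D := by
  refine filter_congr fun e _ => ?_
  simp only [mem_compl]
  tauto

end Graph

section CubicGraph

variable {V : Type*} [DecidableEq V] [Fintype V] {X : SimpleGraph V} [DecidableRel X.Adj]
  (a b : Sym2 V → V)

theorem mk_mem_boundary (hab : ∀ e, s(a e, b e) = e) {u v : V} {D : Finset V} :
    s(u, v) ∈ boundary a b X.edgeFinset D ↔ X.Adj u v ∧ ¬(u ∈ D ↔ v ∈ D) := by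
  rw [boundary, mem_filter, SimpleGraph.mem_edgeFinset, SimpleGraph.mem_edgeSet]
  rcases Sym2.eq_iff.1 (hab s(u, v)) with h | h <;> rw [h.1, h.2]
  tauto

theorem mem_iff_mem_of_reachable_deleteEdges_boundary (hab : ∀ e, s(a e, b e) = e) {u v : V}
    {D : Finset V}
    (h : (X.deleteEdges (boundary a b X.edgeFinset D : Set (Sym2 V))).Reachable u v) :
    u ∈ D ↔ v ∈ D := by
  obtain ⟨w⟩ := h
  induction w with
  | nil => rfl
  | cons h _ ih =>
    rw [SimpleGraph.deleteEdges_adj, mem_coe, mk_mem_boundary a b hab] at h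
    rw [← ih]
    tauto

theorem exists_isCycle_deleteEdges_boundary (hab : ∀ e, s(a e, b e) = e) {D : Finset V}
    {W : Set V} (hW : ∀ u ∈ W, ∀ v ∈ W, (u ∈ D ↔ v ∈ D)) (h : ¬(X.induce W).IsAcyclic) :
    ∃ u ∈ W, ∃ p : (X.deleteEdges (boundary a b X.edgeFinset D : Set (Sym2 V))).Walk u u,
      p.IsCycle := by
  simp only [SimpleGraph.IsAcyclic, not_forall, not_not] at h
  obtain ⟨u, c, hc⟩ := h
  let f : X.induce W →g X.deleteEdges (boundary a b X.edgeFinset D : Set (Sym2 V)) :=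
    ⟨Subtype.val, fun {x y} hxy => by
      rw [SimpleGraph.deleteEdges_adj, mem_coe, mk_mem_boundary a b hab]
      exact ⟨hxy, fun h => h.2 (hW _ x.2 _ y.2)⟩⟩
  exact ⟨u, u.2, c.map f, hc.map (f := f) Subtype.val_injective⟩

theorem le_card_boundary (hab : ∀ e, s(a e, b e) = e) {k : ℕ} (hX : CyclicallyConnected X k)
    {D : Finset V} (h1 : ¬(X.induce (D : Set V)).IsAcyclic)
    (h2 : ¬(X.induce ((Dᶜ : Finset V) : Set V)).IsAcyclic) :
    k ≤ #(boundary a b X.edgeFinset D) := by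
  obtain ⟨u, hu, p, hp⟩ := exists_isCycle_deleteEdges_boundary a b hab (D := D)
    (fun u hu v hv => iff_of_true hu hv) h1
  obtain ⟨v, hv, q, hq⟩ := exists_isCycle_deleteEdges_boundary a b hab (D := D)
    (fun u hu v hv => iff_of_false (mem_compl.1 hu) (mem_compl.1 hv)) h2
  have huv : ¬(X.deleteEdges (boundary a b X.edgeFinset D : Set (Sym2 V))).Reachable u v :=
    fun h => mem_compl.1 hv <|
      (mem_iff_mem_of_reachable_deleteEdges_boundary a b hab h).1 hu
  refine hX _ (fun e he => ?_) ⟨fun h => huv (h.preconnected u v), u, v, p, q, hp, hq, huv⟩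
  exact SimpleGraph.mem_edgeFinset.1 (mem_filter.1 he).1

theorem sum_partWeight_le (hab : ∀ e, s(a e, b e) = e) (hcubic : ∀ v, X.degree v = 3)
    (hX : CyclicallyConnected X 4) (hn : Fintype.card V % 4 = 0) (r : V)
    (P : Finpartition (univ : Finset V)) :
    ∑ D ∈ P.parts, partWeight a b X.edgeFinset r (fun _ => 1) D ≤ #X.edgeFinset + 1 := by
  classical
  have hE := X.sum_degrees_eq_twice_card_edges
  by_cases huniv : univ ∈ P.parts
  · have hP : P.parts = {univ} := by
      refine (eq_singleton_iff_unique_mem.2 ⟨huniv, fun D hD => ?_⟩)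
      obtain ⟨v, hv⟩ := P.nonempty_of_mem_parts hD
      exact P.eq_of_mem_parts hD huniv hv (mem_univ v)
    rw [hP, sum_singleton, partWeight, oddity, inside_eq_self a b (by simp)]
    simp only [hcubic, sum_const, smul_eq_mul, card_univ, mem_univ, if_true] at hE ⊢
    omega
  have hpt : ∀ D ∈ P.parts, 2 * partWeight a b X.edgeFinset r (fun _ => 1) D ≤
      ∑ v ∈ D, X.degree v + ((if r ∈ D then 1 else 0) +
        if ¬(X.induce (D : Set V)).IsAcyclic ∧ (X.induce ((Dᶜ : Finset V) : Set V)).IsAcyclic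
          then 1 else 0) := by
    intro D hD
    have hne := P.nonempty_of_mem_parts hD
    have hne' : Dᶜ.Nonempty := by
      rw [nonempty_iff_ne_empty, Ne, compl_eq_empty_iff]
      exact fun h => huniv (h ▸ hD)
    have h1 := oddity_le_one a b X.edgeFinset r (fun _ => 1) D
    have h0 := sum_degree (X := X) a b hab D
    have hpos := hne.card_pos
    have hpos' := hne'.card_pos
    rw [h0]
    unfold partWeight
    by_cases hac : (X.induce (D : Set V)).IsAcyclic
    · have h2 := card_add_two_le_card_boundary a b hab hcubic hne hac
      by_cases hr : r ∈ D
      · rw [if_pos hr]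
        omega
      · simp only [hcubic, sum_const, smul_eq_mul] at h0
        rw [oddity, if_neg hr, sum_const, smul_eq_mul] at h1 ⊢
        omega
    · by_cases hac' : (X.induce ((Dᶜ : Finset V) : Set V)).IsAcyclic
      · have h2 := card_add_two_le_card_boundary a b hab hcubic hne' hac'
        rw [boundary_compl] at h2
        rw [if_pos (c := ¬_ ∧ _) ⟨hac, hac'⟩]
        omega
      · have h2 := le_card_boundary a b hab hX hac hac'
        omega
  have hone : ∑ D ∈ P.parts, (if ¬(X.induce (D : Set V)).IsAcyclic ∧
      (X.induce ((Dᶜ : Finset V) : Set V)).IsAcyclic then 1 else 0) ≤ 1 := by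
    rw [← card_filter, card_le_one]
    intro D hD B hB
    rw [mem_filter] at hD hB
    by_contra hne
    have hdisj : B ⊆ Dᶜ := subset_compl_iff_disjoint_left.2 (P.disjoint hD.1 hB.1 hne)
    exact hB.2.1 (hD.2.2.embedding (SimpleGraph.induceHomOfLE X
      (coe_subset.2 hdisj)))
  have hsum := sum_le_sum hpt
  rw [← mul_sum, sum_add_distrib, sum_add_distrib, sum_parts_sum, sum_parts_mem P (mem_univ r),
    hE] at hsum
  omega

end CubicGraph

section Forest

theorem isAcyclic_of_rank {V : Type*} {G : SimpleGraph V} (rk : V → ℕ)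
    (h : ∀ v u w, G.Adj v u → G.Adj v w → rk u ≤ rk v → rk w ≤ rk v → u = w) :
    G.IsAcyclic := by
  classical
  intro v c hc
  obtain ⟨x, hx, hmax⟩ := exists_max_image c.support.toFinset rk ⟨v, by simp⟩
  rw [List.mem_toFinset] at hx
  have hc' := hc.rotate hx
  have hle : ∀ y ∈ (c.rotate x hx).support, rk y ≤ rk x := fun y hy =>
    hmax y (by simpa using hy)
  have hnil := hc'.not_nil
  exact hc'.snd_ne_penultimate (h x _ _ (SimpleGraph.Walk.adj_snd hnil)
    (SimpleGraph.Walk.adj_penultimate hnil).symm (hle _ (SimpleGraph.Walk.getVert_mem_support _ _))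
    (hle _ (SimpleGraph.Walk.getVert_mem_support _ _)))

theorem head_eq_or_head_eq {V : Type*} (a b : Sym2 V → V) (hab : ∀ e, s(a e, b e) = e)
    (σ : Sym2 V → Bool) (u v : V) :
    head a b σ s(u, v) = u ∧ tail a b σ s(u, v) = v ∨
      head a b σ s(u, v) = v ∧ tail a b σ s(u, v) = u := by
  unfold head tail
  rcases Sym2.eq_iff.1 (hab s(u, v)) with h | h <;> rw [h.1, h.2] <;>
    cases σ s(u, v) <;> simp

variable {V : Type*} [DecidableEq V] [Fintype V] {X : SimpleGraph V} [DecidableRel X.Adj]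
  (a b : Sym2 V → V)

theorem card_head_eq_le_degree (hab : ∀ e, s(a e, b e) = e) (σ : Sym2 V → Bool) (v : V) :
    #{e ∈ X.edgeFinset | head a b σ e = v} ≤ X.degree v := by
  rw [degree_eq_card_add_card a b hab]
  refine le_trans (card_le_card fun e he => ?_) (card_union_le _ _)
  rw [mem_filter] at he
  rw [mem_union, mem_filter, mem_filter, ← he.2]
  cases h : σ e <;> simp [head, h, he.1]

theorem isAcyclic_induce_of_card_head_eq_one (hab : ∀ e, s(a e, b e) = e) (σ : Sym2 V → Bool)
    (rk : V → ℕ) {T : Set V} (hT : ∀ v ∈ T, #{e ∈ X.edgeFinset | head a b σ e = v} = 1)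
    (hrk : ∀ v ∈ T, ∃ e ∈ X.edgeFinset, head a b σ e = v ∧ rk (tail a b σ e) < rk v) :
    (X.induce T).IsAcyclic := by
  have huniq : ∀ v ∈ T, ∀ e ∈ X.edgeFinset, ∀ e' ∈ X.edgeFinset, head a b σ e = v →
      head a b σ e' = v → e = e' := fun v hv e he e' he' h h' =>
    card_le_one.1 (hT v hv).le e (mem_filter.2 ⟨he, h⟩) e' (mem_filter.2 ⟨he', h'⟩)
  have hin : ∀ u ∈ T, ∀ v, X.Adj v u → rk u ≤ rk v → head a b σ s(v, u) = v := by
    intro u hu v hvu hle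
    have hmem : s(v, u) ∈ X.edgeFinset := SimpleGraph.mem_edgeFinset.2 hvu
    rcases head_eq_or_head_eq a b hab σ v u with h | h
    · exact h.1
    · obtain ⟨e, he, h1, h2⟩ := hrk u hu
      rw [← huniq u hu _ hmem e he h.1 h1, h.2] at h2
      omega
  refine isAcyclic_of_rank (fun v => rk v) fun v u w hu hw hru hrw => Subtype.ext ?_
  have h1 := huniq v v.2 _ (SimpleGraph.mem_edgeFinset.2 hu) _ (SimpleGraph.mem_edgeFinset.2 hw)
    (hin u u.2 v hu hru) (hin w w.2 v hw hrw)
  exact Sym2.congr_right.1 h1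

theorem exists_isAcyclic_induce (hab : ∀ e, s(a e, b e) = e) (hcubic : ∀ v, X.degree v = 3)
    (hX : CyclicallyConnected X 4) (hn : Fintype.card V % 4 = 0) (r : V) :
    ∃ T : Finset V, (X.induce (T : Set V)).IsAcyclic ∧ 3 * Fintype.card V ≤ 4 * #T + 4 := by
  obtain ⟨σ, hσ, hreach⟩ := exists_orientation_of_partition_condition a b _ univ X.edgeFinset r
    (fun _ => 1) rfl (mem_univ r) (by simp) (sum_partWeight_le a b hab hcubic hX hn r)
  obtain ⟨rk, hrk⟩ := exists_rank (head a b σ) (tail a b σ) X.edgeFinset univ r (by simp)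
    (mem_univ r) hreach
  set m : V → ℕ := fun v => #{e ∈ X.edgeFinset | head a b σ e = v} with hm
  have hm13 : ∀ v, m v = 1 ∨ m v = 3 := by
    intro v
    have h1 : m v % 2 = 1 := hσ v (mem_univ v)
    have h2 : m v ≤ 3 := hcubic v ▸ card_head_eq_le_degree a b hab σ v
    omega
  refine ⟨({v | m v = 1} : Finset V).erase r, isAcyclic_induce_of_card_head_eq_one a b hab σ rk
    (fun v hv => ?_) (fun v hv => ?_), ?_⟩
  · exact (mem_filter.1 (mem_erase.1 hv).2).2
  · exact hrk v (mem_univ v) (mem_erase.1 hv).1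
  · have h1 : #X.edgeFinset = ∑ v, m v := card_eq_sum_card_fiberwise (fun _ _ => mem_univ _)
    have h2 : ∑ v, m v + 2 * #{v | m v = 1} = 3 * Fintype.card V := by
      rw [card_filter, mul_sum, ← sum_add_distrib, ← card_univ, card_eq_sum_ones, mul_sum]
      refine sum_congr rfl fun v _ => ?_
      rcases hm13 v with h | h <;> simp [h]
    have h3 := X.sum_degrees_eq_twice_card_edges
    have h4 := pred_card_le_card_erase (s := ({v | m v = 1} : Finset V)) (a := r)
    simp only [hcubic, sum_const, smul_eq_mul, card_univ] at h3
    omega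

end Forest

end OrientationParity

/-- Payan–Sakarovitch: if `X` is a connected cyclically 4-connected cubic simple graph
on `n ≡ 0 (mod 4)` vertices and `S` is a maximum-size cyclically stable set, then
`|S| = (3n-4)/4` and either the subgraph induced by `S` is a tree and the subgraph
induced by the complement of `S` has exactly one edge, or the subgraph induced by `S`
is a forest with exactly two components and the complement of `S` is an independent
set of vertices. -/
theorem stmt8 {V : Type*} [Fintype V] (X : SimpleGraph V) [DecidableRel X.Adj]
    (hconn : X.Connected) (hcubic : ∀ v : V, X.degree v = 3)
    (hc4c : CyclicallyConnected X 4) (hn : Fintype.card V % 4 = 0)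
    (S : Finset V) (hS : (X.induce (↑S : Set V)).IsAcyclic)
    (hmax : ∀ T : Finset V, (X.induce (↑T : Set V)).IsAcyclic → T.card ≤ S.card) :
    4 * S.card = 3 * Fintype.card V - 4 ∧
      (((X.induce (↑S : Set V)).IsTree ∧
          Nat.card ((X.induce ((↑S : Set V)ᶜ)).edgeSet) = 1) ∨
        (Nat.card ((X.induce (↑S : Set V)).ConnectedComponent) = 2 ∧
          ((↑S : Set V)ᶜ).Pairwise (fun u v => ¬ X.Adj u v))) := by
  classical
  obtain ⟨r⟩ := hconn.nonempty
  set a : Sym2 V → V := fun e => (Quot.out e).1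
  set b : Sym2 V → V := fun e => (Quot.out e).2
  have hab : ∀ e, s(a e, b e) = e := fun e => Quot.out_eq e
  obtain ⟨T, hT, hTcard⟩ := OrientationParity.exists_isAcyclic_induce a b hab hcubic hc4c hn r
  have hST := hmax T hT
  have hV : 0 < Fintype.card V := Fintype.card_pos_iff.2 ⟨r⟩
  have hSne : S.Nonempty := Finset.card_pos.1 (by omega)
  have hne : Nonempty (X.induce (S : Set V)).ConnectedComponent :=
    ⟨(X.induce (S : Set V)).connectedComponentMk ⟨hSne.choose, hSne.choose_spec⟩⟩
  have hpos : 0 < Nat.card (X.induce (S : Set V)).ConnectedComponent := Nat.card_pos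
  have h1 := OrientationParity.sum_degree (X := X) a b hab S
  have h2 := X.sum_degrees_eq_twice_card_edges
  have h3 := OrientationParity.card_inside_add_inside_compl a b X.edgeFinset S
  have h4 := OrientationParity.card_inside_add_card_connectedComponent a b hab hS
  have h5 := OrientationParity.card_inside_edgeFinset (X := X) a b hab Sᶜ
  rw [Finset.coe_compl] at h5
  simp only [hcubic, Finset.sum_const, smul_eq_mul, Finset.card_univ] at h1 h2
  refine ⟨by omega, ?_⟩
  obtain ⟨h6, h7⟩ | ⟨h6, h7⟩ : Nat.card (X.induce (S : Set V)).ConnectedComponent = 1 ∧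
      Nat.card (X.induce (S : Set V)ᶜ).edgeSet = 1 ∨
      Nat.card (X.induce (S : Set V)).ConnectedComponent = 2 ∧
      Nat.card (X.induce (S : Set V)ᶜ).edgeSet = 0 := by omega
  · refine Or.inl ⟨⟨?_, hS⟩, h7⟩
    have : Nonempty (S : Set V) := ⟨⟨hSne.choose, hSne.choose_spec⟩⟩
    have := (Nat.card_eq_one_iff_unique.1 h6).1
    exact ⟨fun u v => SimpleGraph.ConnectedComponent.exact (Subsingleton.elim _ _)⟩
  · refine Or.inr ⟨h6, fun u hu v hv _ huv => ?_⟩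
    have := (Nat.card_eq_zero.1 h7).resolve_right (not_infinite_iff_finite.2 inferInstance)
    have hadj : (X.induce (S : Set V)ᶜ).Adj ⟨u, hu⟩ ⟨v, hv⟩ := huv
    exact this.elim ⟨s(⟨u, hu⟩, ⟨v, hv⟩), hadj⟩
end
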